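/- Let N ≥ 2, let Ω ⊂ ℝ^N be a bounded domain with C³ boundary and unit volume, p ∈ (1, p_N), λ ≥ 0, and let (α, ψ) be a solution of problem (P)_λ on Ω which is variational in the following sense: writing ρ_λ = (max(α + λψ, 0))^p, for every measurable ρ : Ω → ℝ with ρ ≥ 0 a.e., ∫_Ω ρ = 1 and ρ^{1+1/p} integrable, and for every w ∈ C²(Ω̄) with w = 0 on ∂Ω and −Δw = ρ in Ω, one has (p/(p+1)) ∫_Ω ρ^{1+1/p} − (λ/2) ∫_Ω ρ w ≥ (p/(p+1)) ∫_Ω ρ_λ^{1+1/p} − (λ/2) ∫_Ω ρ_λ ψ. Then every eigenvalue σ of the linearized operator L_λ at (α, ψ) satisfies σ ≥ 0. -/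

import Mathlib

open MeasureTheory Metric Set

noncomputable section

/-- The Laplacian of a function on Euclidean space. -/
def lapl {N : ℕ} (f : EuclideanSpace ℝ (Fin N) → ℝ) (x : EuclideanSpace ℝ (Fin N)) : ℝ :=
  ∑ i : Fin N,
    fderiv ℝ (fun y => fderiv ℝ f y (EuclideanSpace.single i (1 : ℝ))) x
      (EuclideanSpace.single i (1 : ℝ))

/-- `(α, ψ)` is a solution of problem `(P)_λ` on `Ω`:
`ψ ∈ C²`, `-Δψ = (max (α + λψ) 0)^p` in `Ω`, `ψ = 0` on `∂Ω`, and
`∫_Ω (max (α + λψ) 0)^p = 1`. -/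
def IsSol {N : ℕ} (Ω : Set (EuclideanSpace ℝ (Fin N))) (p lam α : ℝ)
    (ψ : EuclideanSpace ℝ (Fin N) → ℝ) : Prop :=
  ContDiff ℝ 2 ψ ∧
  (∀ x ∈ Ω, -lapl ψ x = (max (α + lam * ψ x) 0) ^ p) ∧
  (∀ x ∈ frontier Ω, ψ x = 0) ∧
  (∫ x in Ω, (max (α + lam * ψ x) 0) ^ p) = 1

/-- The weight `V = (max (α + λψ) 0)^(p-1)`. -/
def Vfun {N : ℕ} (p lam α : ℝ) (ψ : EuclideanSpace ℝ (Fin N) → ℝ)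
    (x : EuclideanSpace ℝ (Fin N)) : ℝ :=
  (max (α + lam * ψ x) 0) ^ (p - 1)

/-- `m = ∫_Ω V`. -/
def mV {N : ℕ} (Ω : Set (EuclideanSpace ℝ (Fin N))) (p lam α : ℝ)
    (ψ : EuclideanSpace ℝ (Fin N) → ℝ) : ℝ :=
  ∫ x in Ω, Vfun p lam α ψ x

/-- The weighted average `⟨φ⟩ = (∫_Ω V φ) / m`. -/
def avgV {N : ℕ} (Ω : Set (EuclideanSpace ℝ (Fin N))) (p lam α : ℝ)
    (ψ φ : EuclideanSpace ℝ (Fin N) → ℝ) : ℝ :=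
  (∫ x in Ω, Vfun p lam α ψ x * φ x) / mV Ω p lam α ψ

/-- `σ` is an eigenvalue of the linearized operator `L_λ` at the solution `(α, ψ)`:
there is a nontrivial `φ ∈ C²(Ω̄)` vanishing on `∂Ω` with `-Δφ = (pλ + σ) V [φ]` in `Ω`. -/
def IsEigen {N : ℕ} (Ω : Set (EuclideanSpace ℝ (Fin N))) (p lam α : ℝ)
    (ψ : EuclideanSpace ℝ (Fin N) → ℝ) (σ : ℝ) : Prop :=
  ∃ φ : EuclideanSpace ℝ (Fin N) → ℝ, ContDiff ℝ 2 φ ∧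
    (∃ x ∈ closure Ω, φ x ≠ 0) ∧ (∀ x ∈ frontier Ω, φ x = 0) ∧
    ∀ x ∈ Ω, -lapl φ x = (p * lam + σ) * (Vfun p lam α ψ x * (φ x - avgV Ω p lam α ψ φ))

/-- `Ω` is a bounded domain of class `C³`: open, connected, bounded, and near every
boundary point `Ω` is the sublevel set of a `C³` function with nonvanishing gradient. -/
def IsC3Domain {N : ℕ} (Ω : Set (EuclideanSpace ℝ (Fin N))) : Prop :=
  IsOpen Ω ∧ IsConnected Ω ∧ Bornology.IsBounded Ω ∧
  ∀ x ∈ frontier Ω, ∃ (U : Set (EuclideanSpace ℝ (Fin N)))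
      (f : EuclideanSpace ℝ (Fin N) → ℝ),
    IsOpen U ∧ x ∈ U ∧ ContDiff ℝ 3 f ∧ (∀ y ∈ U, fderiv ℝ f y ≠ 0) ∧
    Ω ∩ U = {y ∈ U | f y < 0}

/-- Euclidean space of dimension `N`. -/
abbrev Eucl (N : ℕ) : Type := EuclideanSpace ℝ (Fin N)

/-- The partial derivative of `f` in the `i`-th coordinate direction. -/
def pd {N : ℕ} (i : Fin N) (f : Eucl N → ℝ) (x : Eucl N) : ℝ :=
  fderiv ℝ f x (EuclideanSpace.single i (1 : ℝ))

section Calculus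

variable {N : ℕ}

theorem lapl_eq_sum_pd (f : Eucl N → ℝ) (x : Eucl N) : lapl f x = ∑ i, pd i (pd i f) x := rfl

theorem ContDiff.pd {n m : WithTop ℕ∞} {f : Eucl N → ℝ} (hf : ContDiff ℝ n f) (hmn : m + 1 ≤ n)
    (i : Fin N) : ContDiff ℝ m (pd i f) :=
  (hf.fderiv_right hmn).clm_apply contDiff_const

theorem ContDiff.pd_one {f : Eucl N → ℝ} (hf : ContDiff ℝ 2 f) (i : Fin N) :
    ContDiff ℝ 1 (_root_.pd i f) :=
  hf.pd (by norm_num [one_add_one_eq_two]) i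

theorem ContDiff.differentiableAt_pd {f : Eucl N → ℝ} (hf : ContDiff ℝ 2 f) (i : Fin N)
    (x : Eucl N) : DifferentiableAt ℝ (_root_.pd i f) x :=
  ((hf.pd_one i).differentiable (by norm_num)) x

theorem ContDiff.continuous_pd {f : Eucl N → ℝ} (hf : ContDiff ℝ 1 f) (i : Fin N) :
    Continuous (_root_.pd i f) :=
  (hf.pd (m := 0) (by norm_num) i).continuous

theorem ContDiff.differentiableAt_two {f : Eucl N → ℝ} (hf : ContDiff ℝ 2 f) (x : Eucl N) :
    DifferentiableAt ℝ f x := hf.differentiable (by norm_num) x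

theorem ContDiff.continuous_lapl {f : Eucl N → ℝ} (hf : ContDiff ℝ 2 f) : Continuous (lapl f) := by
  show Continuous fun x => ∑ i, _root_.pd i (_root_.pd i f) x
  exact continuous_finsetSum _ fun i _ => (hf.pd_one i).continuous_pd i

theorem pd_congr_of_eventuallyEq {f g : Eucl N → ℝ} {x : Eucl N} (h : f =ᶠ[nhds x] g)
    (i : Fin N) : pd i f x = pd i g x := by
  simp only [pd, h.fderiv_eq]

theorem pd_eventuallyEq {f g : Eucl N → ℝ} {x : Eucl N} (h : f =ᶠ[nhds x] g)
    (i : Fin N) : pd i f =ᶠ[nhds x] pd i g :=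
  h.eventuallyEq_nhds.mono fun _ hy => pd_congr_of_eventuallyEq hy i

theorem lapl_congr_of_eventuallyEq {f g : Eucl N → ℝ} {x : Eucl N} (h : f =ᶠ[nhds x] g) :
    lapl f x = lapl g x := by
  simp only [lapl_eq_sum_pd]
  exact Finset.sum_congr rfl fun i _ => pd_congr_of_eventuallyEq (pd_eventuallyEq h i) i

theorem pd_const (c : ℝ) (i : Fin N) (x : Eucl N) : pd i (fun _ => c) x = 0 := by
  simp [pd]

theorem pd_add {f g : Eucl N → ℝ} {x : Eucl N} (hf : DifferentiableAt ℝ f x)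
    (hg : DifferentiableAt ℝ g x) (i : Fin N) :
    pd i (fun y => f y + g y) x = pd i f x + pd i g x := by
  simp only [pd]; rw [fderiv_fun_add hf hg]; simp

theorem pd_sub {f g : Eucl N → ℝ} {x : Eucl N} (hf : DifferentiableAt ℝ f x)
    (hg : DifferentiableAt ℝ g x) (i : Fin N) :
    pd i (fun y => f y - g y) x = pd i f x - pd i g x := by
  simp only [pd]; rw [fderiv_fun_sub hf hg]; simp

theorem pd_mul {f g : Eucl N → ℝ} {x : Eucl N} (hf : DifferentiableAt ℝ f x)
    (hg : DifferentiableAt ℝ g x) (i : Fin N) :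
    pd i (fun y => f y * g y) x = pd i f x * g x + f x * pd i g x := by
  simp only [pd]; rw [fderiv_fun_mul hf hg]; simp; ring

theorem pd_const_mul (c : ℝ) {f : Eucl N → ℝ} {x : Eucl N} (hf : DifferentiableAt ℝ f x)
    (i : Fin N) : pd i (fun y => c * f y) x = c * pd i f x := by
  simp only [pd]; rw [fderiv_const_mul hf]; simp

theorem pd_sum {ι : Type*} (s : Finset ι) {f : ι → Eucl N → ℝ} {x : Eucl N}
    (hf : ∀ j ∈ s, DifferentiableAt ℝ (f j) x) (i : Fin N) :
    pd i (fun y => ∑ j ∈ s, f j y) x = ∑ j ∈ s, pd i (f j) x := by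
  simp only [pd]; rw [fderiv_fun_sum hf]; simp

theorem pd_comp {g : ℝ → ℝ} {g' : ℝ} {f : Eucl N → ℝ} {x : Eucl N} (hg : HasDerivAt g g' (f x))
    (hf : DifferentiableAt ℝ f x) (i : Fin N) :
    pd i (fun y => g (f y)) x = g' * pd i f x := by
  have := (hg.comp_hasFDerivAt x hf.hasFDerivAt).fderiv
  simp only [pd]
  rw [show (fun y => g (f y)) = g ∘ f from rfl, this]; simp

theorem pd_coord (i j : Fin N) (x : Eucl N) :
    pd i (fun y : Eucl N => y j) x = if i = j then 1 else 0 := by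
  have : (fun y : Eucl N => y j) = (EuclideanSpace.proj j : Eucl N →L[ℝ] ℝ) := rfl
  simp only [pd]
  rw [this, ContinuousLinearMap.fderiv]
  simp [eq_comm]

theorem differentiableAt_coord (j : Fin N) (x : Eucl N) :
    DifferentiableAt ℝ (fun y : Eucl N => y j) x :=
  (EuclideanSpace.proj j : Eucl N →L[ℝ] ℝ).differentiableAt

theorem contDiff_coord {n : WithTop ℕ∞} (j : Fin N) :
    ContDiff ℝ n (fun y : Eucl N => y j) :=
  (EuclideanSpace.proj j : Eucl N →L[ℝ] ℝ).contDiff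

theorem pd_norm_sq (i : Fin N) (x : Eucl N) : pd i (fun y : Eucl N => ‖y‖ ^ 2) x = 2 * x i := by
  have h : (fun y : Eucl N => ‖y‖ ^ 2) = fun y => ∑ j, y j * y j := by
    funext y; rw [EuclideanSpace.norm_sq_eq]; simp [sq]
  rw [h, pd_sum _ fun j _ => (differentiableAt_coord j x).fun_mul (differentiableAt_coord j x)]
  simp [pd_mul (differentiableAt_coord _ x) (differentiableAt_coord _ x), pd_coord]
  rw [Finset.sum_eq_single i]
  · simp; ring
  · intro b _ hb; simp [hb.symm]
  · simp

theorem differentiableAt_norm_sq (x : Eucl N) :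
    DifferentiableAt ℝ (fun y : Eucl N => ‖y‖ ^ 2) x :=
  (contDiff_norm_sq ℝ (n := 1)).differentiable (by norm_num) x

theorem pd_comp_affine {f : Eucl N → ℝ} (a : Eucl N) (s : ℝ) {x : Eucl N}
    (hf : DifferentiableAt ℝ f (a + s • x)) (i : Fin N) :
    pd i (fun y => f (a + s • y)) x = s * pd i f (a + s • x) := by
  have h1 : HasFDerivAt (fun y : Eucl N => a + s • y) (s • ContinuousLinearMap.id ℝ (Eucl N)) x :=
    ((hasFDerivAt_id x).const_smul s).const_add a
  have := (hf.hasFDerivAt.comp x h1).fderiv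
  simp only [pd]
  rw [show (fun y => f (a + s • y)) = f ∘ (fun y => a + s • y) from rfl, this]
  simp

theorem lapl_add {f g : Eucl N → ℝ} (hf : ContDiff ℝ 2 f) (hg : ContDiff ℝ 2 g) (x : Eucl N) :
    lapl (fun y => f y + g y) x = lapl f x + lapl g x := by
  simp only [lapl_eq_sum_pd, ← Finset.sum_add_distrib]
  refine Finset.sum_congr rfl fun i _ => ?_
  rw [show pd i (fun y => f y + g y) = fun y => pd i f y + pd i g y from
    funext fun y => pd_add (hf.differentiableAt_two y) (hg.differentiableAt_two y) i]
  exact pd_add (hf.differentiableAt_pd i x) (hg.differentiableAt_pd i x) i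

theorem lapl_const_mul (c : ℝ) {f : Eucl N → ℝ} (hf : ContDiff ℝ 2 f) (x : Eucl N) :
    lapl (fun y => c * f y) x = c * lapl f x := by
  simp only [lapl_eq_sum_pd, Finset.mul_sum]
  refine Finset.sum_congr rfl fun i _ => ?_
  rw [show pd i (fun y => c * f y) = fun y => c * pd i f y from
    funext fun y => pd_const_mul c (hf.differentiableAt_two y) i]
  exact pd_const_mul c (hf.differentiableAt_pd i x) i

theorem lapl_const (c : ℝ) (x : Eucl N) : lapl (fun _ : Eucl N => c) x = 0 := by
  simp only [lapl_eq_sum_pd]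
  refine Finset.sum_eq_zero fun i _ => ?_
  rw [show pd i (fun _ : Eucl N => c) = fun _ => 0 from funext fun y => pd_const c i y]
  exact pd_const 0 i x

theorem lapl_neg {f : Eucl N → ℝ} (hf : ContDiff ℝ 2 f) (x : Eucl N) :
    lapl (fun y => - f y) x = - lapl f x := by
  have := lapl_const_mul (-1) hf x
  simpa using this

theorem lapl_sub {f g : Eucl N → ℝ} (hf : ContDiff ℝ 2 f) (hg : ContDiff ℝ 2 g) (x : Eucl N) :
    lapl (fun y => f y - g y) x = lapl f x - lapl g x := by
  have := lapl_add hf hg.neg x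
  simp only [sub_eq_add_neg]
  rw [← lapl_neg hg]; exact this

theorem lapl_sum {ι : Type*} (s : Finset ι) {f : ι → Eucl N → ℝ}
    (hf : ∀ j ∈ s, ContDiff ℝ 2 (f j)) (x : Eucl N) :
    lapl (fun y => ∑ j ∈ s, f j y) x = ∑ j ∈ s, lapl (f j) x := by
  classical
  induction s using Finset.induction_on with
  | empty => simpa using lapl_const 0 x
  | insert a s ha ih =>
    simp only [Finset.sum_insert ha]
    rw [lapl_add (hf a (by simp)) (ContDiff.sum fun j hj => hf j (by simp [hj])),
      ih fun j hj => hf j (by simp [hj])]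

theorem lapl_comp_affine {f : Eucl N → ℝ} (hf : ContDiff ℝ 2 f) (a : Eucl N) (s : ℝ)
    (x : Eucl N) : lapl (fun y => f (a + s • y)) x = s ^ 2 * lapl f (a + s • x) := by
  simp only [lapl_eq_sum_pd, Finset.mul_sum]
  refine Finset.sum_congr rfl fun i _ => ?_
  rw [show pd i (fun y => f (a + s • y)) = fun y => s * pd i f (a + s • y) from
    funext fun y => pd_comp_affine a s (hf.differentiableAt_two _) i]
  have h : DifferentiableAt ℝ (fun y => pd i f (a + s • y)) x :=
    (hf.differentiableAt_pd i _).comp x (by fun_prop)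
  rw [pd_const_mul s h, pd_comp_affine a s (hf.differentiableAt_pd i _)]
  ring

theorem lapl_comp {g g' g'' : ℝ → ℝ} (hg : ∀ s, HasDerivAt g (g' s) s)
    (hg' : ∀ s, HasDerivAt g' (g'' s) s) {f : Eucl N → ℝ} (hf : ContDiff ℝ 2 f) (x : Eucl N) :
    lapl (fun y => g (f y)) x = g'' (f x) * (∑ i, pd i f x ^ 2) + g' (f x) * lapl f x := by
  simp only [lapl_eq_sum_pd, Finset.mul_sum, ← Finset.sum_add_distrib]
  refine Finset.sum_congr rfl fun i _ => ?_
  rw [show pd i (fun y => g (f y)) = fun y => g' (f y) * pd i f y from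
    funext fun y => pd_comp (hg _) (hf.differentiableAt_two y) i]
  have h : DifferentiableAt ℝ (fun y => g' (f y)) x :=
    (hg' _).differentiableAt.comp x (hf.differentiableAt_two x)
  rw [pd_mul h (hf.differentiableAt_pd i _), pd_comp (hg' _) (hf.differentiableAt_two x)]
  ring

theorem lapl_norm_sq (x : Eucl N) : lapl (fun y : Eucl N => ‖y‖ ^ 2) x = 2 * N := by
  simp only [lapl_eq_sum_pd]
  have : ∀ i : Fin N, pd i (pd i fun y : Eucl N => ‖y‖ ^ 2) x = 2 := by
    intro i
    rw [show pd i (fun y : Eucl N => ‖y‖ ^ 2) = fun y => 2 * y i from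
      funext fun y => pd_norm_sq i y, pd_const_mul 2 (differentiableAt_coord i x), pd_coord]
    simp
  simp [this, mul_comm]

theorem sum_coord_sq (x : Eucl N) : ∑ i, x i ^ 2 = ‖x‖ ^ 2 := by
  rw [EuclideanSpace.norm_sq_eq]; simp

theorem lapl_mul {f g : Eucl N → ℝ} (hf : ContDiff ℝ 2 f) (hg : ContDiff ℝ 2 g) (x : Eucl N) :
    lapl (fun y => f y * g y) x
      = lapl f x * g x + 2 * (∑ i, pd i f x * pd i g x) + f x * lapl g x := by
  simp only [lapl_eq_sum_pd, Finset.mul_sum, Finset.sum_mul, ← Finset.sum_add_distrib]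
  refine Finset.sum_congr rfl fun i _ => ?_
  rw [show pd i (fun y => f y * g y) = fun y => pd i f y * g y + f y * pd i g y from
    funext fun y => pd_mul (hf.differentiableAt_two y) (hg.differentiableAt_two y) i]
  have hf1 := hf.differentiableAt_two x
  have hg1 := hg.differentiableAt_two x
  have hf2 := hf.differentiableAt_pd i x
  have hg2 := hg.differentiableAt_pd i x
  rw [pd_add (hf2.fun_mul hg1) (hf1.fun_mul hg2), pd_mul hf2 hg1, pd_mul hf1 hg2]
  ring

/-- The integral of a partial derivative of a compactly supported `C¹` function vanishes. -/
theorem integral_pd_eq_zero {f : Eucl N → ℝ} (hf : ContDiff ℝ 1 f) (hs : HasCompactSupport f)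
    (i : Fin N) : ∫ x, pd i f x = 0 := by
  have hc : Continuous (pd i f) := hf.continuous_pd i
  have hcs : HasCompactSupport (pd i f) :=
    hs.fderiv_apply (𝕜 := ℝ) (EuclideanSpace.single i (1 : ℝ))
  have hintegral := hc.integrable_of_hasCompactSupport (μ := volume) hcs
  obtain ⟨r, hr⟩ := hs.isCompact.isBounded.subset_closedBall (0 : Eucl N)
  obtain ⟨g, hg1, hg2⟩ : ∃ g : Eucl N → ℝ, (ContDiff ℝ 1 g ∧ HasCompactSupport g) ∧
      ∀ x ∈ closedBall (0 : Eucl N) (|r| + 1), g x = 1 := by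
    let b : ContDiffBump (0 : Eucl N) := ⟨|r| + 1, |r| + 2, by positivity, by linarith⟩
    exact ⟨b, ⟨b.contDiff, b.hasCompactSupport⟩, fun x hx => b.one_of_mem_closedBall hx⟩
  have key := integral_mul_fderiv_eq_neg_fderiv_mul_of_integrable (μ := (volume : Measure (Eucl N)))
    (f := g) (g := f) (v := EuclideanSpace.single i (1 : ℝ)) ?_ ?_ ?_
    (fun x _ => hg1.1.differentiable (by norm_num) x)
    (fun x _ => hf.differentiable (by norm_num) x)
  · have h1 : ∀ x, g x * fderiv ℝ f x (EuclideanSpace.single i 1) = pd i f x := by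
      intro x
      by_cases hx : x ∈ tsupport f
      · rw [hg2 x (closedBall_subset_closedBall (by linarith [le_abs_self r]) (hr hx)), one_mul]
        rfl
      · have : fderiv ℝ f x = 0 := by
          by_contra h
          exact hx (support_fderiv_subset ℝ h)
        simp [pd, this]
    have h2 : ∀ x, fderiv ℝ g x (EuclideanSpace.single i 1) * f x = 0 := by
      intro x
      by_cases hx : x ∈ tsupport f
      · have hx' : x ∈ ball (0 : Eucl N) (|r| + 1) := by
          have := hr hx
          simp only [mem_closedBall, mem_ball] at this ⊢
          linarith [le_abs_self r]
        have : g =ᶠ[nhds x] fun _ => 1 :=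
          Filter.eventuallyEq_of_mem (isOpen_ball.mem_nhds hx') fun y hy =>
            hg2 y (ball_subset_closedBall hy)
        simp [this.fderiv_eq]
      · simp [image_eq_zero_of_notMem_tsupport hx]
    simp only [h1, h2] at key
    simpa using key
  · exact (((hg1.1.continuous_fderiv (by norm_num)).clm_apply continuous_const).mul
      hf.continuous).integrable_of_hasCompactSupport (hs.mul_left)
  · exact (hg1.1.continuous.mul ((hf.continuous_fderiv (by norm_num)).clm_apply
      continuous_const)).integrable_of_hasCompactSupport (hg1.2.mul_right)
  · exact (hg1.1.continuous.mul hf.continuous).integrable_of_hasCompactSupport (hs.mul_left)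

end Calculus

/-- The `k`-th power of the positive part. -/
def posPow (k : ℕ) (s : ℝ) : ℝ := (max s 0) ^ k

theorem posPow_nonneg (k : ℕ) (s : ℝ) : 0 ≤ posPow k s := pow_nonneg (le_max_right _ _) k

theorem posPow_of_nonneg {s : ℝ} (hs : 0 ≤ s) (k : ℕ) : posPow k s = s ^ k := by
  simp [posPow, hs]

theorem posPow_of_nonpos {s : ℝ} (hs : s ≤ 0) {k : ℕ} (hk : k ≠ 0) : posPow k s = 0 := by
  simp [posPow, hs, hk]

theorem mul_posPow (k : ℕ) (hk : k ≠ 0) (s : ℝ) : s * posPow k s = posPow (k + 1) s := by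
  rcases le_total 0 s with h | h
  · rw [posPow_of_nonneg h, posPow_of_nonneg h]; ring
  · rw [posPow_of_nonpos h hk, posPow_of_nonpos h (by omega)]; ring

theorem continuous_posPow (k : ℕ) : Continuous (posPow k) := by
  unfold posPow; fun_prop

theorem posPow_mono (k : ℕ) {s t : ℝ} (h : s ≤ t) : posPow k s ≤ posPow k t :=
  pow_le_pow_left₀ (le_max_right _ _) (max_le_max_right 0 h) k

theorem hasDerivAt_posPow {k : ℕ} (hk : 1 ≤ k) (s : ℝ) :
    HasDerivAt (posPow (k + 1)) ((k + 1) * posPow k s) s := by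
  rcases lt_trichotomy s 0 with h | h | h
  · have : posPow (k + 1) =ᶠ[nhds s] fun _ => 0 :=
      Filter.eventuallyEq_of_mem (Iio_mem_nhds h) fun y hy =>
        posPow_of_nonpos (le_of_lt hy) (by omega)
    rw [posPow_of_nonpos h.le (by omega), mul_zero]
    exact (hasDerivAt_const s 0).congr_of_eventuallyEq this
  · subst h
    rw [posPow_of_nonpos le_rfl (by omega), mul_zero, hasDerivAt_iff_isLittleO]
    have h1 : (fun x' : ℝ => posPow (k + 1) x' - posPow (k + 1) 0 - (x' - 0) • (0 : ℝ))
        = fun x' => posPow (k + 1) x' := by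
      funext y; simp [posPow_of_nonpos le_rfl (show k + 1 ≠ 0 by omega)]
    rw [h1]
    simp only [sub_zero]
    have h2 : (fun x : ℝ => posPow (k + 1) x) =O[nhds 0] fun x : ℝ => x ^ (k + 1) := by
      refine Asymptotics.isBigO_of_le _ fun x => ?_
      rw [Real.norm_of_nonneg (posPow_nonneg _ _), norm_pow, Real.norm_eq_abs]
      exact pow_le_pow_left₀ (le_max_right _ _) (max_le (le_abs_self x) (abs_nonneg x)) _
    exact h2.trans_isLittleO (by simpa using
      (Asymptotics.isLittleO_pow_pow (𝕜 := ℝ) (m := 1) (n := k + 1) (by omega)))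
  · have : posPow (k + 1) =ᶠ[nhds s] fun y => y ^ (k + 1) :=
      Filter.eventuallyEq_of_mem (Ioi_mem_nhds h) fun y hy => posPow_of_nonneg (le_of_lt hy) _
    rw [posPow_of_nonneg h.le]
    have := (hasDerivAt_pow (k + 1) s).congr_of_eventuallyEq this
    simpa using this

theorem deriv_posPow {k : ℕ} (hk : 1 ≤ k) :
    deriv (posPow (k + 1)) = fun s => (k + 1) * posPow k s :=
  funext fun s => (hasDerivAt_posPow hk s).deriv

theorem contDiff_posPow_one {k : ℕ} (hk : 1 ≤ k) : ContDiff ℝ 1 (posPow (k + 1)) := by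
  rw [contDiff_one_iff_deriv, deriv_posPow hk]
  exact ⟨fun s => (hasDerivAt_posPow hk s).differentiableAt,
    continuous_const.mul (continuous_posPow k)⟩

theorem contDiff_posPow_two {k : ℕ} (hk : 2 ≤ k) : ContDiff ℝ 2 (posPow (k + 1)) := by
  rw [show (2 : WithTop ℕ∞) = 1 + 1 by norm_num, contDiff_succ_iff_deriv, deriv_posPow (by omega)]
  refine ⟨fun s => (hasDerivAt_posPow (by omega) s).differentiableAt, by simp, ?_⟩
  obtain ⟨j, rfl⟩ : ∃ j, k = j + 1 := ⟨k - 1, by omega⟩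
  exact contDiff_const.mul (contDiff_posPow_one (by omega))

section Weights

variable {N : ℕ}

/-- The radial weight `(r² - |x|²)₊ᵏ`. -/
def ballWeight (k : ℕ) (r : ℝ) (x : Eucl N) : ℝ := posPow k (r ^ 2 - ‖x‖ ^ 2)

theorem ballWeight_nonneg (k : ℕ) (r : ℝ) (x : Eucl N) : 0 ≤ ballWeight k r x :=
  posPow_nonneg _ _

theorem ballWeight_eq_zero {k : ℕ} (hk : k ≠ 0) {r : ℝ} {x : Eucl N} (hx : |r| ≤ ‖x‖) :
    ballWeight k r x = 0 :=
  posPow_of_nonpos (by rw [← sq_abs r]; nlinarith [abs_nonneg r]) hk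

theorem ballWeight_pos {k : ℕ} {r : ℝ} {x : Eucl N} (hx : ‖x‖ < |r|) :
    0 < ballWeight k r x := by
  have : 0 < r ^ 2 - ‖x‖ ^ 2 := by rw [← sq_abs r]; nlinarith [norm_nonneg x]
  rw [ballWeight, posPow_of_nonneg this.le]
  positivity

theorem continuous_ballWeight (k : ℕ) (r : ℝ) : Continuous (ballWeight (N := N) k r) :=
  (continuous_posPow k).comp (by fun_prop)

theorem hasCompactSupport_ballWeight {k : ℕ} (hk : k ≠ 0) (r : ℝ) :
    HasCompactSupport (ballWeight (N := N) k r) :=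
  HasCompactSupport.intro (isCompact_closedBall (0 : Eucl N) |r|) fun x hx =>
    ballWeight_eq_zero hk (by simpa using (not_le.1 (by simpa using hx)).le)

theorem contDiff_ballWeight_one {k : ℕ} (hk : 1 ≤ k) (r : ℝ) :
    ContDiff ℝ 1 (ballWeight (N := N) (k + 1) r) :=
  (contDiff_posPow_one hk).comp (contDiff_const.sub (contDiff_norm_sq ℝ))

theorem pd_ballWeight {k : ℕ} (hk : 1 ≤ k) (r : ℝ) (i : Fin N) (x : Eucl N) :
    pd i (ballWeight (k + 1) r) x = -2 * (k + 1) * (x i * ballWeight k r x) := by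
  have h := pd_comp (f := fun y : Eucl N => r ^ 2 - ‖y‖ ^ 2) (x := x) (hasDerivAt_posPow hk _)
    ((differentiableAt_const _).sub (differentiableAt_norm_sq x)) i
  rw [pd_sub (differentiableAt_const _) (differentiableAt_norm_sq x), pd_const, pd_norm_sq] at h
  simp only [ballWeight] at h ⊢
  rw [show ballWeight (N := N) (k + 1) r = fun y => posPow (k + 1) (r ^ 2 - ‖y‖ ^ 2) from rfl, h]
  ring

theorem integrable_mul_ballWeight {F : Eucl N → ℝ} (hF : Continuous F) {k : ℕ} (hk : k ≠ 0)
    (r : ℝ) : Integrable fun x => F x * ballWeight k r x :=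
  (hF.mul (continuous_ballWeight k r)).integrable_of_hasCompactSupport
    (hasCompactSupport_ballWeight hk r).mul_left

/-- Divergence theorem against a radial weight. -/
theorem integral_div_mul_ballWeight {X : Fin N → Eucl N → ℝ} (hX : ∀ i, ContDiff ℝ 1 (X i))
    {k : ℕ} (hk : 1 ≤ k) (r : ℝ) :
    ∫ x, (∑ i, pd i (X i) x) * ballWeight (k + 1) r x
      = 2 * (k + 1) * ∫ x, (∑ i, X i x * x i) * ballWeight k r x := by
  have h0 : ∀ i, ∫ x, pd i (fun y => X i y * ballWeight (k + 1) r y) x = 0 := fun i =>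
    integral_pd_eq_zero ((hX i).mul (contDiff_ballWeight_one hk r))
      (hasCompactSupport_ballWeight (by omega) r).mul_left i
  have h1 : ∀ i x, pd i (fun y => X i y * ballWeight (k + 1) r y) x
      = pd i (X i) x * ballWeight (k + 1) r x
        - 2 * (k + 1) * (X i x * x i * ballWeight k r x) := by
    intro i x
    rw [pd_mul ((hX i).differentiable (by norm_num) x)
      ((contDiff_ballWeight_one hk r).differentiable (by norm_num) x), pd_ballWeight hk]
    ring
  have hi1 : ∀ i, Integrable fun x => pd i (X i) x * ballWeight (k + 1) r x := fun i =>
    integrable_mul_ballWeight ((hX i).continuous_pd i) (by omega) r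
  have hi2 : ∀ i, Integrable fun x => X i x * x i * ballWeight k r x := fun i =>
    integrable_mul_ballWeight ((hX i).continuous.mul (by fun_prop)) (by omega) r
  have h2 : ∀ i, ∫ x, pd i (X i) x * ballWeight (k + 1) r x
      = 2 * (k + 1) * ∫ x, X i x * x i * ballWeight k r x := by
    intro i
    have := h0 i
    simp only [h1] at this
    rw [integral_sub (hi1 i) ((hi2 i).const_mul _), integral_const_mul] at this
    linarith
  simp only [Finset.sum_mul]
  rw [integral_finsetSum _ fun i _ => hi1 i, integral_finsetSum _ fun i _ => hi2 i,
    Finset.mul_sum]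
  exact Finset.sum_congr rfl fun i _ => h2 i

theorem hasDerivAt_integral_mul_ballWeight {F : Eucl N → ℝ} (hF : Continuous F) {k : ℕ}
    (hk : 1 ≤ k) (r : ℝ) :
    HasDerivAt (fun r => ∫ x, F x * ballWeight (k + 1) r x)
      (2 * (k + 1) * r * ∫ x, F x * ballWeight k r x) r := by
  have hd : ∀ (x : Eucl N) (r : ℝ), HasDerivAt (fun r => F x * ballWeight (k + 1) r x)
      (F x * (2 * (k + 1) * r * ballWeight k r x)) r := by
    intro x r
    have h1 : HasDerivAt (fun r : ℝ => r ^ 2 - ‖x‖ ^ 2) (2 * r) r := by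
      simpa using (hasDerivAt_pow 2 r).sub_const (‖x‖ ^ 2)
    have := ((hasDerivAt_posPow hk _).comp r h1).const_mul (F x)
    exact this.congr_deriv (by simp only [ballWeight]; ring)
  have key := (hasDerivAt_integral_of_dominated_loc_of_deriv_le (μ := (volume : Measure (Eucl N)))
    (F := fun r x => F x * ballWeight (k + 1) r x)
    (F' := fun r x => F x * (2 * (k + 1) * r * ballWeight k r x)) (x₀ := r) (s := ball r 1)
    (bound := fun x => |F x| * (2 * (k + 1) * (|r| + 1) * ballWeight k (|r| + 1) x))
    (ball_mem_nhds r one_pos) ?_ ?_ ?_ ?_ ?_ ?_).2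
  · refine key.congr_deriv ?_
    rw [← integral_const_mul]
    congr 1; funext x; ring
  · exact Filter.Eventually.of_forall fun r =>
      (hF.mul (continuous_ballWeight _ r)).aestronglyMeasurable
  · exact integrable_mul_ballWeight hF (by omega) r
  · exact (hF.mul (continuous_const.mul (continuous_ballWeight _ r))).aestronglyMeasurable
  · refine Filter.Eventually.of_forall fun x y hy => ?_
    have hy' : |y| ≤ |r| + 1 := by
      have := abs_sub_abs_le_abs_sub y r
      rw [mem_ball, Real.dist_eq] at hy; linarith
    rw [norm_mul, norm_mul, norm_mul, Real.norm_eq_abs, Real.norm_eq_abs,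
      Real.norm_of_nonneg (ballWeight_nonneg k y x), Real.norm_eq_abs,
      abs_of_nonneg (by positivity : (0:ℝ) ≤ 2 * (k + 1))]
    have hb : ballWeight k y x ≤ ballWeight k (|r| + 1) x := by
      refine posPow_mono k ?_
      rw [← sq_abs y]; nlinarith [abs_nonneg y]
    have := ballWeight_nonneg k y x
    gcongr
  · have := integrable_mul_ballWeight (F := fun x => |F x| * (2 * (k + 1) * (|r| + 1)))
      (by fun_prop) (show k ≠ 0 by omega) (|r| + 1)
    simpa only [mul_assoc] using this
  · exact Filter.Eventually.of_forall fun x y _ => hd x y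

theorem integral_ballWeight_pos {k : ℕ} (hk : k ≠ 0) {r : ℝ} (hr : r ≠ 0) :
    0 < ∫ x, ballWeight (N := N) k r x := by
  have h := (continuous_ballWeight (N := N) k r).integral_pos_of_hasCompactSupport_nonneg_nonzero
    (μ := volume) (hasCompactSupport_ballWeight hk r) (fun x => ballWeight_nonneg k r x)
    (x := 0) (ballWeight_pos (by simpa using hr)).ne'
  exact h

end Weights

section MeanValue

variable {N : ℕ}

/-- The integral of `v` over the ball of centre `x` and radius `s`, with a radial weight,
rescaled to the unit ball. -/
def ballMean (v : Eucl N → ℝ) (s : ℝ) (x : Eucl N) : ℝ :=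
  (∫ z, v (x + s • z) * ballWeight 2 1 z) / ∫ z : Eucl N, ballWeight 2 1 z

theorem integral_ballWeight_two_pos : 0 < ∫ z : Eucl N, ballWeight 2 1 z :=
  integral_ballWeight_pos (by norm_num) one_ne_zero

theorem ballMean_zero (v : Eucl N → ℝ) (x : Eucl N) : ballMean v 0 x = v x := by
  simp only [ballMean, zero_smul, add_zero]
  rw [integral_const_mul, mul_div_assoc, div_self integral_ballWeight_two_pos.ne', mul_one]

theorem integrable_comp_mul_ballWeight {v : Eucl N → ℝ} (hv : Continuous v) {k : ℕ} (hk : k ≠ 0)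
    (s r : ℝ) (x : Eucl N) : Integrable fun z => v (x + s • z) * ballWeight k r z :=
  integrable_mul_ballWeight (by fun_prop) hk r

theorem hasDerivAt_integral_comp_smul {v : Eucl N → ℝ} (hv : ContDiff ℝ 2 v) (x : Eucl N)
    (s : ℝ) :
    HasDerivAt (fun s : ℝ => ∫ z, v (x + s • z) * ballWeight 2 1 z)
      (s / 6 * ∫ z, lapl v (x + s • z) * ballWeight 3 1 z) s := by
  have hd : ∀ (z : Eucl N) (s : ℝ), HasDerivAt (fun s : ℝ => v (x + s • z) * ballWeight 2 1 z)
      (fderiv ℝ v (x + s • z) z * ballWeight 2 1 z) s := by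
    intro z s
    have h1 : HasDerivAt (fun s : ℝ => x + s • z) z s := by
      simpa using ((hasDerivAt_id s).smul_const z).const_add x
    exact (((hv.differentiableAt_two _).hasFDerivAt.comp_hasDerivAt s h1)).mul_const _
  have hc : Continuous fun q : ℝ × Eucl N => fderiv ℝ v (x + q.1 • q.2) q.2 :=
    ((hv.continuous_fderiv (by norm_num)).comp (by fun_prop)).clm_apply continuous_snd
  obtain ⟨K, hK⟩ := ((isCompact_closedBall s 1).prod
    (isCompact_closedBall (0 : Eucl N) 1)).exists_bound_of_continuousOn hc.continuousOn
  have key := (hasDerivAt_integral_of_dominated_loc_of_deriv_le (μ := (volume : Measure (Eucl N)))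
    (F := fun s z => v (x + s • z) * ballWeight 2 1 z)
    (F' := fun s z => fderiv ℝ v (x + s • z) z * ballWeight 2 1 z) (x₀ := s) (s := ball s 1)
    (bound := fun z => K * ballWeight 2 1 z)
    (ball_mem_nhds s one_pos) ?_ ?_ ?_ ?_ ?_ ?_).2
  · refine key.congr_deriv ?_
    have h := integral_div_mul_ballWeight (X := fun i z => pd i v (x + s • z))
      (fun i => (hv.pd_one i).comp (by fun_prop)) (k := 2) (by norm_num) 1
    have e1 : ∀ z, ∑ i, pd i (fun z => pd i v (x + s • z)) z = s * lapl v (x + s • z) := by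
      intro z
      rw [lapl_eq_sum_pd, Finset.mul_sum]
      exact Finset.sum_congr rfl fun i _ => pd_comp_affine x s (hv.differentiableAt_pd i _) i
    have e2 : ∀ z : Eucl N, ∑ i, pd i v (x + s • z) * z i = fderiv ℝ v (x + s • z) z := by
      intro z
      have hz : z = ∑ i, z i • EuclideanSpace.single i (1 : ℝ) := by
        simpa using ((EuclideanSpace.basisFun (Fin N) ℝ).sum_repr z).symm
      have := congrArg (fderiv ℝ v (x + s • z)) hz
      rw [this, map_sum]
      simp [pd, mul_comm]
    simp only [e1, e2] at h
    have e3 : ∫ z, s * lapl v (x + s • z) * ballWeight (2 + 1) 1 z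
        = s * ∫ z, lapl v (x + s • z) * ballWeight 3 1 z := by
      rw [← integral_const_mul]; simp only [mul_assoc]
    rw [e3] at h
    push_cast at h
    linarith
  · exact Filter.Eventually.of_forall fun s =>
      (integrable_comp_mul_ballWeight hv.continuous (by norm_num) s 1 x).aestronglyMeasurable
  · exact integrable_comp_mul_ballWeight hv.continuous (by norm_num) s 1 x
  · have : Continuous fun z : Eucl N => fderiv ℝ v (x + s • z) z :=
      hc.comp (by fun_prop : Continuous fun z : Eucl N => (s, z))
    exact (this.mul (continuous_ballWeight 2 1)).aestronglyMeasurable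
  · refine Filter.Eventually.of_forall fun z y hy => ?_
    rw [norm_mul, Real.norm_of_nonneg (ballWeight_nonneg 2 1 z)]
    rcases le_or_gt ‖z‖ 1 with hz | hz
    · exact mul_le_mul_of_nonneg_right
        (hK (y, z) ⟨ball_subset_closedBall hy, by simpa using hz⟩) (ballWeight_nonneg 2 1 z)
    · rw [ballWeight_eq_zero (by norm_num) (by simpa using hz.le)]; simp
  · exact integrable_mul_ballWeight (F := fun _ : Eucl N => K) continuous_const
      (show (2 : ℕ) ≠ 0 by norm_num) 1
  · exact Filter.Eventually.of_forall fun z y _ => hd z y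

theorem ballWeight_three_le (z : Eucl N) : ballWeight 3 1 z ≤ ballWeight 2 1 z := by
  unfold ballWeight posPow
  have h0 : 0 ≤ max ((1:ℝ) ^ 2 - ‖z‖ ^ 2) 0 := le_max_right _ _
  have h1 : max ((1:ℝ) ^ 2 - ‖z‖ ^ 2) 0 ≤ 1 := max_le (by nlinarith [norm_nonneg z]) zero_le_one
  exact pow_le_pow_of_le_one h0 h1 (by norm_num)

theorem integral_lapl_mul_ballWeight_bounds {v : Eucl N → ℝ} (hv : ContDiff ℝ 2 v) {x : Eucl N}
    {ρ K s : ℝ} (hs : s ∈ Ioo 0 ρ) (h0 : ∀ y ∈ ball x ρ, lapl v y ≤ 0) :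
    (∫ z, lapl v (x + s • z) * ballWeight 3 1 z ≤ 0) ∧
    ((∀ y ∈ ball x ρ, -lapl v y ≤ K) →
      -(K * ∫ z : Eucl N, ballWeight 2 1 z) ≤ ∫ z, lapl v (x + s • z) * ballWeight 3 1 z) := by
  have hb : ∀ z : Eucl N, ‖z‖ < 1 → x + s • z ∈ ball x ρ := by
    intro z hz
    rw [mem_ball, dist_eq_norm, add_sub_cancel_left, norm_smul, Real.norm_of_nonneg hs.1.le]
    nlinarith [hs.1, hs.2, norm_nonneg z]
  constructor
  · refine integral_nonpos fun z => ?_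
    rcases lt_or_ge ‖z‖ 1 with hz | hz
    · exact mul_nonpos_of_nonpos_of_nonneg (h0 _ (hb z hz)) (ballWeight_nonneg _ _ _)
    · simp [ballWeight_eq_zero (k := 3) (by norm_num) (show |(1:ℝ)| ≤ ‖z‖ by simpa using hz)]
  · intro hK
    rw [← integral_const_mul, ← integral_neg]
    refine integral_mono ?_ (integrable_comp_mul_ballWeight hv.continuous_lapl
      (by norm_num) s 1 x) fun z => ?_
    · exact (integrable_mul_ballWeight (F := fun _ : Eucl N => K) continuous_const
        (show (2:ℕ) ≠ 0 by norm_num) 1).neg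
    · rcases lt_or_ge ‖z‖ 1 with hz | hz
      · have h1 := hK _ (hb z hz)
        have h2 := h0 _ (hb z hz)
        have h3 := ballWeight_three_le z
        have h4 := ballWeight_nonneg 3 1 z
        simp only
        nlinarith
      · have hz' : |(1:ℝ)| ≤ ‖z‖ := by simpa using hz
        simp [ballWeight_eq_zero (k := 3) (by norm_num) hz',
          ballWeight_eq_zero (k := 2) (by norm_num) hz']

theorem ballMean_le {v : Eucl N → ℝ} (hv : ContDiff ℝ 2 v) {x : Eucl N} {ρ : ℝ} (hρ : 0 ≤ ρ)
    (h0 : ∀ y ∈ ball x ρ, lapl v y ≤ 0) : ballMean v ρ x ≤ v x := by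
  have hanti : AntitoneOn (fun s : ℝ => ∫ z, v (x + s • z) * ballWeight 2 1 z) (Icc 0 ρ) := by
    refine antitoneOn_of_deriv_nonpos (convex_Icc 0 ρ)
      (fun s _ => (hasDerivAt_integral_comp_smul hv x s).continuousAt.continuousWithinAt)
      (fun s _ => (hasDerivAt_integral_comp_smul hv x s).differentiableAt.differentiableWithinAt)
      fun s hs => ?_
    rw [interior_Icc] at hs
    rw [(hasDerivAt_integral_comp_smul hv x s).deriv]
    exact mul_nonpos_of_nonneg_of_nonpos (by linarith [hs.1])
      (integral_lapl_mul_ballWeight_bounds (K := 0) hv hs h0).1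
  have := hanti (left_mem_Icc.2 hρ) (right_mem_Icc.2 hρ) hρ
  rw [← ballMean_zero v x]
  exact div_le_div_of_nonneg_right this integral_ballWeight_two_pos.le

theorem le_ballMean_add {v : Eucl N → ℝ} (hv : ContDiff ℝ 2 v) {x : Eucl N} {ρ K : ℝ}
    (hρ : 0 ≤ ρ) (hK0 : 0 ≤ K) (h0 : ∀ y ∈ ball x ρ, lapl v y ≤ 0)
    (hK : ∀ y ∈ ball x ρ, -lapl v y ≤ K) :
    v x ≤ ballMean v ρ x + K * ρ ^ 2 := by
  set J := ∫ z : Eucl N, ballWeight 2 1 z with hJ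
  have hJ0 : 0 < J := integral_ballWeight_two_pos
  have hd : ∀ s : ℝ, HasDerivAt
      (fun s : ℝ => (∫ z, v (x + s • z) * ballWeight 2 1 z) + K * J * s ^ 2)
      ((s / 6 * ∫ z, lapl v (x + s • z) * ballWeight 3 1 z) + K * J * (2 * s)) s := fun s =>
    (hasDerivAt_integral_comp_smul hv x s).add
      (by simpa using (hasDerivAt_pow 2 s).const_mul (K * J))
  have hmono : MonotoneOn (fun s : ℝ => (∫ z, v (x + s • z) * ballWeight 2 1 z) + K * J * s ^ 2)
      (Icc 0 ρ) := by
    refine monotoneOn_of_deriv_nonneg (convex_Icc 0 ρ)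
      (fun s _ => (hd s).continuousAt.continuousWithinAt)
      (fun s _ => (hd s).differentiableAt.differentiableWithinAt) fun s hs => ?_
    rw [interior_Icc] at hs
    rw [(hd s).deriv]
    have := (integral_lapl_mul_ballWeight_bounds hv hs h0).2 hK
    have hs0 := hs.1
    have : s / 6 * -(K * J) ≤ s / 6 * ∫ z, lapl v (x + s • z) * ballWeight 3 1 z :=
      mul_le_mul_of_nonneg_left this (by linarith)
    have hKJ : 0 ≤ K * J := by positivity
    nlinarith
  have := hmono (left_mem_Icc.2 hρ) (right_mem_Icc.2 hρ) hρ
  rw [← ballMean_zero v x]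
  simp only [ballMean]
  rw [← hJ, div_add' _ _ _ hJ0.ne', div_le_div_iff_of_pos_right hJ0]
  simp only at this
  nlinarith

theorem eq_zero_on_ball_of_superharmonic {v : Eucl N → ℝ} (hv : ContDiff ℝ 2 v) {x : Eucl N}
    {ρ : ℝ} (hρ : 0 < ρ) (h0 : ∀ y ∈ ball x ρ, lapl v y ≤ 0) (hpos : ∀ y ∈ ball x ρ, 0 ≤ v y)
    (hx : v x = 0) : ∀ y ∈ ball x ρ, v y = 0 := by
  intro y hy
  have h1 : ∫ z, v (x + ρ • z) * ballWeight 2 1 z ≤ 0 := by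
    have := ballMean_le hv hρ.le h0
    rw [hx, ballMean, div_le_iff₀ integral_ballWeight_two_pos, zero_mul] at this
    exact this
  have hmem : ∀ z : Eucl N, ‖z‖ < 1 → x + ρ • z ∈ ball x ρ := by
    intro z hz
    rw [mem_ball, dist_eq_norm, add_sub_cancel_left, norm_smul, Real.norm_of_nonneg hρ.le]
    nlinarith
  have hnn : ∀ z, 0 ≤ v (x + ρ • z) * ballWeight 2 1 z := by
    intro z
    rcases lt_or_ge ‖z‖ 1 with hz | hz
    · exact mul_nonneg (hpos _ (hmem z hz)) (ballWeight_nonneg _ _ _)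
    · simp [ballWeight_eq_zero (k := 2) (by norm_num) (show |(1:ℝ)| ≤ ‖z‖ by simpa using hz)]
  by_contra hne
  set z : Eucl N := ρ⁻¹ • (y - x) with hz
  have hyz : x + ρ • z = y := by rw [hz, smul_inv_smul₀ hρ.ne']; abel
  have hz1 : ‖z‖ < |(1:ℝ)| := by
    rw [mem_ball, dist_eq_norm] at hy
    rw [hz, norm_smul, norm_inv, Real.norm_of_nonneg hρ.le, abs_one, inv_mul_lt_iff₀ hρ]
    linarith
  have hc : Continuous fun z : Eucl N => v (x + ρ • z) * ballWeight 2 1 z :=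
    (hv.continuous.comp (by fun_prop)).mul (continuous_ballWeight 2 1)
  have := hc.integral_pos_of_hasCompactSupport_nonneg_nonzero (μ := volume)
    (hasCompactSupport_ballWeight (by norm_num) 1).mul_left hnn (x := z)
    (mul_ne_zero (by rwa [hyz]) (ballWeight_pos hz1).ne')
  linarith

/-- Weak minimum principle for superharmonic functions. -/
theorem nonneg_of_superharmonic (hN : N ≠ 0) {U : Set (Eucl N)} (hU : IsOpen U)
    (hb : Bornology.IsBounded U) {F : Eucl N → ℝ} (hF : ContDiff ℝ 2 F)
    (hl : ∀ x ∈ U, lapl F x ≤ 0) (hfr : ∀ x ∈ frontier U, 0 ≤ F x) :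
    ∀ x ∈ closure U, 0 ≤ F x := by
  intro x hx
  obtain ⟨x0, hx0, hmin⟩ := hb.isCompact_closure.exists_isMinOn ⟨x, hx⟩ hF.continuous.continuousOn
  refine le_trans ?_ (hmin hx)
  by_contra! hneg
  have hx0U : x0 ∈ U := by
    by_contra h
    have := hfr x0 ⟨hx0, by rwa [hU.interior_eq]⟩
    linarith
  have hne : (Uᶜ).Nonempty := by
    rw [nonempty_compl]
    rintro rfl
    have : Nonempty (Fin N) := ⟨⟨0, Nat.pos_of_ne_zero hN⟩⟩
    exact NormedSpace.unbounded_univ ℝ (Eucl N) hb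
  obtain ⟨y, hyU, hy⟩ := hU.isClosed_compl.exists_infDist_eq_dist hne x0
  have hρ : 0 < dist x0 y := dist_pos.2 (by rintro rfl; exact hyU hx0U)
  have hball : ball x0 (dist x0 y) ⊆ U := by
    intro z hz
    by_contra h
    have := infDist_le_dist_of_mem (x := x0) (show z ∈ Uᶜ from h)
    rw [mem_ball'] at hz
    linarith
  have hz := eq_zero_on_ball_of_superharmonic (v := fun y => F y - F x0) (x := x0)
    (hF.sub contDiff_const) hρ
    (fun z hz => by
      rw [lapl_sub hF contDiff_const, lapl_const, sub_zero]; exact hl z (hball hz))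
    (fun z hz => sub_nonneg.2 (hmin (subset_closure (hball hz)))) (sub_self _)
  have hyc : y ∈ closure (ball x0 (dist x0 y)) := by
    rw [closure_ball _ hρ.ne']; simp [dist_comm]
  have hFy : F y - F x0 = 0 := by
    have hcl : IsClosed {z | F z - F x0 = 0} :=
      isClosed_eq (hF.continuous.sub continuous_const) continuous_const
    exact closure_minimal (fun z hz' => hz z hz') hcl hyc
  have := hfr y ⟨closure_mono hball hyc, by rw [hU.interior_eq]; exact hyU⟩
  linarith

/-- Strong minimum principle for nonnegative superharmonic functions. -/
theorem eq_zero_of_superharmonic {U : Set (Eucl N)} (hU : IsOpen U) (hc : IsPreconnected U)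
    {F : Eucl N → ℝ} (hF : ContDiff ℝ 2 F) (hl : ∀ x ∈ U, lapl F x ≤ 0)
    (hpos : ∀ x ∈ U, 0 ≤ F x) {x0 : Eucl N} (hx0 : x0 ∈ U) (h0 : F x0 = 0) :
    ∀ x ∈ U, F x = 0 := by
  have hintegral : ∀ x ∈ U, F x = 0 → x ∈ interior {x | F x = 0} := by
    intro x hx h
    obtain ⟨ρ, hρ, hsub⟩ := Metric.isOpen_iff.1 hU x hx
    exact mem_interior.2 ⟨ball x ρ, fun y hy => eq_zero_on_ball_of_superharmonic hF hρ
      (fun y hy => hl y (hsub hy)) (fun y hy => hpos y (hsub hy)) h y hy, isOpen_ball,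
      mem_ball_self hρ⟩
  have := hc.subset_left_of_subset_union (u := interior {x | F x = 0}) (v := {x | F x ≠ 0})
    isOpen_interior (isOpen_ne_fun hF.continuous continuous_const)
    (Set.disjoint_left.2 fun x hx hx' => hx' (interior_subset (s := {x | F x = 0}) hx))
    (fun x hx => (em (F x = 0)).imp (hintegral x hx) id) ⟨x0, hx0, hintegral x0 hx0 h0⟩
  exact fun x hx => interior_subset (s := {x | F x = 0}) (this hx)

end MeanValue

section Frequency

variable {N : ℕ}

/-- The radial derivative `x · ∇v`. -/
def eulerDeriv (v : Eucl N → ℝ) (x : Eucl N) : ℝ := ∑ i, pd i v x * x i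

/-- The squared length of the gradient. -/
def gradSq (v : Eucl N → ℝ) (x : Eucl N) : ℝ := ∑ i, pd i v x ^ 2

theorem ContDiff.eulerDeriv {v : Eucl N → ℝ} (hv : ContDiff ℝ 2 v) :
    ContDiff ℝ 1 (_root_.eulerDeriv v) :=
  ContDiff.sum fun i _ => (hv.pd_one i).mul (contDiff_coord i)

theorem ContDiff.gradSq {v : Eucl N → ℝ} (hv : ContDiff ℝ 2 v) : ContDiff ℝ 1 (_root_.gradSq v) :=
  ContDiff.sum fun i _ => (hv.pd_one i).pow 2

theorem ballWeight_succ {k : ℕ} (hk : k ≠ 0) (r : ℝ) (x : Eucl N) :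
    ballWeight (k + 1) r x = (r ^ 2 - ‖x‖ ^ 2) * ballWeight k r x :=
  (mul_posPow k hk _).symm

theorem sq_mul_integral_ballWeight {F : Eucl N → ℝ} (hF : Continuous F) {k : ℕ} (hk : k ≠ 0)
    (r : ℝ) : r ^ 2 * ∫ x, F x * ballWeight k r x
      = (∫ x, F x * ballWeight (k + 1) r x) + ∫ x, F x * ‖x‖ ^ 2 * ballWeight k r x := by
  rw [← integral_const_mul, ← integral_add (integrable_mul_ballWeight hF (by omega) r)
    (integrable_mul_ballWeight (by fun_prop) hk r)]
  congr 1; funext x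
  rw [ballWeight_succ hk]; ring

theorem sum_pd_mul_coord {F : Eucl N → ℝ} {x : Eucl N} (hF : DifferentiableAt ℝ F x) :
    ∑ i, pd i (fun y => F y * y i) x = N * F x + eulerDeriv F x := by
  simp only [pd_mul hF (differentiableAt_coord _ x), pd_coord, eulerDeriv, Finset.sum_add_distrib]
  simp; ring

theorem integral_mul_coord_ballWeight {F : Eucl N → ℝ} (hF : ContDiff ℝ 1 F) {k : ℕ} (hk : 1 ≤ k)
    (r : ℝ) : ∫ x, (N * F x + eulerDeriv F x) * ballWeight (k + 1) r x
      = 2 * (k + 1) * ∫ x, F x * ‖x‖ ^ 2 * ballWeight k r x := by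
  have h := integral_div_mul_ballWeight (X := fun i x => F x * x i)
    (fun i => hF.mul (contDiff_coord i)) hk r
  have e1 : ∀ x, ∑ i, pd i (fun y => F y * y i) x = N * F x + eulerDeriv F x := fun x =>
    sum_pd_mul_coord (hF.differentiable (by norm_num) x)
  have e2 : ∀ x : Eucl N, ∑ i, F x * x i * x i = F x * ‖x‖ ^ 2 := by
    intro x
    rw [← sum_coord_sq, Finset.mul_sum]
    exact Finset.sum_congr rfl fun i _ => by ring
  simpa only [e1, e2] using h

theorem eulerDeriv_comp {g : ℝ → ℝ} {g' : ℝ} {v : Eucl N → ℝ} {x : Eucl N}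
    (hg : HasDerivAt g g' (v x)) (hv : DifferentiableAt ℝ v x) :
    eulerDeriv (fun y => g (v y)) x = g' * eulerDeriv v x := by
  simp only [eulerDeriv, pd_comp hg hv, Finset.mul_sum, mul_assoc]

/-- The weighted height function. -/
def heightInt (v : Eucl N → ℝ) (r : ℝ) : ℝ := ∫ x, v x ^ 2 * ballWeight 2 r x

/-- The weighted energy function. -/
def energyInt (v : Eucl N → ℝ) (r : ℝ) : ℝ :=
  ∫ x, (gradSq v x + v x * lapl v x) * ballWeight 3 r x

theorem energyInt_eq {v : Eucl N → ℝ} (hv : ContDiff ℝ 2 v) (r : ℝ) :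
    energyInt v r = 6 * ∫ x, v x * eulerDeriv v x * ballWeight 2 r x := by
  have h := integral_div_mul_ballWeight (X := fun i x => v x * pd i v x)
    (fun i => (hv.of_le (by norm_num)).mul (hv.pd_one i)) (k := 2) (by norm_num) r
  have e1 : ∀ x, ∑ i, pd i (fun y => v y * pd i v y) x = gradSq v x + v x * lapl v x := by
    intro x
    rw [gradSq, lapl_eq_sum_pd, Finset.mul_sum, ← Finset.sum_add_distrib]
    refine Finset.sum_congr rfl fun i _ => ?_
    rw [pd_mul (hv.differentiableAt_two x) (hv.differentiableAt_pd i x)]; ring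
  have e2 : ∀ x, ∑ i, v x * pd i v x * x i = v x * eulerDeriv v x := by
    intro x
    rw [eulerDeriv, Finset.mul_sum]
    exact Finset.sum_congr rfl fun i _ => by ring
  simp only [e1, e2] at h
  rw [energyInt, h]
  norm_num

theorem hasDerivAt_heightInt {v : Eucl N → ℝ} (hv : ContDiff ℝ 2 v) (r : ℝ) :
    ∃ H' : ℝ, HasDerivAt (heightInt v) H' r ∧
      r * H' = (N + 4) * heightInt v r + energyInt v r / 3 := by
  have hv1 : ContDiff ℝ 1 v := hv.of_le (by norm_num)
  have hv2 : Continuous fun x => v x ^ 2 := hv.continuous.pow 2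
  have hve : Continuous fun x => v x * eulerDeriv v x :=
    hv.continuous.mul hv.eulerDeriv.continuous
  refine ⟨_, hasDerivAt_integral_mul_ballWeight hv2 le_rfl r, ?_⟩
  have h1 := sq_mul_integral_ballWeight hv2 one_ne_zero r
  have h2 := integral_mul_coord_ballWeight (hv1.pow 2) le_rfl r
  have e : ∀ x, (N * v x ^ 2 + eulerDeriv (fun y => v y ^ 2) x) * ballWeight (1 + 1) r x
      = N * (v x ^ 2 * ballWeight 2 r x) + 2 * (v x * eulerDeriv v x * ballWeight 2 r x) := by
    intro x
    rw [eulerDeriv_comp (g := fun s => s ^ 2) (hasDerivAt_pow 2 _) (hv.differentiableAt_two x)]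
    norm_num; ring
  simp only [e] at h2
  rw [integral_add ((integrable_mul_ballWeight hv2 (by norm_num) r).const_mul _)
    ((integrable_mul_ballWeight hve (by norm_num) r).const_mul _), integral_const_mul, integral_const_mul] at h2
  rw [energyInt_eq hv]
  simp only [heightInt] at *
  push_cast at *
  norm_num at *
  linarith

theorem pohozaev_ballWeight {v : Eucl N → ℝ} (hv : ContDiff ℝ 2 v) (r : ℝ) :
    ∫ x, ((N - 2) * gradSq v x - 2 * (eulerDeriv v x * lapl v x)) * ballWeight 3 r x
      = 6 * ∫ x, (gradSq v x * ‖x‖ ^ 2 - 2 * eulerDeriv v x ^ 2) * ballWeight 2 r x := by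
  have h := integral_div_mul_ballWeight
    (X := fun i x => gradSq v x * x i - 2 * (eulerDeriv v x * pd i v x))
    (fun i => (hv.gradSq.mul (contDiff_coord i)).sub
      (contDiff_const.mul (hv.eulerDeriv.mul (hv.pd_one i)))) (k := 2) (by norm_num) r
  have hgd : ∀ x, DifferentiableAt ℝ (gradSq v) x := hv.gradSq.differentiable (by norm_num)
  have hed : ∀ x, DifferentiableAt ℝ (eulerDeriv v) x := hv.eulerDeriv.differentiable (by norm_num)
  have hpp : ∀ i j x, pd i (pd j v) x = pd j (pd i v) x := by
    intro i j x
    have hsymm : IsSymmSndFDerivAt ℝ v x :=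
      hv.contDiffAt.isSymmSndFDerivAt (by simp)
    have hd : DifferentiableAt ℝ (fderiv ℝ v) x :=
      (hv.fderiv_right (m := 1) (by norm_num [one_add_one_eq_two])).differentiable (by norm_num) x
    have e : ∀ i j : Fin N, pd i (pd j v) x = fderiv ℝ (fderiv ℝ v) x
        (EuclideanSpace.single i 1) (EuclideanSpace.single j 1) := by
      intro i j
      simp only [pd]
      rw [show pd j v = fun y => fderiv ℝ v y (EuclideanSpace.single j 1) from rfl,
        fderiv_clm_apply hd (differentiableAt_const _)]
      simp
    rw [e, e]; exact hsymm _ _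
  have e1 : ∀ x, ∑ i, pd i (fun y => gradSq v y * y i - 2 * (eulerDeriv v y * pd i v y)) x
      = (N - 2) * gradSq v x - 2 * (eulerDeriv v x * lapl v x) := by
    intro x
    have s1 : ∀ i, pd i (fun y => gradSq v y * y i - 2 * (eulerDeriv v y * pd i v y)) x
        = pd i (fun y => gradSq v y * y i) x
          - 2 * (pd i (eulerDeriv v) x * pd i v x + eulerDeriv v x * pd i (pd i v) x) := by
      intro i
      rw [pd_sub ((hgd x).fun_mul (differentiableAt_coord i x))
        (((hed x).fun_mul (hv.differentiableAt_pd i x)).const_mul 2),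
        pd_const_mul 2 ((hed x).fun_mul (hv.differentiableAt_pd i x)),
        pd_mul (hed x) (hv.differentiableAt_pd i x)]
    simp only [s1]
    rw [Finset.sum_sub_distrib, sum_pd_mul_coord (hgd x), ← Finset.mul_sum,
      Finset.sum_add_distrib, ← Finset.mul_sum, ← lapl_eq_sum_pd]
    have s2 : eulerDeriv (gradSq v) x = 2 * ∑ i, ∑ j, pd j v x * pd i (pd j v) x * x i := by
      simp only [eulerDeriv]
      rw [Finset.mul_sum]
      refine Finset.sum_congr rfl fun i _ => ?_
      have : pd i (gradSq v) x = ∑ j, 2 * (pd j v x * pd i (pd j v) x) := by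
        rw [show gradSq v = fun y => ∑ j, pd j v y ^ 2 from rfl,
          pd_sum _ fun j _ => (hv.differentiableAt_pd j x).fun_pow 2]
        refine Finset.sum_congr rfl fun j _ => ?_
        rw [pd_comp (g := fun s => s ^ 2) (hasDerivAt_pow 2 _) (hv.differentiableAt_pd j x)]
        norm_num; ring
      rw [this, Finset.sum_mul, Finset.mul_sum]
      exact Finset.sum_congr rfl fun j _ => by ring
    have s3 : ∑ i, pd i (eulerDeriv v) x * pd i v x
        = gradSq v x + ∑ i, ∑ j, pd j v x * pd i (pd j v) x * x i := by
      have : ∀ i, pd i (eulerDeriv v) x = pd i v x + ∑ j, pd i (pd j v) x * x j := by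
        intro i
        rw [show eulerDeriv v = fun y => ∑ j, pd j v y * y j from rfl,
          pd_sum _ fun j _ => (hv.differentiableAt_pd j x).fun_mul (differentiableAt_coord j x)]
        simp only [pd_mul (hv.differentiableAt_pd _ x) (differentiableAt_coord _ x), pd_coord,
          Finset.sum_add_distrib]
        simp [add_comm]
      simp only [this, add_mul, Finset.sum_add_distrib, gradSq, Finset.sum_mul, sq]
      congr 1
      rw [Finset.sum_comm]
      refine Finset.sum_congr rfl fun i _ => Finset.sum_congr rfl fun j _ => ?_
      rw [hpp j i]; ring
    rw [s2, s3]; ring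
  have e2 : ∀ x, ∑ i, (gradSq v x * x i - 2 * (eulerDeriv v x * pd i v x)) * x i
      = gradSq v x * ‖x‖ ^ 2 - 2 * eulerDeriv v x ^ 2 := by
    intro x
    have h1 : eulerDeriv v x ^ 2 = ∑ i, eulerDeriv v x * (pd i v x * x i) := by
      rw [← Finset.mul_sum, sq]; rfl
    rw [← sum_coord_sq, h1, Finset.mul_sum, Finset.mul_sum, ← Finset.sum_sub_distrib]
    exact Finset.sum_congr rfl fun i _ => by ring
  simp only [e1, e2] at h
  rw [h]; norm_num

end Frequency

section Monotonicity

variable {N : ℕ}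

theorem abs_integral_ballWeight_le {v F : Eucl N → ℝ} (hv : Continuous v)
    {L r : ℝ} (hr : 0 < r) (hFv : ∀ x ∈ ball (0 : Eucl N) r, |F x| ≤ L * v x ^ 2) :
    |∫ x, F x * ballWeight 3 r x| ≤ L * r ^ 2 * heightInt v r ∧
    |∫ x, F x * ‖x‖ ^ 2 * ballWeight 2 r x| ≤ L * r ^ 2 * heightInt v r := by
  have hi : Integrable fun x => L * r ^ 2 * (v x ^ 2 * ballWeight 2 r x) :=
    (integrable_mul_ballWeight (F := fun x => v x ^ 2) (hv.pow 2) (by norm_num) r).const_mul _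
  have hz : ∀ x : Eucl N, ¬ ‖x‖ < r → ballWeight 2 r x = 0 ∧ ballWeight 3 r x = 0 := by
    intro x hx
    have : |r| ≤ ‖x‖ := by rw [abs_of_pos hr]; exact not_lt.1 hx
    exact ⟨ballWeight_eq_zero (by norm_num) this, ballWeight_eq_zero (by norm_num) this⟩
  have hsq : ∀ x : Eucl N, ‖x‖ < r → ‖x‖ ^ 2 ≤ r ^ 2 := fun x hx =>
    pow_le_pow_left₀ (norm_nonneg x) hx.le 2
  rw [heightInt, ← integral_const_mul]
  constructor
  · rw [← Real.norm_eq_abs]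
    refine norm_integral_le_of_norm_le hi (Filter.Eventually.of_forall fun x => ?_)
    by_cases hx : ‖x‖ < r
    · rw [show (3 : ℕ) = 2 + 1 from rfl, ballWeight_succ (by norm_num), norm_mul, norm_mul,
        Real.norm_eq_abs, Real.norm_of_nonneg (ballWeight_nonneg _ _ _),
        Real.norm_of_nonneg (by linarith [hsq x hx])]
      have h1 := hFv x (by simpa using hx)
      have h2 := ballWeight_nonneg 2 r x
      have h3 : r ^ 2 - ‖x‖ ^ 2 ≤ r ^ 2 := by nlinarith [norm_nonneg x]
      have h4 := hsq x hx
      calc |F x| * ((r ^ 2 - ‖x‖ ^ 2) * ballWeight 2 r x)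
          ≤ L * v x ^ 2 * (r ^ 2 * ballWeight 2 r x) := by
            apply mul_le_mul h1 (mul_le_mul_of_nonneg_right h3 h2)
              (mul_nonneg (by linarith) h2) ((abs_nonneg _).trans h1)
        _ = _ := by ring
    · simp [hz x hx]
  · rw [← Real.norm_eq_abs]
    refine norm_integral_le_of_norm_le hi (Filter.Eventually.of_forall fun x => ?_)
    by_cases hx : ‖x‖ < r
    · rw [norm_mul, norm_mul, Real.norm_eq_abs, Real.norm_of_nonneg (ballWeight_nonneg _ _ _),
        Real.norm_of_nonneg (by positivity)]
      have h1 := hFv x (by simpa using hx)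
      have h2 := ballWeight_nonneg 2 r x
      have h4 := hsq x hx
      calc |F x| * ‖x‖ ^ 2 * ballWeight 2 r x
          ≤ L * v x ^ 2 * r ^ 2 * ballWeight 2 r x := by
            apply mul_le_mul_of_nonneg_right _ h2
            exact mul_le_mul h1 h4 (by positivity) ((abs_nonneg _).trans h1)
        _ = _ := by ring
    · simp [hz x hx]

theorem hasDerivAt_energyInt {v : Eucl N → ℝ} (hv : ContDiff ℝ 2 v) {g G : ℝ → ℝ}
    (hg : Continuous g) (hG : ∀ s, HasDerivAt G (g s) s) {L r : ℝ} (hr : 0 < r)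
    (heq : ∀ x ∈ ball (0 : Eucl N) r, lapl v x = -g (v x))
    (hgL : ∀ x ∈ ball (0 : Eucl N) r, |g (v x)| ≤ L * |v x|)
    (hGL : ∀ x ∈ ball (0 : Eucl N) r, |G (v x)| ≤ L * v x ^ 2) :
    ∃ D' : ℝ, HasDerivAt (energyInt v) D' r ∧
      (N + 4) * energyInt v r + 12 * (∫ x, eulerDeriv v x ^ 2 * ballWeight 2 r x)
        - L * (3 * N + 20) * r ^ 2 * heightInt v r ≤ r * D' := by
  have cv := hv.continuous
  have cl := hv.continuous_lapl
  have cn := hv.gradSq.continuous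
  have ce := hv.eulerDeriv.continuous
  have hG1 : ContDiff ℝ 1 G := by
    rw [contDiff_one_iff_deriv]
    exact ⟨fun s => (hG s).differentiableAt, by rwa [show deriv G = g from
      funext fun s => (hG s).deriv]⟩
  have hGv : ContDiff ℝ 1 fun x => G (v x) := hG1.comp (hv.of_le (by norm_num))
  have cE : Continuous fun x => gradSq v x + v x * lapl v x := by fun_prop
  refine ⟨_, hasDerivAt_integral_mul_ballWeight cE (k := 2) (by norm_num) r, ?_⟩
  have h1 := sq_mul_integral_ballWeight cE (k := 2) (by norm_num) r
  have hB : ∫ x, (gradSq v x + v x * lapl v x) * ‖x‖ ^ 2 * ballWeight 2 r x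
      = (∫ x, gradSq v x * ‖x‖ ^ 2 * ballWeight 2 r x)
        + ∫ x, v x * lapl v x * ‖x‖ ^ 2 * ballWeight 2 r x := by
    rw [← integral_add (integrable_mul_ballWeight (by fun_prop) (by norm_num) r)
      (integrable_mul_ballWeight (by fun_prop) (by norm_num) r)]
    congr 1; funext x; ring
  have hA : energyInt v r = (∫ x, gradSq v x * ballWeight 3 r x)
        + ∫ x, v x * lapl v x * ballWeight 3 r x := by
    rw [energyInt, ← integral_add (integrable_mul_ballWeight (by fun_prop) (by norm_num) r)
      (integrable_mul_ballWeight (by fun_prop) (by norm_num) r)]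
    congr 1; funext x; ring
  have hP := pohozaev_ballWeight hv r
  have hP1 : ∫ x, ((N - 2) * gradSq v x - 2 * (eulerDeriv v x * lapl v x)) * ballWeight 3 r x
      = (N - 2) * (∫ x, gradSq v x * ballWeight 3 r x)
        - 2 * ∫ x, eulerDeriv v x * lapl v x * ballWeight 3 r x := by
    rw [← integral_const_mul, ← integral_const_mul,
      ← integral_sub ((integrable_mul_ballWeight (by fun_prop) (by norm_num) r).const_mul _)
      ((integrable_mul_ballWeight (by fun_prop) (by norm_num) r).const_mul _)]
    congr 1; funext x; ring
  have hP2 : ∫ x, (gradSq v x * ‖x‖ ^ 2 - 2 * eulerDeriv v x ^ 2) * ballWeight 2 r x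
      = (∫ x, gradSq v x * ‖x‖ ^ 2 * ballWeight 2 r x)
        - 2 * ∫ x, eulerDeriv v x ^ 2 * ballWeight 2 r x := by
    rw [← integral_const_mul,
      ← integral_sub (integrable_mul_ballWeight (by fun_prop) (by norm_num) r)
      ((integrable_mul_ballWeight (by fun_prop) (by norm_num) r).const_mul _)]
    congr 1; funext x; ring
  have hQ := integral_mul_coord_ballWeight hGv (k := 2) (by norm_num) r
  have hQ1 : ∫ x, (N * G (v x) + eulerDeriv (fun y => G (v y)) x) * ballWeight (2 + 1) r x
      = N * (∫ x, G (v x) * ballWeight 3 r x)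
        - ∫ x, eulerDeriv v x * lapl v x * ballWeight 3 r x := by
    rw [← integral_const_mul,
      ← integral_sub ((integrable_mul_ballWeight hGv.continuous (by norm_num) r).const_mul _)
      (integrable_mul_ballWeight (by fun_prop) (by norm_num) r)]
    congr 1; funext x
    rw [eulerDeriv_comp (hG _) (hv.differentiableAt_two x)]
    by_cases hx : ‖x‖ < r
    · rw [heq x (by simpa using hx)]; ring
    · have : |r| ≤ ‖x‖ := by rw [abs_of_pos hr]; exact not_lt.1 hx
      simp [ballWeight_eq_zero (k := 3) (by norm_num) this]
  have hvl : ∀ x ∈ ball (0 : Eucl N) r, |v x * lapl v x| ≤ L * v x ^ 2 := by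
    intro x hx
    rw [heq x hx, abs_mul, abs_neg, ← sq_abs (v x)]
    nlinarith [hgL x hx, abs_nonneg (v x)]
  obtain ⟨b1, b2⟩ := abs_integral_ballWeight_le (F := fun x => v x * lapl v x) cv hr hvl
  obtain ⟨b3, b4⟩ := abs_integral_ballWeight_le (F := fun x => G (v x)) cv hr hGL
  rw [hP1, hP2] at hP
  rw [hQ1] at hQ
  rw [hB] at h1
  rw [abs_le] at b1 b2 b3 b4
  simp only [energyInt] at *
  norm_num at hQ h1 ⊢
  set H := heightInt v r
  set D := ∫ x, (gradSq v x + v x * lapl v x) * ballWeight 3 r x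
  set A2 := ∫ x, v x * lapl v x * ballWeight 3 r x
  set A5 := ∫ x, G (v x) * ballWeight 3 r x
  set B2 := ∫ x, v x * lapl v x * ‖x‖ ^ 2 * ballWeight 2 r x
  set B3 := ∫ x, G (v x) * ‖x‖ ^ 2 * ballWeight 2 r x
  have hNn : (0 : ℝ) ≤ N := Nat.cast_nonneg N
  have t1 := mul_le_mul_of_nonneg_left b1.1 hNn
  have t2 := mul_le_mul_of_nonneg_left b1.2 hNn
  have t3 := mul_le_mul_of_nonneg_left b3.1 hNn
  have t4 := mul_le_mul_of_nonneg_left b3.2 hNn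
  nlinarith [b1.1, b1.2, b2.1, b2.2, b3.1, b3.2, b4.1, b4.2]

theorem heightInt_nonneg (v : Eucl N → ℝ) (r : ℝ) : 0 ≤ heightInt v r :=
  integral_nonneg fun _ => mul_nonneg (sq_nonneg _) (ballWeight_nonneg _ _ _)

theorem heightInt_pos {v : Eucl N → ℝ} (hv : Continuous v) {r : ℝ} {x : Eucl N} (hx : ‖x‖ < r)
    (hvx : v x ≠ 0) : 0 < heightInt v r := by
  have hc : Continuous fun x => v x ^ 2 * ballWeight 2 r x :=
    (hv.pow 2).mul (continuous_ballWeight 2 r)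
  exact hc.integral_pos_of_hasCompactSupport_nonneg_nonzero (μ := volume)
    (hasCompactSupport_ballWeight (by norm_num) r).mul_left
    (fun _ => mul_nonneg (sq_nonneg _) (ballWeight_nonneg _ _ _)) (x := x)
    (mul_ne_zero (pow_ne_zero 2 hvx) (ballWeight_pos (lt_of_lt_of_le hx (le_abs_self r))).ne')

theorem sq_energyInt_le {v : Eucl N → ℝ} (hv : ContDiff ℝ 2 v) (r : ℝ) :
    energyInt v r ^ 2 ≤ 36 * (heightInt v r * ∫ x, eulerDeriv v x ^ 2 * ballWeight 2 r x) := by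
  have cv := hv.continuous
  have ce := hv.eulerDeriv.continuous
  set H := heightInt v r with hH
  set Q := ∫ x, eulerDeriv v x ^ 2 * ballWeight 2 r x with hQ
  set P := ∫ x, v x * eulerDeriv v x * ballWeight 2 r x with hP
  have key : ∀ a b : ℝ, 0 ≤ a ^ 2 * H + 2 * a * b * P + b ^ 2 * Q := by
    intro a b
    have : a ^ 2 * H + 2 * a * b * P + b ^ 2 * Q
        = ∫ x, (a * v x + b * eulerDeriv v x) ^ 2 * ballWeight 2 r x := by
      have i1 : Integrable fun x => a ^ 2 * (v x ^ 2 * ballWeight 2 r x) :=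
        (integrable_mul_ballWeight (F := fun x => v x ^ 2) (by fun_prop) (by norm_num) r).const_mul _
      have i2 : Integrable fun x => 2 * a * b * (v x * eulerDeriv v x * ballWeight 2 r x) :=
        (integrable_mul_ballWeight (by fun_prop) (by norm_num) r).const_mul _
      have i3 : Integrable fun x => b ^ 2 * (eulerDeriv v x ^ 2 * ballWeight 2 r x) :=
        (integrable_mul_ballWeight (F := fun x => eulerDeriv v x ^ 2) (by fun_prop) (by norm_num)
          r).const_mul _
      have i12 : Integrable fun x => a ^ 2 * (v x ^ 2 * ballWeight 2 r x)
          + 2 * a * b * (v x * eulerDeriv v x * ballWeight 2 r x) := i1.add i2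
      rw [hH, hP, hQ, heightInt, ← integral_const_mul, ← integral_const_mul,
        ← integral_const_mul, ← integral_add i1 i2, ← integral_add i12 i3]
      congr 1; funext x; ring
    rw [this]
    exact integral_nonneg fun x => mul_nonneg (sq_nonneg _) (ballWeight_nonneg _ _ _)
  rw [energyInt_eq hv]
  have hPHQ : P ^ 2 ≤ H * Q := by
    have hH0 : 0 ≤ H := heightInt_nonneg v r
    rcases hH0.eq_or_lt with h | h
    · have h1 := key (Q + 1) (-P)
      have h2 := key 0 1
      rw [← h] at h1 ⊢
      nlinarith [sq_nonneg P]
    · have h1 := key P (-H)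
      nlinarith
  nlinarith

end Monotonicity

section Doubling

variable {N : ℕ}

theorem exists_pow_le_heightInt {v : Eucl N → ℝ} (hv : ContDiff ℝ 2 v) {g G : ℝ → ℝ}
    (hg : Continuous g) (hG : ∀ s, HasDerivAt G (g s) s) {L ρ : ℝ} (hρ : 0 < ρ)
    (heq : ∀ x ∈ ball (0 : Eucl N) ρ, lapl v x = -g (v x))
    (hgL : ∀ x ∈ ball (0 : Eucl N) ρ, |g (v x)| ≤ L * |v x|)
    (hGL : ∀ x ∈ ball (0 : Eucl N) ρ, |G (v x)| ≤ L * v x ^ 2)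
    (hne : ∀ ε > 0, ∃ x : Eucl N, ‖x‖ < ε ∧ v x ≠ 0) :
    ∃ A : ℕ, ∃ c > 0, ∀ r ∈ Ioc 0 ρ, c * r ^ A ≤ heightInt v r := by
  have hHpos : ∀ r, 0 < r → 0 < heightInt v r := fun r hr => by
    obtain ⟨x, hx, hvx⟩ := hne r hr
    exact heightInt_pos hv.continuous hx hvx
  choose! H' hH' hHeq using fun r => hasDerivAt_heightInt hv r
  have hball : ∀ r ∈ Ioc 0 ρ, ball (0 : Eucl N) r ⊆ ball 0 ρ := fun r hr => ball_subset_ball hr.2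
  choose! D' hD' hDle using fun (r : ℝ) (hr : r ∈ Ioc 0 ρ) =>
    hasDerivAt_energyInt hv hg hG hr.1 (fun x hx => heq x (hball r hr hx))
      (fun x hx => hgL x (hball r hr hx)) (fun x hx => hGL x (hball r hr hx))
  set C := L * (3 * N + 20) with hC
  have hd : ∀ r ∈ Ioc 0 ρ, HasDerivAt (fun r => energyInt v r / heightInt v r + C * r ^ 2 / 2)
      ((D' r * heightInt v r - energyInt v r * H' r) / heightInt v r ^ 2 + C * r) r := by
    intro r hr
    refine ((hD' r hr).div (hH' r) (hHpos r hr.1).ne').add ?_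
    have := ((hasDerivAt_pow 2 r).const_mul C).div_const 2
    exact this.congr_deriv (by push_cast; ring)
  have hmono : MonotoneOn (fun r => energyInt v r / heightInt v r + C * r ^ 2 / 2) (Ioc 0 ρ) := by
    refine monotoneOn_of_deriv_nonneg (convex_Ioc 0 ρ)
      (fun r hr => (hd r hr).continuousAt.continuousWithinAt)
      (fun r hr => (hd r (interior_subset hr)).differentiableAt.differentiableWithinAt)
      fun r hr => ?_
    have hr' := interior_subset hr
    rw [(hd r hr').deriv]
    have h1 := hDle r hr'
    have h2 := hHeq r
    have h3 := sq_energyInt_le hv r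
    have hH := hHpos r hr'.1
    have hr0 := hr'.1
    rw [div_add' _ _ _ (by positivity)]
    refine div_nonneg ?_ (by positivity)
    refine nonneg_of_mul_nonneg_right (a := r) ?_ hr0
    have h4 := mul_le_mul_of_nonneg_right h1 hH.le
    have h5 : energyInt v r * (r * H' r)
      = energyInt v r * ((N + 4) * heightInt v r + energyInt v r / 3) := by rw [h2]
    nlinarith
  set K := energyInt v ρ / heightInt v ρ + C * ρ ^ 2 / 2 with hK
  obtain ⟨A, hA⟩ := exists_nat_ge ((N : ℝ) + 4 + (K + |C| * ρ ^ 2) / 3)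
  have hfreq : ∀ r ∈ Ioc 0 ρ, energyInt v r ≤ (K + |C| * ρ ^ 2) * heightInt v r := by
    intro r hr
    have h1 := hmono hr (right_mem_Ioc.2 hρ) hr.2
    have h2 : -(C * r ^ 2 / 2) ≤ |C| * ρ ^ 2 := by
      have e1 : r ^ 2 ≤ ρ ^ 2 := pow_le_pow_left₀ hr.1.le hr.2 2
      have e2 := neg_abs_le C
      have e3 : |C| * r ^ 2 ≤ |C| * ρ ^ 2 := mul_le_mul_of_nonneg_left e1 (abs_nonneg C)
      nlinarith [sq_nonneg r, abs_nonneg C]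
    rw [← div_le_iff₀ (hHpos r hr.1)]
    simp only at h1
    linarith
  refine ⟨A, heightInt v ρ / ρ ^ A, div_pos (hHpos ρ hρ) (by positivity), fun r hr => ?_⟩
  have hd2 : ∀ r ∈ Ioc 0 ρ, HasDerivAt (fun r => heightInt v r / r ^ A)
      ((H' r * r ^ A - heightInt v r * (A * r ^ (A - 1))) / (r ^ A) ^ 2) r := fun r hr =>
    (hH' r).div (hasDerivAt_pow A r) (pow_ne_zero _ hr.1.ne')
  have hanti : AntitoneOn (fun r => heightInt v r / r ^ A) (Ioc 0 ρ) := by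
    refine antitoneOn_of_deriv_nonpos (convex_Ioc 0 ρ)
      (fun r hr => (hd2 r hr).continuousAt.continuousWithinAt)
      (fun r hr => (hd2 r (interior_subset hr)).differentiableAt.differentiableWithinAt)
      fun r hr => ?_
    have hr' := interior_subset hr
    have hr0 := hr'.1
    rw [(hd2 r hr').deriv]
    refine div_nonpos_of_nonpos_of_nonneg ?_ (by positivity)
    refine nonpos_of_mul_nonpos_right (a := r) ?_ hr0
    have hApos : A ≠ 0 ∨ A = 0 := (em (A = 0)).symm
    have e : r * ((A : ℝ) * r ^ (A - 1)) = A * r ^ A := by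
      rcases hApos with h | h
      · rw [← mul_pow_sub_one h r]; ring
      · simp [h]
    have h2 := hHeq r
    have h3 := hfreq r hr'
    have hH := hHpos r hr0
    have h4 : r * H' r ≤ A * heightInt v r := by
      have := mul_le_mul_of_nonneg_right hA hH.le
      rw [h2]; linarith
    have h5 : 0 < r ^ A := by positivity
    have : r * (H' r * r ^ A - heightInt v r * (A * r ^ (A - 1)))
        = (r * H' r - A * heightInt v r) * r ^ A := by
      rw [mul_sub, ← mul_assoc r (heightInt v r), mul_comm r (heightInt v r), mul_assoc, e]; ring
    rw [this]
    exact mul_nonpos_of_nonpos_of_nonneg (by linarith) h5.le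
  have := hanti hr (right_mem_Ioc.2 hρ) hr.2
  simp only at this
  rwa [le_div_iff₀ (pow_pos hr.1 A)] at this

/-- A nontrivial solution of a semilinear equation satisfies a doubling estimate at arbitrarily
small scales. -/
theorem exists_doubling_scale {v : Eucl N → ℝ} (hv : ContDiff ℝ 2 v) {g G : ℝ → ℝ}
    (hg : Continuous g) (hG : ∀ s, HasDerivAt G (g s) s) {L ρ : ℝ} (hρ : 0 < ρ)
    (heq : ∀ x ∈ ball (0 : Eucl N) ρ, lapl v x = -g (v x))
    (hgL : ∀ x ∈ ball (0 : Eucl N) ρ, |g (v x)| ≤ L * |v x|)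
    (hGL : ∀ x ∈ ball (0 : Eucl N) ρ, |G (v x)| ≤ L * v x ^ 2)
    (hne : ∀ ε > 0, ∃ x : Eucl N, ‖x‖ < ε ∧ v x ≠ 0) :
    ∃ B : ℝ, 1 ≤ B ∧ ∀ ε > 0, ∃ r, 0 < r ∧ r < ε ∧ ∃ y ∈ closedBall (0 : Eucl N) r, v y ≠ 0 ∧
      ∀ z ∈ closedBall (0 : Eucl N) (8 * r), |v z| ≤ B * |v y| := by
  obtain ⟨A, c, hc, hlow⟩ := exists_pow_le_heightInt hv hg hG hρ heq hgL hGL hne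
  have hex : ∀ r : ℝ, 0 ≤ r → ∃ y ∈ closedBall (0 : Eucl N) r, ∀ z ∈ closedBall (0 : Eucl N) r,
      |v z| ≤ |v y| := by
    intro r hr
    obtain ⟨y, hy, h⟩ := (isCompact_closedBall (0 : Eucl N) r).exists_isMaxOn
      ⟨0, by simpa using hr⟩ (hv.continuous.abs).continuousOn
    exact ⟨y, hy, fun z hz => h hz⟩
  choose! Y hY hYmax using hex
  set M : ℝ := ∫ x : Eucl N, ballWeight 2 ρ x with hM
  have hM0 : 0 < M := integral_ballWeight_pos (by norm_num) hρ.ne'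
  have hup : ∀ r ∈ Ioc 0 ρ, heightInt v r ≤ v (Y r) ^ 2 * M := by
    intro r hr
    rw [hM, ← integral_const_mul, heightInt]
    refine integral_mono (integrable_mul_ballWeight (F := fun x => v x ^ 2)
      (hv.continuous.pow 2) (by norm_num) r)
      (integrable_mul_ballWeight (F := fun _ : Eucl N => v (Y r) ^ 2) continuous_const
        (by norm_num) ρ) fun x => ?_
    have h2 : ballWeight 2 r x ≤ ballWeight 2 ρ x :=
      posPow_mono 2 (by have := hr.1; have := hr.2; nlinarith)
    rcases lt_or_ge ‖x‖ r with hx | hx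
    · have h1 : v x ^ 2 ≤ v (Y r) ^ 2 := sq_le_sq.2 (hYmax r hr.1.le x (by simpa using hx.le))
      exact mul_le_mul h1 h2 (ballWeight_nonneg _ _ _) (sq_nonneg _)
    · simp only
      rw [ballWeight_eq_zero (by norm_num) (by rwa [abs_of_pos hr.1]), mul_zero]
      exact mul_nonneg (sq_nonneg _) (ballWeight_nonneg _ _ _)
  have hY0 : ∀ r ∈ Ioc 0 ρ, v (Y r) ≠ 0 := by
    intro r hr h0
    have h1 := hlow r hr
    have h2 := hup r hr
    rw [h0] at h2
    have : 0 < c * r ^ A := mul_pos hc (pow_pos hr.1 A)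
    nlinarith
  refine ⟨8 ^ (A + 1), one_le_pow₀ (by norm_num), fun ε hε => ?_⟩
  by_contra! hcon
  set r0 := min (ε / 2) ρ with hr0
  have hr0pos : 0 < r0 := lt_min (by linarith) hρ
  have hr0ε : r0 < ε := (min_le_left _ _).trans_lt (by linarith)
  have hr : ∀ k : ℕ, r0 * (1 / 8) ^ k ∈ Ioc 0 ρ := fun k =>
    ⟨by positivity, (mul_le_of_le_one_right hr0pos.le
      (pow_le_one₀ (by norm_num) (by norm_num))).trans (min_le_right _ _)⟩
  have hstep : ∀ k : ℕ, 8 ^ (A + 1) * |v (Y (r0 * (1 / 8) ^ (k + 1)))|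
      ≤ |v (Y (r0 * (1 / 8) ^ k))| := by
    intro k
    have hk := hr (k + 1)
    obtain ⟨z, hz, hlt⟩ := hcon (r0 * (1 / 8) ^ (k + 1)) hk.1
      ((mul_le_of_le_one_right hr0pos.le (pow_le_one₀ (by norm_num) (by norm_num))).trans_lt hr0ε)
      (Y (r0 * (1 / 8) ^ (k + 1))) (hY _ hk.1.le) (hY0 _ hk)
    have e : 8 * (r0 * (1 / 8) ^ (k + 1)) = r0 * (1 / 8) ^ k := by rw [pow_succ]; ring
    rw [e] at hz
    exact hlt.le.trans (hYmax _ (hr k).1.le z hz)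
  have hiter : ∀ k : ℕ, (8 ^ (A + 1)) ^ k * |v (Y (r0 * (1 / 8) ^ k))| ≤ |v (Y r0)| := by
    intro k
    induction k with
    | zero => simp
    | succ k ih =>
      refine le_trans ?_ ih
      rw [pow_succ, mul_assoc]
      exact mul_le_mul_of_nonneg_left (hstep k) (by positivity)
  have hfin : ∀ k : ℕ, (8 : ℝ) ^ k ≤ v (Y r0) ^ 2 * M / (c * r0 ^ A) := by
    intro k
    rw [le_div_iff₀ (by positivity)]
    have h1 := (hlow _ (hr k)).trans (hup _ (hr k))
    have h2 := pow_le_pow_left₀ (by positivity) (hiter k) 2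
    rw [mul_pow, sq_abs, sq_abs] at h2
    set q : ℝ := 8 ^ k with hq
    have hq1 : 1 ≤ q := one_le_pow₀ (by norm_num)
    have e1 : ((8 : ℝ) ^ (A + 1)) ^ k = q ^ (A + 1) := by rw [hq, ← pow_mul, ← pow_mul, mul_comm]
    have e2 : (1 / 8 : ℝ) ^ k = q⁻¹ := by rw [hq, one_div, inv_pow]
    rw [e1] at h2
    rw [e2] at h1 h2
    rw [mul_pow, inv_pow] at h1
    have hqp : 0 < q := by linarith
    have h3 : c * r0 ^ A ≤ q ^ A * (v (Y (r0 * q⁻¹)) ^ 2 * M) := by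
      have := mul_le_mul_of_nonneg_left h1 (by positivity : 0 ≤ q ^ A)
      calc c * r0 ^ A = q ^ A * (c * (r0 ^ A * (q ^ A)⁻¹)) := by field_simp
        _ ≤ _ := this
    calc q * (c * r0 ^ A) ≤ q * (q ^ A * (v (Y (r0 * q⁻¹)) ^ 2 * M)) :=
          mul_le_mul_of_nonneg_left h3 hqp.le
      _ = q ^ (A + 1) * v (Y (r0 * q⁻¹)) ^ 2 * M := by ring
      _ ≤ (q ^ (A + 1)) ^ 2 * v (Y (r0 * q⁻¹)) ^ 2 * M := by
          have : q ^ (A + 1) ≤ (q ^ (A + 1)) ^ 2 := by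
            have := one_le_pow₀ hq1 (n := A + 1)
            nlinarith
          gcongr
      _ ≤ v (Y r0) ^ 2 * M := mul_le_mul_of_nonneg_right h2 hM0.le
  obtain ⟨k, hk⟩ := pow_unbounded_of_one_lt (v (Y r0) ^ 2 * M / (c * r0 ^ A))
    (by norm_num : (1 : ℝ) < 8)
  exact absurd (hfin k) (not_le.2 hk)

end Doubling

section Corkscrew

variable {N : ℕ}

theorem exists_lipschitz_ballMean (N : ℕ) : ∃ C : ℝ, 1 ≤ C ∧ ∀ (v : Eucl N → ℝ), Continuous v →
    ∀ (s M : ℝ) (x y : Eucl N), 0 < s → 0 ≤ M → ‖y - x‖ ≤ s →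
    (∀ z ∈ closedBall x (2 * s), |v z| ≤ M) →
    |ballMean v s x - ballMean v s y| ≤ C * M * (‖y - x‖ / s) := by
  obtain ⟨K, hK⟩ := ContDiff.lipschitzWith_of_hasCompactSupport
    (hasCompactSupport_ballWeight (N := N) (k := 1 + 1) (by norm_num) 1)
    (contDiff_ballWeight_one (le_refl 1) 1) (by norm_num)
  set J := ∫ z : Eucl N, ballWeight 2 1 z with hJ
  have hJ0 : 0 < J := integral_ballWeight_two_pos
  set W := volume.real (closedBall (0 : Eucl N) 2) with hW
  have hW0 : 0 ≤ W := measureReal_nonneg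
  refine ⟨max 1 (K * W / J), le_max_left _ _, fun v hv s M x y hs hM hxy hb => ?_⟩
  set h : Eucl N := s⁻¹ • (y - x) with hh
  have hhn : ‖h‖ = ‖y - x‖ / s := by
    rw [hh, norm_smul, norm_inv, Real.norm_of_nonneg hs.le]; field_simp
  have hh1 : ‖h‖ ≤ 1 := by rw [hhn, div_le_one hs]; exact hxy
  have hy : y = x + s • h := by rw [hh, smul_inv_smul₀ hs.ne']; abel
  have e1 : ∫ z, v (y + s • z) * ballWeight 2 1 z
      = ∫ z, v (x + s • z) * ballWeight 2 1 (z - h) := by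
    rw [← integral_sub_right_eq_self _ h]
    refine integral_congr_ae (Filter.Eventually.of_forall fun z => ?_)
    simp only [hy, smul_sub]
    congr 2; abel
  have hi1 := integrable_comp_mul_ballWeight hv (k := 2) (by norm_num) s 1 x
  have hi2 : Integrable fun z => v (x + s • z) * ballWeight 2 1 (z - h) := by
    have := (integrable_comp_mul_ballWeight hv (k := 2) (by norm_num) s 1 y).comp_sub_right h
    refine this.congr (Filter.Eventually.of_forall fun z => ?_)
    simp only [hy, smul_sub]
    congr 2; abel
  have e2 : ballMean v s x - ballMean v s y
      = (∫ z, v (x + s • z) * (ballWeight 2 1 z - ballWeight 2 1 (z - h))) / J := by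
    simp only [ballMean]
    rw [← hJ, ← sub_div, e1, ← integral_sub hi1 hi2]
    simp only [mul_sub]
  have hzero : ∀ z ∉ closedBall (0 : Eucl N) 2,
      v (x + s • z) * (ballWeight 2 1 z - ballWeight 2 1 (z - h)) = 0 := by
    intro z hz
    rw [mem_closedBall, dist_zero_right, not_le] at hz
    have h1 : 1 ≤ ‖z - h‖ := by linarith [norm_sub_norm_le z h]
    rw [ballWeight_eq_zero (by norm_num) (by rw [abs_one]; linarith),
      ballWeight_eq_zero (by norm_num) (by rwa [abs_one]), sub_zero, mul_zero]
  have hbd : ‖∫ z, v (x + s • z) * (ballWeight 2 1 z - ballWeight 2 1 (z - h))‖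
      ≤ (M * (K * ‖h‖)) * W := by
    rw [← setIntegral_eq_integral_of_forall_compl_eq_zero hzero]
    refine norm_setIntegral_le_of_norm_le_const measure_closedBall_lt_top fun z hz => ?_
    rw [mem_closedBall, dist_zero_right] at hz
    rw [norm_mul]
    refine mul_le_mul (hb _ ?_) ?_ (norm_nonneg _) hM
    · rw [mem_closedBall, dist_eq_norm, add_sub_cancel_left, norm_smul, Real.norm_of_nonneg hs.le]
      nlinarith
    · have := hK.dist_le_mul z (z - h)
      rw [dist_eq_norm, dist_eq_norm, sub_sub_cancel] at this
      exact this
  rw [e2, abs_div, abs_of_pos hJ0, ← hhn, div_le_iff₀ hJ0]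
  have h3 : K * W ≤ max 1 (K * W / J) * J := by
    have := le_max_right 1 (K * W / J)
    rwa [div_le_iff₀ hJ0] at this
  have h4 : 0 ≤ M * ‖h‖ := by positivity
  rw [Real.norm_eq_abs] at hbd
  nlinarith

theorem ballMean_le_of_le_on_ball {v : Eucl N → ℝ} (hv : Continuous v) {s T D δ : ℝ}
    {x y : Eucl N} (hy : ‖y‖ + δ ≤ 1 / 2) (hT : 0 ≤ T) (hD : 0 ≤ D)
    (h1 : ∀ z : Eucl N, ‖z‖ < 1 → v (x + s • z) ≤ T)
    (h2 : ∀ z ∈ ball y δ, v (x + s • z) ≤ -D) :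
    ballMean v s x ≤
      T - D / 2 * volume.real (ball (0 : Eucl N) δ) / ∫ z : Eucl N, ballWeight 2 1 z := by
  have hJ0 : 0 < ∫ z : Eucl N, ballWeight 2 1 z := integral_ballWeight_two_pos
  have hpt : ∀ z : Eucl N, v (x + s • z) * ballWeight 2 1 z
      ≤ T * ballWeight 2 1 z + (ball y δ).indicator (fun _ => -(D / 2)) z := by
    intro z
    by_cases hm : z ∈ ball y δ
    · rw [indicator_of_mem hm]
      have h2 := h2 z hm
      rw [mem_ball, dist_eq_norm] at hm
      have hz2 : ‖z‖ ≤ 1 / 2 := by linarith [norm_le_norm_add_norm_sub' z y]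
      have h3 : 1 / 2 ≤ ballWeight 2 1 z := by
        have h4 : (3 / 4 : ℝ) ≤ 1 ^ 2 - ‖z‖ ^ 2 := by nlinarith [norm_nonneg z]
        have h5 : (3 / 4 : ℝ) ≤ max (1 ^ 2 - ‖z‖ ^ 2) 0 := h4.trans (le_max_left _ _)
        unfold ballWeight posPow
        nlinarith
      have h6 : 0 ≤ T * ballWeight 2 1 z := mul_nonneg hT (ballWeight_nonneg _ _ _)
      nlinarith
    · rw [indicator_of_notMem hm, add_zero]
      rcases lt_or_ge ‖z‖ 1 with hz | hz
      · exact mul_le_mul_of_nonneg_right (h1 z hz) (ballWeight_nonneg _ _ _)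
      · rw [ballWeight_eq_zero (by norm_num) (by rwa [abs_one])]
        simp
  have hi1 : Integrable fun z : Eucl N => T * ballWeight 2 1 z :=
    integrable_mul_ballWeight (F := fun _ : Eucl N => T) continuous_const
      (show (2 : ℕ) ≠ 0 by norm_num) 1
  have hi2 : Integrable fun z : Eucl N => (ball y δ).indicator (fun _ => -(D / 2)) z :=
    (integrable_indicator_iff measurableSet_ball).2 (integrableOn_const measure_ball_lt_top.ne)
  have hintegral := integral_mono (integrable_comp_mul_ballWeight hv (by norm_num) s 1 x)
    (hi1.add hi2) hpt
  rw [integral_add' hi1 hi2, integral_const_mul, integral_indicator measurableSet_ball,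
    setIntegral_const, smul_eq_mul] at hintegral
  have hWy : volume.real (ball y δ) = volume.real (ball (0 : Eucl N) δ) := by
    rw [measureReal_def, measureReal_def, Measure.addHaar_ball_center]
  rw [hWy] at hintegral
  rw [ballMean, div_le_iff₀ hJ0, sub_mul, div_mul_cancel₀ _ hJ0.ne']
  linarith

set_option maxHeartbeats 1000000 in
/-- Near a zero, a nontrivial superharmonic solution of `-Δv = g(v)` is positive on balls
comparable with their distance to the zero, at arbitrarily small scales. -/
theorem exists_corkscrew {v : Eucl N → ℝ} (hv : ContDiff ℝ 2 v) {g G : ℝ → ℝ}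
    (hg : Continuous g) (hG : ∀ s, HasDerivAt G (g s) s) {L ρ : ℝ} (hρ : 0 < ρ)
    (heq : ∀ x ∈ ball (0 : Eucl N) ρ, lapl v x = -g (v x))
    (hg0 : ∀ x ∈ ball (0 : Eucl N) ρ, 0 ≤ g (v x))
    (hgL : ∀ x ∈ ball (0 : Eucl N) ρ, |g (v x)| ≤ L * |v x|)
    (hGL : ∀ x ∈ ball (0 : Eucl N) ρ, |G (v x)| ≤ L * v x ^ 2)
    (hne : ∀ ε > 0, ∃ x : Eucl N, ‖x‖ < ε ∧ v x ≠ 0) (h0 : v 0 = 0) :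
    ∃ B : ℝ, 1 ≤ B ∧ ∀ ε > 0, ∃ r, 0 < r ∧ r < ε ∧ ∃ z : Eucl N, ‖z‖ ≤ 4 * r ∧
      ∀ y ∈ closedBall z (r / B), 0 < v y := by
  obtain ⟨B, hB1, hB⟩ := exists_doubling_scale hv hg hG hρ heq hgL hGL hne
  obtain ⟨C, hC1, hC⟩ := exists_lipschitz_ballMean N
  set J := ∫ z : Eucl N, ballWeight 2 1 z with hJ
  have hJ0 : 0 < J := integral_ballWeight_two_pos
  set L' := max L 1 with hL'
  have hL1 : 1 ≤ L' := le_max_right _ _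
  set β := 1 / (4 * C * B) with hβ
  have hCB : 1 ≤ C * B := one_le_mul_of_one_le_of_one_le hC1 hB1
  have hβ0 : 0 < β := by positivity
  have hβ1 : β ≤ 1 / 4 := by
    rw [hβ]; exact one_div_le_one_div_of_le (by norm_num) (by nlinarith)
  set W := volume.real (ball (0 : Eucl N) (β / 4)) with hW
  have hW0 : 0 < W := ENNReal.toReal_pos (measure_ball_pos volume _ (by positivity)).ne' measure_ball_lt_top.ne
  set κ := W / (4 * B * J) with hκ
  have hκ0 : 0 < κ := by positivity
  set θ := min (κ / 4) (1 / B) with hθ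
  have hθ0 : 0 < θ := lt_min (by positivity) (by positivity)
  have hθκ : θ ≤ κ / 4 := min_le_left _ _
  have hθB : θ ≤ 1 / B := min_le_right _ _
  have hθ1 : θ ≤ 1 := hθB.trans (by rw [div_le_one (by positivity)]; exact hB1)
  refine ⟨4 * C / θ, ?_, fun ε hε => ?_⟩
  · rw [le_div_iff₀ hθ0]; nlinarith
  obtain ⟨r, hr0, hr, y0, hy0, hvy0, hM⟩ := hB (min (min ε 1) (min (ρ / 8) (θ / (128 * L'))))
    (by positivity)
  have hrε : r < ε := hr.trans_le ((min_le_left _ _).trans (min_le_left _ _))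
  have hr1 : r < 1 := hr.trans_le ((min_le_left _ _).trans (min_le_right _ _))
  have hrρ : 8 * r < ρ := by
    have := hr.trans_le ((min_le_right _ _).trans (min_le_left _ _)); linarith
  have hrL : 128 * (L' * r ^ 2) ≤ θ := by
    have := hr.trans_le ((min_le_right _ _).trans (min_le_right _ _))
    rw [lt_div_iff₀ (by positivity)] at this
    nlinarith [mul_pos (show 0 < L' by linarith) hr0]
  set M := B * |v y0| with hMd
  have hM0 : 0 < M := by positivity
  have hvM : |v y0| = M / B := by rw [hMd]; field_simp
  rw [mem_closedBall, dist_zero_right] at hy0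
  have hsub : ∀ x : Eucl N, ∀ s, ‖x‖ + s ≤ 8 * r → ball x s ⊆ ball 0 (8 * r) := by
    intro x s h z hz
    rw [mem_ball, dist_eq_norm] at hz
    rw [mem_ball, dist_zero_right]
    linarith [norm_le_norm_add_norm_sub' z x]
  have hsub' : ∀ x : Eucl N, ∀ s, ‖x‖ + s ≤ 8 * r → closedBall x s ⊆ closedBall 0 (8 * r) := by
    intro x s h z hz
    rw [mem_closedBall, dist_eq_norm] at hz
    rw [mem_closedBall, dist_zero_right]
    linarith [norm_le_norm_add_norm_sub' z x]
  have hsup : ∀ x ∈ ball (0 : Eucl N) (8 * r), lapl v x ≤ 0 ∧ -lapl v x ≤ L' * M := by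
    intro x hx
    have hx' : x ∈ ball (0 : Eucl N) ρ := ball_subset_ball hrρ.le hx
    rw [heq x hx', neg_neg]
    refine ⟨by linarith [hg0 x hx'], (le_abs_self _).trans ((hgL x hx').trans ?_)⟩
    exact mul_le_mul (le_max_left _ _) (hM x (ball_subset_closedBall hx)) (abs_nonneg _)
      (by linarith)
  have hle : ∀ x : Eucl N, ∀ s, 0 ≤ s → ‖x‖ + s ≤ 8 * r → ballMean v s x ≤ v x := fun x s hs h =>
    ballMean_le hv hs fun y hy => (hsup y (hsub x s h hy)).1
  have hge : ∀ x : Eucl N, ∀ s, 0 ≤ s → ‖x‖ + s ≤ 8 * r →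
      v x ≤ ballMean v s x + L' * M * s ^ 2 := fun x s hs h =>
    le_ballMean_add hv hs (by positivity) (fun y hy => (hsup y (hsub x s h hy)).1)
      fun y hy => (hsup y (hsub x s h hy)).2
  have hlip : ∀ x y : Eucl N, ‖x‖ + 2 * r ≤ 8 * r → ‖y - x‖ ≤ r →
      |ballMean v r x - ballMean v r y| ≤ C * M * (‖y - x‖ / r) := fun x y hx hxy =>
    hC v hv.continuous r M x y hr0 hM0.le hxy fun z hz => hM z (hsub' x _ hx hz)
  have hfin : ∀ z : Eucl N, ‖z‖ ≤ 4 * r → θ * M ≤ v z →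
      ∀ y ∈ closedBall z (r / (4 * C / θ)), 0 < v y := by
    intro z hz hvz y hy
    rw [mem_closedBall, dist_eq_norm] at hy
    have h1 : r / (4 * C / θ) = θ / (4 * C) * r := by field_simp
    have h2 : θ / (4 * C) ≤ 1 := by rw [div_le_one (by positivity)]; linarith
    rw [h1] at hy
    have h3 : ‖y - z‖ ≤ r := hy.trans (mul_le_of_le_one_left hr0.le h2)
    have h4 := hlip z y (by linarith) h3
    have h5 : C * M * (‖y - z‖ / r) ≤ θ * M / 4 := by
      have : ‖y - z‖ / r ≤ θ / (4 * C) := by rwa [div_le_iff₀ hr0]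
      calc C * M * (‖y - z‖ / r) ≤ C * M * (θ / (4 * C)) := by gcongr
        _ = θ * M / 4 := by field_simp
    have h6 := hle y r hr0.le (by linarith [norm_le_norm_add_norm_sub' y z])
    have h7 := hge z r hr0.le (by linarith)
    have h8 := abs_le.1 (h4.trans h5)
    have h9 : L' * M * r ^ 2 ≤ θ * M / 128 := by
      linarith [mul_le_mul_of_nonneg_left hrL hM0.le]
    have : 0 < θ * M := by positivity
    linarith [h8.2]
  refine ⟨r, hr0, hrε, ?_⟩
  rcases lt_or_gt_of_ne hvy0 with hneg | hpos
  · rw [abs_of_neg hneg] at hvM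
    by_contra! hcon
    have hub : ∀ z : Eucl N, ‖z‖ ≤ 4 * r → v z ≤ θ * M := by
      intro z hz
      by_contra! h
      obtain ⟨y, hy, hy'⟩ := hcon z hz
      exact absurd (hfin z hz h.le y hy) (not_lt.2 hy')
    have hlow : ∀ y ∈ ball y0 (β * r), v y ≤ -(M / (2 * B)) := by
      intro y hy
      rw [mem_ball, dist_eq_norm] at hy
      have h3 : ‖y - y0‖ ≤ r :=
        hy.le.trans (mul_le_of_le_one_left hr0.le (by linarith))
      have h4 := hlip y0 y (by linarith) h3
      have h5 : C * M * (‖y - y0‖ / r) ≤ M / (4 * B) := by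
        have : ‖y - y0‖ / r ≤ β := by rw [div_le_iff₀ hr0]; exact hy.le
        calc C * M * (‖y - y0‖ / r) ≤ C * M * β := by gcongr
          _ = M / (4 * B) := by rw [hβ]; field_simp
      have h6 := hge y r hr0.le (by linarith [norm_le_norm_add_norm_sub' y y0])
      have h7 := hle y0 r hr0.le (by linarith)
      have h8 := abs_le.1 (h4.trans h5)
      have h9 : L' * M * r ^ 2 ≤ M / (4 * B) := by
        have : 4 * (L' * r ^ 2) ≤ 1 / B := by
          linarith [show 0 ≤ L' * r ^ 2 by positivity]
        calc L' * M * r ^ 2 = M / 4 * (4 * (L' * r ^ 2)) := by ring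
          _ ≤ M / 4 * (1 / B) := by gcongr
          _ = M / (4 * B) := by field_simp
      have h10 : M / B = M / (4 * B) + M / (4 * B) + M / (2 * B) := by field_simp; ring
      linarith [h8.1]
    set y1 : Eucl N := (4 * r)⁻¹ • y0 with hy1
    have hy1n : ‖y1‖ ≤ 1 / 4 := by
      rw [hy1, norm_smul, norm_inv, Real.norm_of_nonneg (by positivity),
        inv_mul_le_iff₀ (by positivity)]
      linarith
    have hmean := hge 0 (4 * r) (by positivity) (by rw [norm_zero]; linarith)
    have hm2 : ballMean v (4 * r) 0 ≤ θ * M - κ * M := by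
      refine (ballMean_le_of_le_on_ball hv.continuous (y := y1) (δ := β / 4) (T := θ * M)
        (D := M / (2 * B)) (by linarith) (by positivity) (by positivity) (fun z hz => ?_)
        fun z hz => ?_).trans_eq ?_
      · rw [zero_add]
        refine hub _ ?_
        rw [norm_smul, Real.norm_of_nonneg (by positivity)]
        nlinarith
      · rw [zero_add]
        refine hlow _ ?_
        rw [mem_ball, dist_eq_norm] at hz
        have : (4 * r) • z - y0 = (4 * r) • (z - y1) := by
          rw [hy1, smul_sub, smul_inv_smul₀ (by positivity)]
        rw [mem_ball, dist_eq_norm, this, norm_smul, Real.norm_of_nonneg (by positivity)]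
        nlinarith
      · rw [hκ, hW, hJ]
        field_simp
        ring
    rw [h0] at hmean
    have h1 : L' * M * (4 * r) ^ 2 ≤ M * θ / 8 := by
      linarith [mul_le_mul_of_nonneg_left hrL hM0.le]
    have : 0 < M * κ := by positivity
    have : M * θ ≤ M * (κ / 4) := by gcongr
    linarith
  · rw [abs_of_pos hpos] at hvM
    refine ⟨y0, by linarith, hfin y0 (by linarith) ?_⟩
    rw [hvM, div_eq_mul_one_div, mul_comm]
    gcongr

end Corkscrew

section Kernel

variable {N : ℕ}

/-- Weighted integral in the radius of the profiles `(r² - s)₊ᵏ`. -/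
def radiusInt (τ R : ℝ) (q k : ℕ) (s : ℝ) : ℝ :=
  ∫ r in τ..R, (r ^ q)⁻¹ * posPow k (r ^ 2 - s)

theorem continuousOn_inv_pow_uIcc {τ R : ℝ} (hτ : 0 < τ) (hR : τ ≤ R) (q : ℕ) :
    ContinuousOn (fun r : ℝ => (r ^ q)⁻¹) (uIcc τ R) := by
  refine (continuous_pow q).continuousOn.inv₀ fun r hr => ?_
  rw [uIcc_of_le hR] at hr
  exact pow_ne_zero _ (hτ.trans_le hr.1).ne'

theorem continuousOn_radiusInt_integrand {τ R : ℝ} (hτ : 0 < τ) (hR : τ ≤ R) (q k : ℕ) (s : ℝ) :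
    ContinuousOn (fun r : ℝ => (r ^ q)⁻¹ * posPow k (r ^ 2 - s)) (uIcc τ R) :=
  (continuousOn_inv_pow_uIcc hτ hR q).mul
    ((continuous_posPow k).comp (by fun_prop)).continuousOn

theorem hasDerivAt_radiusInt {τ R : ℝ} (hτ : 0 < τ) (hR : τ ≤ R) (q : ℕ) {k : ℕ} (hk : 1 ≤ k)
    (s : ℝ) : HasDerivAt (radiusInt τ R q (k + 1)) (-(k + 1) * radiusInt τ R q k s) s := by
  have hm : ∀ (j : ℕ) (s : ℝ), AEStronglyMeasurable
      (fun r : ℝ => (r ^ q)⁻¹ * posPow j (r ^ 2 - s)) (volume.restrict (uIoc τ R)) := fun j s =>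
    ((continuousOn_radiusInt_integrand hτ hR q j s).mono uIoc_subset_uIcc).aestronglyMeasurable
      measurableSet_uIoc
  have key := (intervalIntegral.hasDerivAt_integral_of_dominated_loc_of_deriv_le
    (μ := volume) (a := τ) (b := R)
    (F := fun s r => (r ^ q)⁻¹ * posPow (k + 1) (r ^ 2 - s))
    (F' := fun s r => (r ^ q)⁻¹ * (-(k + 1) * posPow k (r ^ 2 - s))) (x₀ := s) (s := ball s 1)
    (bound := fun r => (r ^ q)⁻¹ * ((k + 1) * posPow k (r ^ 2 - (s - 1))))
    (ball_mem_nhds s one_pos) (Filter.Eventually.of_forall fun s => hm _ s)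
    (continuousOn_radiusInt_integrand hτ hR q _ s).intervalIntegrable ?_ ?_ ?_ ?_).2
  · refine key.congr_deriv ?_
    rw [radiusInt, ← intervalIntegral.integral_const_mul]
    congr 1; ext r; ring
  · refine ((hm k s).const_mul (-(k + 1 : ℝ))).congr (Filter.Eventually.of_forall fun r => ?_)
    simp only; ring
  · refine Filter.Eventually.of_forall fun r hr y hy => ?_
    have hr0 : 0 < r := by
      rw [uIoc_of_le hR] at hr; exact hτ.trans hr.1
    rw [norm_mul, norm_mul, norm_neg, Real.norm_of_nonneg (by positivity),
      Real.norm_of_nonneg (by positivity), Real.norm_of_nonneg (posPow_nonneg _ _)]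
    have : posPow k (r ^ 2 - y) ≤ posPow k (r ^ 2 - (s - 1)) := posPow_mono k (by
      rw [mem_ball, Real.dist_eq, abs_lt] at hy; linarith [hy.1])
    gcongr
  · refine ContinuousOn.intervalIntegrable ?_
    refine ((continuousOn_radiusInt_integrand hτ hR q k (s - 1)).const_mul (k + 1 : ℝ)).congr
      fun r _ => ?_
    simp only; ring
  · refine Filter.Eventually.of_forall fun r _ y _ => ?_
    have h1 : HasDerivAt (fun y : ℝ => r ^ 2 - y) (-1) y := by
      simpa using (hasDerivAt_id y).const_sub (r ^ 2)
    have h2 := ((hasDerivAt_posPow hk _).comp y h1).const_mul (r ^ q)⁻¹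
    exact h2.congr_deriv (by ring)

theorem continuous_radiusInt {τ R : ℝ} (hτ : 0 < τ) (hR : τ ≤ R) (q : ℕ) {k : ℕ} (hk : 2 ≤ k) :
    Continuous (radiusInt τ R q k) := by
  obtain ⟨j, rfl⟩ : ∃ j, k = j + 1 := ⟨k - 1, by omega⟩
  exact continuous_iff_continuousAt.2 fun s =>
    (hasDerivAt_radiusInt hτ hR q (by omega) s).continuousAt

theorem contDiff_radiusInt {τ R : ℝ} (hτ : 0 < τ) (hR : τ ≤ R) (q : ℕ) {k : ℕ} (hk : 2 ≤ k) :
    ContDiff ℝ 2 (radiusInt τ R q (k + 2)) := by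
  have hd : ∀ j, 1 ≤ j → deriv (radiusInt τ R q (j + 1)) =
      fun s => -(j + 1) * radiusInt τ R q j s := fun j hj =>
    funext fun s => (hasDerivAt_radiusInt hτ hR q hj s).deriv
  have h1 : ContDiff ℝ 1 (radiusInt τ R q (k + 1)) := by
    rw [contDiff_one_iff_deriv, hd k (by omega)]
    exact ⟨fun s => (hasDerivAt_radiusInt hτ hR q (by omega) s).differentiableAt,
      continuous_const.mul (continuous_radiusInt hτ hR q hk)⟩
  rw [show (2 : WithTop ℕ∞) = 1 + 1 by norm_num, contDiff_succ_iff_deriv, hd (k + 1) (by omega)]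
  exact ⟨fun s => (hasDerivAt_radiusInt hτ hR q (by omega) s).differentiableAt, by simp,
    contDiff_const.mul h1⟩

theorem radiusInt_identity {τ R : ℝ} (hτ : 0 < τ) (hR : τ ≤ R) {k : ℕ} (hk : 1 ≤ k) (d : ℕ)
    (s : ℝ) :
    2 * (k + 1) * s * radiusInt τ R (2 * (k + 1) + d + 1) k s
      - d * radiusInt τ R (2 * (k + 1) + d + 1) (k + 1) s
      = (R ^ (2 * (k + 1) + d))⁻¹ * posPow (k + 1) (R ^ 2 - s)
        - (τ ^ (2 * (k + 1) + d))⁻¹ * posPow (k + 1) (τ ^ 2 - s) := by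
  set q := 2 * (k + 1) + d with hq
  have hi : ∀ j, IntervalIntegrable (fun r : ℝ => (r ^ (q + 1))⁻¹ * posPow j (r ^ 2 - s))
      volume τ R := fun j =>
    (continuousOn_radiusInt_integrand hτ hR (q + 1) j s).intervalIntegrable
  have hd : ∀ r ∈ uIcc τ R, HasDerivAt (fun r : ℝ => (r ^ q)⁻¹ * posPow (k + 1) (r ^ 2 - s))
      (2 * (k + 1) * s * ((r ^ (q + 1))⁻¹ * posPow k (r ^ 2 - s))
        - d * ((r ^ (q + 1))⁻¹ * posPow (k + 1) (r ^ 2 - s))) r := by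
    intro r hr
    rw [uIcc_of_le hR] at hr
    have hr0 : r ≠ 0 := (hτ.trans_le hr.1).ne'
    have h1 : HasDerivAt (fun r : ℝ => r ^ 2 - s) (2 * r) r := by
      simpa using (hasDerivAt_pow 2 r).sub_const s
    have h2 := ((hasDerivAt_pow q r).inv (pow_ne_zero _ hr0)).mul
      ((hasDerivAt_posPow hk (r ^ 2 - s)).comp r h1)
    refine h2.congr_deriv ?_
    have h3 := mul_posPow k (by omega) (r ^ 2 - s)
    have h4 : posPow (k + 1) (r ^ 2 - s) = (r ^ 2 - s) * posPow k (r ^ 2 - s) := h3.symm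
    have h5 : (r : ℝ) ^ (q - 1) = r ^ q / r := by
      rw [eq_div_iff hr0, ← pow_succ]; congr 1; omega
    simp only [Function.comp, Pi.inv_apply]
    rw [h4, h5, pow_succ, hq]
    push_cast
    rw [← hq]
    field_simp
    ring
  have hintegral := intervalIntegral.integral_eq_sub_of_hasDerivAt hd
    (((hi k).const_mul _).sub ((hi (k + 1)).const_mul _))
  rw [intervalIntegral.integral_sub ((hi k).const_mul _) ((hi (k + 1)).const_mul _),
    intervalIntegral.integral_const_mul, intervalIntegral.integral_const_mul] at hintegral
  exact hintegral

/-- The normalized radial weight `(r² - |x|²)₊ᵏ`. -/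
def ballKernel (k : ℕ) (r : ℝ) (x : Eucl N) : ℝ :=
  (r ^ (2 * k + N))⁻¹ * ballWeight k r x / ∫ z : Eucl N, ballWeight k 1 z

/-- The difference of two normalized radial weights is the Laplacian of a compactly supported
function. -/
theorem exists_lapl_eq_ballKernel_sub {k : ℕ} (hk : 3 ≤ k) {τ R : ℝ} (hτ : 0 < τ) (hR : τ ≤ R) :
    ∃ κ : Eucl N → ℝ, ContDiff ℝ 2 κ ∧ (∀ x, R ≤ ‖x‖ → κ x = 0) ∧
      ∀ x, lapl κ x = ballKernel k R x - ballKernel k τ x := by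
  obtain ⟨j, rfl⟩ : ∃ j, k = j + 1 := ⟨k - 1, by omega⟩
  set q := 2 * (j + 1) + N + 1 with hq
  set J := ∫ z : Eucl N, ballWeight (j + 1) 1 z with hJ
  have hJ0 : 0 < J := integral_ballWeight_pos (by omega) one_ne_zero
  have hj0 : (0 : ℝ) < j + 2 := by positivity
  have hC2 : ContDiff ℝ 2 fun x : Eucl N => radiusInt τ R q (j + 2) (‖x‖ ^ 2) :=
    (contDiff_radiusInt hτ hR q (by omega)).comp (contDiff_norm_sq ℝ)
  refine ⟨fun x => (1 / (2 * (j + 2) * J)) * radiusInt τ R q (j + 2) (‖x‖ ^ 2),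
    contDiff_const.mul hC2, fun x hx => ?_, fun x => ?_⟩
  · have : radiusInt τ R q (j + 2) (‖x‖ ^ 2) = 0 := by
      rw [radiusInt, intervalIntegral.integral_congr (g := fun _ => 0), intervalIntegral.integral_zero]
      intro r hr
      rw [uIcc_of_le hR] at hr
      simp only
      rw [posPow_of_nonpos (by nlinarith [hr.1, hr.2]) (by omega), mul_zero]
    simp only [this, mul_zero]
  · rw [lapl_const_mul _ hC2, lapl_comp (g := radiusInt τ R q (j + 2))
      (g' := fun s => -(j + 2) * radiusInt τ R q (j + 1) s)
      (g'' := fun s => -(j + 2) * (-(j + 1) * radiusInt τ R q j s))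
      (fun s => (hasDerivAt_radiusInt hτ hR q (by omega) s).congr_deriv (by push_cast; ring))
      (fun s => (hasDerivAt_radiusInt hτ hR q (by omega) s).const_mul _) (contDiff_norm_sq ℝ),
      lapl_norm_sq]
    have hs : ∑ i, pd i (fun y : Eucl N => ‖y‖ ^ 2) x ^ 2 = 4 * ‖x‖ ^ 2 := by
      simp only [pd_norm_sq, mul_pow, ← Finset.mul_sum, sum_coord_sq]
      norm_num
    have hid := radiusInt_identity hτ hR (k := j) (by omega) N (‖x‖ ^ 2)
    rw [← hq] at hid
    have e : ∀ r : ℝ, ballKernel (j + 1) r x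
        = (r ^ (2 * (j + 1) + N))⁻¹ * posPow (j + 1) (r ^ 2 - ‖x‖ ^ 2) / J := fun r => rfl
    rw [hs, e, e, ← sub_div, ← hid]
    field_simp
    ring

theorem ballKernel_nonneg (k : ℕ) {r : ℝ} (hr : 0 ≤ r) (x : Eucl N) : 0 ≤ ballKernel k r x :=
  div_nonneg (mul_nonneg (by positivity) (ballWeight_nonneg _ _ _))
    (integral_nonneg fun _ => ballWeight_nonneg _ _ _)

theorem ballKernel_eq_zero {k : ℕ} (hk : k ≠ 0) {r : ℝ} (hr : 0 ≤ r) {x : Eucl N}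
    (hx : r ≤ ‖x‖) : ballKernel k r x = 0 := by
  rw [ballKernel, ballWeight_eq_zero hk (by rwa [abs_of_nonneg hr])]; simp

theorem continuous_ballKernel (k : ℕ) (r : ℝ) : Continuous (ballKernel (N := N) k r) :=
  (continuous_const.mul (continuous_ballWeight k r)).div_const _

theorem integral_ballKernel {k : ℕ} (hk : k ≠ 0) {r : ℝ} (hr : 0 < r) :
    ∫ x : Eucl N, ballKernel k r x = 1 := by
  have hJ0 : 0 < ∫ z : Eucl N, ballWeight k 1 z := integral_ballWeight_pos hk one_ne_zero
  have h1 := Measure.integral_comp_smul (volume : Measure (Eucl N)) (ballWeight k 1) r⁻¹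
  have h2 : ∀ x : Eucl N, ballWeight k 1 (r⁻¹ • x) = (r ^ (2 * k))⁻¹ * ballWeight k r x := by
    intro x
    have e : r ^ 2 - ‖x‖ ^ 2 = r ^ 2 * (1 ^ 2 - ‖r⁻¹ • x‖ ^ 2) := by
      rw [norm_smul, norm_inv, Real.norm_of_nonneg hr.le]; field_simp
    have : max (r ^ 2 - ‖x‖ ^ 2) 0 = r ^ 2 * max (1 ^ 2 - ‖r⁻¹ • x‖ ^ 2) 0 := by
      rw [e, mul_max_of_nonneg _ _ (by positivity), mul_zero]
    rw [ballWeight, ballWeight, posPow, posPow, this, mul_pow, ← pow_mul]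
    field_simp
  simp only [h2] at h1
  rw [finrank_euclideanSpace_fin, integral_const_mul, smul_eq_mul, abs_of_pos (by positivity),
    inv_pow, inv_inv] at h1
  simp only [ballKernel]
  rw [integral_div, integral_const_mul, div_eq_one_iff_eq hJ0.ne', pow_add, mul_inv, mul_right_comm,
    h1]
  field_simp

end Kernel

section Extrapolation

theorem prod_abs_sub_range_erase {n j : ℕ} (hj : j ≤ n) :
    ∏ i ∈ (Finset.range (n + 1)).erase j, |(j : ℝ) - i| = (j.factorial : ℝ) * (n - j).factorial := by
  have h1 : ∏ i ∈ (Finset.range (n + 1)).erase j, |(j : ℝ) - i|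
      = ∏ i ∈ Finset.range (n + 1), if i = j then 1 else |(j : ℝ) - i| := by
    rw [← Finset.mul_prod_erase (Finset.range (n + 1)) _ (Finset.mem_range.2 (by omega : j < n + 1)),
      if_pos rfl, one_mul]
    exact Finset.prod_congr rfl fun i hi => by rw [if_neg (Finset.ne_of_mem_erase hi)]
  rw [h1, show n + 1 = j + (n - j + 1) by omega, Finset.prod_range_add, Finset.prod_range_succ']
  simp only [add_zero, if_true, mul_one]
  congr 1
  · rw [← Finset.prod_range_reflect, ← Finset.prod_range_add_one_eq_factorial]
    push_cast
    refine Finset.prod_congr rfl fun i hi => ?_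
    have := Finset.mem_range.1 hi
    rw [if_neg (by omega), show j - 1 - i = j - (i + 1) by omega, Nat.cast_sub (by omega)]
    push_cast
    rw [sub_sub_cancel, abs_of_nonneg (by positivity)]
  · rw [← Finset.prod_range_add_one_eq_factorial]
    push_cast
    refine Finset.prod_congr rfl fun i hi => ?_
    rw [if_neg (by omega), show (j : ℝ) - (j + (i + 1)) = -(i + 1) by ring, abs_neg,
      abs_of_nonneg (by positivity)]

/-- Evaluation at `0` of polynomials of degree at most `2 * m` through values in `[1, 1 + β]`,
with coefficients growing at most geometrically in `m`. -/
theorem exists_extrapolation {β : ℝ} (hβ : 0 < β) (hβ1 : β ≤ 1) : ∃ C : ℝ, 1 ≤ C ∧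
    ∀ m : ℕ, 1 ≤ m → ∃ c s : ℕ → ℝ, (∀ j ∈ Finset.range (2 * m + 1), s j ∈ Icc 1 (1 + β)) ∧
      (∑ j ∈ Finset.range (2 * m + 1), |c j| ≤ C ^ m) ∧
      ∀ P : Polynomial ℝ, P.natDegree ≤ 2 * m →
        ∑ j ∈ Finset.range (2 * m + 1), c j * P.eval (s j) = P.eval 0 := by
  have hC1 : 1 ≤ 4 * Real.exp 1 / β := by
    rw [le_div_iff₀ hβ]; nlinarith [Real.add_one_le_exp 1]
  refine ⟨(4 * Real.exp 1 / β) ^ 2, one_le_pow₀ hC1, fun m hm => ?_⟩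
  set n := 2 * m with hn
  have hn0 : (0 : ℝ) < n := by
    have : 0 < n := by omega
    exact_mod_cast this
  set s : ℕ → ℝ := fun j => 1 + β * j / n with hs
  have hsub : ∀ i j : ℕ, s j - s i = β / n * (j - i) := fun i j => by simp only [hs]; ring
  have hinj : Set.InjOn s (Finset.range (n + 1)) := fun i _ j _ h => by
    have : s j - s i = 0 := by rw [h, sub_self]
    rw [hsub] at this
    have h2 : (j : ℝ) - i = 0 := by
      rcases mul_eq_zero.1 this with h3 | h3
      · exact absurd h3 (by positivity)
      · exact h3
    exact_mod_cast (sub_eq_zero.1 h2).symm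
  have hmem : ∀ j ∈ Finset.range (n + 1), s j ∈ Icc 1 (1 + β) := fun j hj => by
    have hj' : (j : ℝ) ≤ n := by exact_mod_cast Nat.lt_succ_iff.1 (Finset.mem_range.1 hj)
    refine ⟨by simp only [hs]; linarith [show 0 ≤ β * j / n by positivity], ?_⟩
    simp only [hs, add_le_add_iff_left]
    rw [div_le_iff₀ hn0]
    gcongr
  refine ⟨fun j => (Lagrange.basis (Finset.range (n + 1)) s j).eval 0, s, hmem, ?_, ?_⟩
  · have hc : ∀ j ∈ Finset.range (n + 1), |(Lagrange.basis (Finset.range (n + 1)) s j).eval 0|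
        ≤ (2 * n / β) ^ n / n.factorial * n.choose j := by
      intro j hj
      have hj' : j ≤ n := Nat.lt_succ_iff.1 (Finset.mem_range.1 hj)
      have hcard : ((Finset.range (n + 1)).erase j).card = n := by
        rw [Finset.card_erase_of_mem hj, Finset.card_range]; omega
      rw [Lagrange.basis, Polynomial.eval_prod, Finset.abs_prod]
      calc ∏ i ∈ (Finset.range (n + 1)).erase j, |(Lagrange.basisDivisor (s j) (s i)).eval 0|
          ≤ ∏ i ∈ (Finset.range (n + 1)).erase j, (2 * n / β) * |(j : ℝ) - i|⁻¹ := by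
            refine Finset.prod_le_prod (fun _ _ => abs_nonneg _) fun i hi => ?_
            have h2 := hmem i (Finset.mem_of_mem_erase hi)
            simp only [Lagrange.basisDivisor, Polynomial.eval_mul, Polynomial.eval_C,
              Polynomial.eval_sub, Polynomial.eval_X, zero_sub]
            rw [abs_mul, abs_neg, hsub, abs_inv, abs_mul, abs_of_pos (show 0 < β / n by positivity),
              abs_of_pos (show 0 < s i by linarith [h2.1])]
            have h3 : s i ≤ 2 := by linarith [h2.2]
            calc (β / n * |(j : ℝ) - i|)⁻¹ * s i ≤ (β / n * |(j : ℝ) - i|)⁻¹ * 2 := by gcongr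
              _ = 2 * n / β * |(j : ℝ) - i|⁻¹ := by
                rw [mul_inv, inv_div]; ring
        _ = (2 * n / β) ^ n / n.factorial * n.choose j := by
            rw [Finset.prod_mul_distrib, Finset.prod_const, hcard, Finset.prod_inv_distrib,
              prod_abs_sub_range_erase hj', Nat.cast_choose ℝ hj']
            have : (n.factorial : ℝ) ≠ 0 := by positivity
            field_simp
    calc ∑ j ∈ Finset.range (n + 1), |(Lagrange.basis (Finset.range (n + 1)) s j).eval 0|
        ≤ ∑ j ∈ Finset.range (n + 1), (2 * n / β) ^ n / n.factorial * n.choose j :=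
          Finset.sum_le_sum hc
      _ = (4 / β) ^ n * ((n : ℝ) ^ n / n.factorial) := by
          rw [← Finset.mul_sum]
          have : ∑ j ∈ Finset.range (n + 1), ((n.choose j : ℕ) : ℝ) = 2 ^ n := by
            exact_mod_cast Nat.sum_range_choose n
          rw [this, show (2 * (n : ℝ) / β) = 2 * n * β⁻¹ by ring, show (4 / β) = 2 * 2 * β⁻¹ by ring]
          simp only [mul_pow]
          ring
      _ ≤ (4 / β) ^ n * Real.exp n := by
          gcongr
          exact Real.pow_div_factorial_le_exp n (by positivity) n
      _ = ((4 * Real.exp 1 / β) ^ 2) ^ m := by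
          rw [← pow_mul, ← hn, mul_comm (4 : ℝ), mul_div_assoc, mul_pow, ← Real.exp_nat_mul, mul_one,
            mul_comm]
  · intro P hP
    have hdeg : P.degree < (Finset.range (n + 1)).card := by
      rw [Finset.card_range]
      exact lt_of_le_of_lt Polynomial.degree_le_natDegree (by exact_mod_cast Nat.lt_succ_of_le hP)
    have h := congrArg (Polynomial.eval 0) (Lagrange.eq_interpolate hinj hdeg)
    rw [h, Lagrange.interpolate_apply, Polynomial.eval_finsetSum]
    refine Finset.sum_congr rfl fun j _ => ?_
    rw [Polynomial.eval_mul, Polynomial.eval_C, mul_comm]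

end Extrapolation

section SetConvolution

variable {N : ℕ}

/-- Convolution of `k` with the indicator function of `S`. -/
def setConv (S : Set (Eucl N)) (k : Eucl N → ℝ) (x : Eucl N) : ℝ := ∫ y in S, k (x - y)

theorem setConv_eq_convolution {S : Set (Eucl N)} (hS : MeasurableSet S) (k : Eucl N → ℝ) :
    setConv S k = convolution (S.indicator fun _ => (1 : ℝ)) k (ContinuousLinearMap.mul ℝ ℝ)
      volume := by
  ext x
  rw [setConv, ← integral_indicator hS, convolution]
  refine integral_congr_ae (Filter.Eventually.of_forall fun y => ?_)
  by_cases hy : y ∈ S <;> simp [hy]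

theorem locallyIntegrable_indicator_one {S : Set (Eucl N)} (hS : MeasurableSet S)
    (hfin : volume S ≠ ⊤) : LocallyIntegrable (S.indicator fun _ => (1 : ℝ)) :=
  ((integrable_indicator_iff hS).2 (integrableOn_const hfin)).locallyIntegrable

theorem contDiff_setConv {S : Set (Eucl N)} (hS : MeasurableSet S) (hfin : volume S ≠ ⊤)
    {k : Eucl N → ℝ} {n : ℕ∞} (hk : ContDiff ℝ n k) (hc : HasCompactSupport k) :
    ContDiff ℝ n (setConv S k) := by
  rw [setConv_eq_convolution hS]
  exact hc.contDiff_convolution_right _ (locallyIntegrable_indicator_one hS hfin) hk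

theorem pd_setConv {S : Set (Eucl N)} (hS : MeasurableSet S) (hfin : volume S ≠ ⊤)
    {k : Eucl N → ℝ} (hk : ContDiff ℝ 1 k) (hc : HasCompactSupport k) (i : Fin N) :
    pd i (setConv S k) = setConv S (pd i k) := by
  have hl := locallyIntegrable_indicator_one hS hfin
  ext x
  have h := hc.hasFDerivAt_convolution_right (ContinuousLinearMap.mul ℝ ℝ) hl hk x
  rw [setConv_eq_convolution hS, pd, h.fderiv, convolution_precompR_apply _ hl (hc.fderiv ℝ)
    (hk.continuous_fderiv one_ne_zero), setConv_eq_convolution hS]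
  rfl

theorem lapl_setConv {S : Set (Eucl N)} (hS : MeasurableSet S) (hfin : volume S ≠ ⊤)
    {k : Eucl N → ℝ} (hk : ContDiff ℝ 2 k) (hc : HasCompactSupport k) (x : Eucl N) :
    lapl (setConv S k) x = setConv S (lapl k) x := by
  have hcp : ∀ i, HasCompactSupport (pd i k) := fun i =>
    (hc.fderiv_apply ℝ (EuclideanSpace.single i (1 : ℝ)))
  have hi : ∀ i, Integrable (fun y => pd i (pd i k) (x - y)) (volume.restrict S) := fun i => by
    have hcont : Continuous (pd i (pd i k)) := (hk.pd_one i).continuous_pd i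
    have : HasCompactSupport (pd i (pd i k)) :=
      (hcp i).fderiv_apply ℝ (EuclideanSpace.single i (1 : ℝ))
    exact ((hcont.integrable_of_hasCompactSupport this).comp_sub_left x).integrableOn
  rw [lapl_eq_sum_pd, setConv]
  simp only [lapl_eq_sum_pd]
  rw [integral_finsetSum _ fun i _ => hi i]
  refine Finset.sum_congr rfl fun i _ => ?_
  rw [pd_setConv hS hfin (hk.of_le (by norm_num)) hc, pd_setConv hS hfin (hk.pd_one i) (hcp i)]
  rfl

end SetConvolution

section Sweeping

variable {N : ℕ}

theorem exists_polynomial_ballWeight (m : ℕ) (R : ℝ) (ξ a : Eucl N) :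
    ∃ P : Polynomial ℝ, P.natDegree ≤ 2 * m ∧
      ∀ s : ℝ, P.eval s = (R ^ 2 - ‖ξ - s • a‖ ^ 2) ^ m := by
  refine ⟨(Polynomial.C (R ^ 2 - ‖ξ‖ ^ 2) + Polynomial.C (2 * inner ℝ ξ a) * Polynomial.X
    - Polynomial.C (‖a‖ ^ 2) * Polynomial.X ^ 2) ^ m, ?_, fun s => ?_⟩
  · refine Polynomial.natDegree_pow_le.trans ?_
    rw [mul_comm 2 m]
    refine Nat.mul_le_mul_left m ?_
    compute_degree
  · simp only [Polynomial.eval_pow, Polynomial.eval_sub, Polynomial.eval_add, Polynomial.eval_mul,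
      Polynomial.eval_C, Polynomial.eval_X]
    congr 1
    rw [norm_sub_sq_real, norm_smul, mul_pow, inner_smul_right, Real.norm_eq_abs, sq_abs]
    ring

theorem abs_ballWeight_sub_extrapolation_le {m : ℕ} {ι : Finset ℕ} {c s : ℕ → ℝ}
    (hs : ∀ j ∈ ι, s j ∈ Icc (0 : ℝ) 2)
    (hP : ∀ P : Polynomial ℝ, P.natDegree ≤ 2 * m → ∑ j ∈ ι, c j * P.eval (s j) = P.eval 0)
    {R d : ℝ} (hd : 0 ≤ d) (hR : 2 * d ≤ R) {a : Eucl N} (ha : ‖a‖ ≤ d) (ξ : Eucl N) :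
    |ballWeight m R ξ - ∑ j ∈ ι, c j * ballWeight m R (ξ - s j • a)|
      ≤ (1 + ∑ j ∈ ι, |c j|) * (4 * R * d) ^ m := by
  have hR0 : 0 ≤ R := by linarith
  by_cases hall : ∀ t ∈ Icc (0 : ℝ) 2, ‖ξ - t • a‖ ≤ R
  · obtain ⟨P, hdeg, hev⟩ := exists_polynomial_ballWeight m R ξ a
    have e : ∀ t ∈ Icc (0 : ℝ) 2, ballWeight m R (ξ - t • a) = P.eval t := fun t ht => by
      rw [hev]
      exact posPow_of_nonneg (by nlinarith [norm_nonneg (ξ - t • a), hall t ht]) m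
    have h0 := e 0 ⟨le_rfl, by norm_num⟩
    rw [zero_smul, sub_zero, ← hP P hdeg] at h0
    rw [h0, ← Finset.sum_sub_distrib, Finset.sum_eq_zero, abs_zero]
    · have : 0 ≤ ∑ j ∈ ι, |c j| := Finset.sum_nonneg fun _ _ => abs_nonneg _
      positivity
    · intro j hj
      rw [e _ (hs j hj), sub_self]
  · push Not at hall
    obtain ⟨t0, ht0, hfar⟩ := hall
    have hb : ∀ t ∈ Icc (0 : ℝ) 2, |ballWeight m R (ξ - t • a)| ≤ (4 * R * d) ^ m := by
      intro t ht
      have h1 : ‖(t - t0) • a‖ ≤ 2 * d := by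
        rw [norm_smul, Real.norm_eq_abs]
        have : |t - t0| ≤ 2 := abs_le.2 ⟨by linarith [ht.1, ht0.2], by linarith [ht.2, ht0.1]⟩
        nlinarith [abs_nonneg (t - t0), norm_nonneg a]
      have h2 : R - 2 * d ≤ ‖ξ - t • a‖ := by
        have h3 := norm_add_le (ξ - t • a) ((t - t0) • a)
        have h4 : ξ - t • a + (t - t0) • a = ξ - t0 • a := by rw [sub_smul]; abel
        rw [h4] at h3
        linarith
      rw [abs_of_nonneg (ballWeight_nonneg _ _ _), ballWeight, posPow]
      refine pow_le_pow_left₀ (le_max_right _ _) (max_le ?_ (by positivity)) m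
      nlinarith
    have h0 := hb 0 ⟨le_rfl, by norm_num⟩
    rw [zero_smul, sub_zero] at h0
    calc |ballWeight m R ξ - ∑ j ∈ ι, c j * ballWeight m R (ξ - s j • a)|
        ≤ |ballWeight m R ξ| + |∑ j ∈ ι, c j * ballWeight m R (ξ - s j • a)| := abs_sub _ _
      _ ≤ (4 * R * d) ^ m + ∑ j ∈ ι, |c j| * (4 * R * d) ^ m := by
          refine add_le_add h0 ((Finset.abs_sum_le_sum_abs _ _).trans
            (Finset.sum_le_sum fun j hj => ?_))
          rw [abs_mul]
          exact mul_le_mul_of_nonneg_left (hb _ (hs j hj)) (abs_nonneg _)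
      _ = (1 + ∑ j ∈ ι, |c j|) * (4 * R * d) ^ m := by rw [← Finset.sum_mul]; ring

theorem setConv_ballKernel_mem_Icc {S : Set (Eucl N)} {k : ℕ} (hk : k ≠ 0) {r : ℝ}
    (hr : 0 < r) (x : Eucl N) : setConv S (ballKernel k r) x ∈ Icc (0 : ℝ) 1 := by
  have hi : Integrable fun y : Eucl N => ballKernel k r (x - y) :=
    ((continuous_ballKernel k r).integrable_of_hasCompactSupport
      (HasCompactSupport.intro (isCompact_closedBall (0 : Eucl N) r) fun x hx =>
        ballKernel_eq_zero hk hr.le (by simpa using (not_le.1 (by simpa using hx)).le))).comp_sub_left x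
  refine ⟨integral_nonneg fun y => ballKernel_nonneg k hr.le _, ?_⟩
  refine (setIntegral_le_integral hi
    (Filter.Eventually.of_forall fun y => ballKernel_nonneg k hr.le _)).trans_eq ?_
  rw [integral_sub_left_eq_self (fun y => ballKernel k r y), integral_ballKernel hk hr]

theorem setConv_eq_one {S : Set (Eucl N)} {k : ℕ} (hk : k ≠ 0) {r : ℝ}
    (hr : 0 < r) {x : Eucl N} (hx : ball x r ⊆ S) : setConv S (ballKernel k r) x = 1 := by
  rw [setConv, setIntegral_eq_integral_of_forall_compl_eq_zero fun y hy =>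
    ballKernel_eq_zero hk hr.le ?_, integral_sub_left_eq_self (fun y => ballKernel k r y),
    integral_ballKernel hk hr]
  by_contra h
  exact hy (hx (by rw [mem_ball', dist_eq_norm]; exact not_le.1 h))

theorem setConv_eq_zero {S : Set (Eucl N)} (hS : MeasurableSet S) {k : Eucl N → ℝ} {r : ℝ}
    (hk : ∀ x, r ≤ ‖x‖ → k x = 0) {x : Eucl N} (hx : Disjoint (ball x r) S) :
    setConv S k x = 0 := by
  rw [setConv, setIntegral_congr_fun hS (g := fun _ => (0 : ℝ)) fun y hy => ?_, integral_zero]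
  refine hk _ ?_
  by_contra h
  exact Set.disjoint_left.1 hx (by rw [mem_ball', dist_eq_norm]; exact not_le.1 h) hy

theorem ballKernel_eq_mul (k : ℕ) (r : ℝ) (x : Eucl N) : ballKernel k r x
    = (r ^ (2 * k + N))⁻¹ / (∫ z : Eucl N, ballWeight k 1 z) * ballWeight k r x := by
  rw [ballKernel]; ring

theorem le_integral_ballWeight {k : ℕ} (hk : k ≠ 0) :
    (3 / 4 : ℝ) ^ k * volume.real (ball (0 : Eucl N) (1 / 2)) ≤ ∫ z : Eucl N, ballWeight k 1 z := by
  have hi : Integrable fun z : Eucl N => ballWeight k 1 z := by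
    simpa using integrable_mul_ballWeight (F := fun _ : Eucl N => (1 : ℝ)) continuous_const hk 1
  refine le_trans ?_ (setIntegral_le_integral (s := ball (0 : Eucl N) (1 / 2)) hi
    (Filter.Eventually.of_forall fun y => ballWeight_nonneg k 1 y))
  rw [mul_comm, ← smul_eq_mul, ← setIntegral_const]
  refine setIntegral_mono_on (integrableOn_const measure_ball_lt_top.ne) hi.integrableOn
    measurableSet_ball fun z hz => ?_
  rw [mem_ball, dist_zero_right] at hz
  exact pow_le_pow_left₀ (by norm_num) (le_max_of_le_left (by nlinarith [norm_nonneg z])) k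

theorem abs_setConv_sub_extrapolation_le {m : ℕ} (hm : m ≠ 0) {ι : Finset ℕ} {c s : ℕ → ℝ}
    (hs : ∀ j ∈ ι, s j ∈ Icc (0 : ℝ) 2)
    (hP : ∀ P : Polynomial ℝ, P.natDegree ≤ 2 * m → ∑ j ∈ ι, c j * P.eval (s j) = P.eval 0)
    {R d : ℝ} (hd : 0 < d) (hR : 2 * d ≤ R) {a : Eucl N} (ha : ‖a‖ ≤ d) {S : Set (Eucl N)}
    (hS : S ⊆ ball 0 d) (x : Eucl N) :
    |setConv S (ballKernel m R) x - ∑ j ∈ ι, c j * setConv S (ballKernel m R) (x - s j • a)|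
      ≤ (1 + ∑ j ∈ ι, |c j|) * (6 * (d / R)) ^ m * 2 ^ N := by
  have hR0 : 0 < R := by linarith
  set J := ∫ z : Eucl N, ballWeight m 1 z with hJ
  set W := volume.real (ball (0 : Eucl N) (1 / 2)) with hW
  have hW0 : 0 < W := ENNReal.toReal_pos (measure_ball_pos volume _ (by norm_num)).ne'
    measure_ball_lt_top.ne
  have hJW : (3 / 4 : ℝ) ^ m * W ≤ J := le_integral_ballWeight hm
  have hJ0 : 0 < J := lt_of_lt_of_le (by positivity) hJW
  have hsum0 : 0 ≤ ∑ j ∈ ι, |c j| := Finset.sum_nonneg fun _ _ => abs_nonneg _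
  have hfin : volume S < ⊤ := (measure_mono hS).trans_lt measure_ball_lt_top
  have hi : ∀ x : Eucl N, Integrable (fun y : Eucl N => ballKernel m R (x - y))
      (volume.restrict S) := fun x =>
    (((continuous_ballKernel m R).integrable_of_hasCompactSupport
      (HasCompactSupport.intro (isCompact_closedBall (0 : Eucl N) R) fun x hx =>
        ballKernel_eq_zero hm hR0.le
          (by simpa using (not_le.1 (by simpa using hx)).le))).comp_sub_left x).integrableOn
  have hvol : volume.real S ≤ R ^ N * (2 ^ N * W) := by
    have h1 : volume.real S ≤ volume.real (ball (0 : Eucl N) (2 * R * (1 / 2))) :=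
      measureReal_mono (hS.trans (ball_subset_ball (by linarith))) measure_ball_lt_top.ne
    have h2 : volume.real (ball (0 : Eucl N) (2 * R * (1 / 2))) = (2 * R) ^ N * W := by
      rw [hW, measureReal_def, measureReal_def,
        Measure.addHaar_ball_mul_of_pos volume 0 (show 0 < 2 * R by positivity),
        ENNReal.toReal_mul, finrank_euclideanSpace_fin, ENNReal.toReal_ofReal (by positivity)]
    rw [h2, mul_pow] at h1
    linarith
  have e : setConv S (ballKernel m R) x - ∑ j ∈ ι, c j * setConv S (ballKernel m R) (x - s j • a)
      = ∫ y in S, (ballKernel m R (x - y) - ∑ j ∈ ι, c j * ballKernel m R (x - y - s j • a)) := by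
    simp only [setConv, ← integral_const_mul]
    have hcomm : ∀ y j, x - s j • a - y = x - y - s j • a := fun y j => by abel
    rw [← integral_finsetSum ι fun j _ => (hi (x - s j • a)).const_mul (c j),
      ← integral_sub (hi x) (integrable_finsetSum ι fun j _ => (hi (x - s j • a)).const_mul (c j))]
    simp only [hcomm]
  have hpt : ∀ y ∈ S, ‖ballKernel m R (x - y)
      - ∑ j ∈ ι, c j * ballKernel m R (x - y - s j • a)‖
      ≤ (R ^ (2 * m + N))⁻¹ / J * ((1 + ∑ j ∈ ι, |c j|) * (4 * R * d) ^ m) := by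
    intro y _
    have h := abs_ballWeight_sub_extrapolation_le hs hP hd.le hR ha (x - y)
    have e2 : ballKernel m R (x - y) - ∑ j ∈ ι, c j * ballKernel m R (x - y - s j • a)
        = (R ^ (2 * m + N))⁻¹ / J * (ballWeight m R (x - y)
          - ∑ j ∈ ι, c j * ballWeight m R (x - y - s j • a)) := by
      simp only [ballKernel_eq_mul, ← hJ, mul_sub, Finset.mul_sum]
      congr 1
      exact Finset.sum_congr rfl fun j _ => by ring
    rw [e2, norm_mul, Real.norm_of_nonneg (by positivity), Real.norm_eq_abs]
    exact mul_le_mul_of_nonneg_left h (by positivity)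
  rw [e, ← Real.norm_eq_abs]
  refine (norm_setIntegral_le_of_norm_le_const hfin hpt).trans ?_
  calc (R ^ (2 * m + N))⁻¹ / J * ((1 + ∑ j ∈ ι, |c j|) * (4 * R * d) ^ m) * volume.real S
      ≤ (R ^ (2 * m + N))⁻¹ / ((3 / 4 : ℝ) ^ m * W) * ((1 + ∑ j ∈ ι, |c j|) * (4 * R * d) ^ m)
        * (R ^ N * (2 ^ N * W)) := by gcongr
    _ = (1 + ∑ j ∈ ι, |c j|) * (16 / 3 * (d / R)) ^ m * 2 ^ N := by
        have h1 : (16 / 3 * (d / R)) ^ m = (4 * R * d) ^ m / ((3 / 4 : ℝ) ^ m * R ^ (2 * m)) := by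
          rw [pow_mul, ← mul_pow, ← div_pow]
          congr 1
          field_simp
          norm_num
        rw [h1, pow_add]
        field_simp
    _ ≤ (1 + ∑ j ∈ ι, |c j|) * (6 * (d / R)) ^ m * 2 ^ N := by
        gcongr
        norm_num

/-- Sweeping: a source concentrated near the origin is approximated, away from a small ball
around `a`, by the Laplacian of a compactly supported function. -/
theorem exists_sweeping (N : ℕ) {B : ℝ} (hB : 1 ≤ B) : ∃ B1 : ℝ, 1 < B1 ∧
    ∀ (R d τ : ℝ) (a : Eucl N) (S : Set (Eucl N)) (m : ℕ), 0 < d → 8 * d ≤ R → ‖a‖ ≤ d →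
      MeasurableSet S → S ⊆ ball 0 (d / (4 * B)) → 0 < τ → τ ≤ d / (4 * B) → 3 ≤ m →
      ∃ η f : Eucl N → ℝ, ContDiff ℝ 2 η ∧ (∀ x, 2 * R ≤ ‖x‖ → η x = 0) ∧
        (∀ x, f x ∈ Icc (0 : ℝ) 1) ∧ (∀ x, ball x τ ⊆ S → f x = 1) ∧
        (∀ x, Disjoint (ball x τ) S → f x = 0) ∧
        (∀ x, |-lapl η x - f x| ≤ B1 ^ m) ∧
        ∀ x, x ∉ closedBall a (d / B) → |-lapl η x - f x| ≤ (B1 * d / R) ^ m := by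
  have hB0 : 0 < B := by linarith
  obtain ⟨C, hC1, hC⟩ := exists_extrapolation (β := 1 / (2 * B)) (by positivity)
    (by rw [div_le_one (by positivity)]; linarith)
  refine ⟨C + 12 * C * 2 ^ N, by nlinarith [one_le_pow₀ (M₀ := ℝ) (n := N) one_le_two],
    fun R d τ a S m hd hR ha hSm hS hτ hτd hm => ?_⟩
  have hR0 : 0 < R := by linarith
  have h2N : (1 : ℝ) ≤ 2 ^ N := one_le_pow₀ one_le_two
  have hdB : d / (4 * B) ≤ d / 4 := by gcongr; linarith
  have hSd : S ⊆ ball 0 d := hS.trans (ball_subset_ball (by linarith))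
  have hfin : volume S ≠ ⊤ := ((measure_mono hSd).trans_lt measure_ball_lt_top).ne
  obtain ⟨c, s, hs, hsum, hP⟩ := hC m (by omega)
  set ι := Finset.range (2 * m + 1) with hι
  have hβ : 1 / (2 * B) ≤ 1 := by rw [div_le_one (by positivity)]; linarith
  have hs' : ∀ j ∈ ι, s j ∈ Icc (0 : ℝ) 2 := fun j hj =>
    ⟨by linarith [(hs j hj).1], by linarith [(hs j hj).2]⟩
  have hm0 : m ≠ 0 := by omega
  obtain ⟨κ, hκ2, hκ0, hκl⟩ := exists_lapl_eq_ballKernel_sub (N := N) hm hτ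
    (show τ ≤ R by linarith)
  have hκc : HasCompactSupport κ := HasCompactSupport.intro (isCompact_closedBall (0 : Eucl N) R)
    fun x hx => hκ0 x (by simpa using (not_le.1 (by simpa using hx)).le)
  have hh2 : ContDiff ℝ 2 (setConv S κ) := contDiff_setConv hSm hfin (n := 2) hκ2 hκc
  have hc2 : ∀ j, ContDiff ℝ 2 fun x : Eucl N => setConv S κ (x - s j • a) := fun j =>
    hh2.comp (contDiff_id.sub contDiff_const)
  have hsum2 : ContDiff ℝ 2 fun x : Eucl N => ∑ j ∈ ι, c j * setConv S κ (x - s j • a) :=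
    ContDiff.sum fun j _ => contDiff_const.mul (hc2 j)
  have hκi : ∀ r, 0 < r → ∀ x : Eucl N, Integrable (fun y : Eucl N => ballKernel m r (x - y))
      (volume.restrict S) := fun r hr x =>
    (((continuous_ballKernel m r).integrable_of_hasCompactSupport
      (HasCompactSupport.intro (isCompact_closedBall (0 : Eucl N) r) fun x hx =>
        ballKernel_eq_zero hm0 hr.le
          (by simpa using (not_le.1 (by simpa using hx)).le))).comp_sub_left x).integrableOn
  have hlh : ∀ x, lapl (setConv S κ) x
      = setConv S (ballKernel m R) x - setConv S (ballKernel m τ) x := fun x => by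
    rw [lapl_setConv hSm hfin hκ2 hκc, setConv, setConv, setConv,
      ← integral_sub (hκi R hR0 x) (hκi τ hτ x)]
    simp only [hκl]
  have hlt : ∀ (y x : Eucl N), lapl (fun x => setConv S κ (x - y)) x
      = lapl (setConv S κ) (x - y) := fun y x => by
    have := lapl_comp_affine hh2 (-y) 1 x
    simp only [one_smul, one_pow, one_mul, neg_add_eq_sub] at this
    exact this
  have hlη : ∀ x, -lapl (fun x => setConv S κ x - ∑ j ∈ ι, c j * setConv S κ (x - s j • a)) x
      - setConv S (ballKernel m τ) x
      = -(∑ j ∈ ι, c j * setConv S (ballKernel m τ) (x - s j • a))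
        - (setConv S (ballKernel m R) x
          - ∑ j ∈ ι, c j * setConv S (ballKernel m R) (x - s j • a)) := by
    intro x
    rw [lapl_sub hh2 hsum2, lapl_sum ι fun j _ => contDiff_const.mul (hc2 j), hlh]
    have : ∀ j, lapl (fun x => c j * setConv S κ (x - s j • a)) x
        = c j * (setConv S (ballKernel m R) (x - s j • a)
          - setConv S (ballKernel m τ) (x - s j • a)) := fun j => by
      rw [lapl_const_mul _ (hc2 j), hlt, hlh]
    simp only [this, mul_sub, Finset.sum_sub_distrib]
    ring
  have hsa : ∀ j ∈ ι, ‖s j • a‖ ≤ 2 * d := fun j hj => by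
    rw [norm_smul, Real.norm_of_nonneg (hs' j hj).1]
    nlinarith [(hs' j hj).1, (hs' j hj).2, norm_nonneg a]
  have hmain : ∀ x, |setConv S (ballKernel m R) x
      - ∑ j ∈ ι, c j * setConv S (ballKernel m R) (x - s j • a)|
      ≤ (12 * C * 2 ^ N * d / R) ^ m := by
    intro x
    refine (abs_setConv_sub_extrapolation_le hm0 hs' hP hd (by linarith) ha hSd x).trans ?_
    have h1 : 1 + ∑ j ∈ ι, |c j| ≤ (2 * C) ^ m := by
      have h2 : (1 : ℝ) ≤ C ^ m := one_le_pow₀ hC1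
      have h3 : (2 : ℝ) ≤ 2 ^ m := by
        calc (2 : ℝ) = 2 ^ 1 := by norm_num
          _ ≤ 2 ^ m := pow_le_pow_right₀ one_le_two (by omega)
      rw [mul_pow]
      nlinarith
    have h4 : (2 : ℝ) ^ N ≤ (2 ^ N) ^ m := le_self_pow₀ h2N hm0
    calc (1 + ∑ j ∈ ι, |c j|) * (6 * (d / R)) ^ m * 2 ^ N
        ≤ (2 * C) ^ m * (6 * (d / R)) ^ m * (2 ^ N) ^ m := by gcongr
      _ = (12 * C * 2 ^ N * d / R) ^ m := by
        rw [← mul_pow, ← mul_pow]; congr 1; ring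
  refine ⟨fun x => setConv S κ x - ∑ j ∈ ι, c j * setConv S κ (x - s j • a),
    setConv S (ballKernel m τ), hh2.sub hsum2, fun x hx => ?_,
    setConv_ballKernel_mem_Icc hm0 hτ, fun x => setConv_eq_one hm0 hτ,
    fun x => setConv_eq_zero hSm fun y => ballKernel_eq_zero hm0 hτ.le, fun x => ?_,
    fun x hx => ?_⟩
  · have h0 : ∀ y : Eucl N, R + d ≤ ‖y‖ → setConv S κ y = 0 := by
      intro y hy
      refine setConv_eq_zero hSm hκ0 (Set.disjoint_left.2 fun z hz hzS => ?_)
      rw [mem_ball, dist_eq_norm] at hz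
      have := hSd hzS
      rw [mem_ball, dist_zero_right] at this
      linarith [norm_le_norm_add_norm_sub z y]
    simp only
    rw [h0 x (by linarith), Finset.sum_eq_zero, sub_zero]
    intro j hj
    rw [h0, mul_zero]
    linarith [norm_sub_norm_le x (s j • a), hsa j hj]
  · rw [hlη]
    have h1 : |∑ j ∈ ι, c j * setConv S (ballKernel m τ) (x - s j • a)| ≤ C ^ m := by
      refine (Finset.abs_sum_le_sum_abs _ _).trans (le_trans (Finset.sum_le_sum fun j _ => ?_) hsum)
      have := setConv_ballKernel_mem_Icc (S := S) hm0 hτ (x - s j • a)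
      rw [abs_mul, abs_of_nonneg this.1]
      exact mul_le_of_le_one_right (abs_nonneg _) this.2
    have h2 : (12 * C * 2 ^ N * d / R) ^ m ≤ (12 * C * 2 ^ N) ^ m := by
      refine pow_le_pow_left₀ (by positivity) ?_ m
      rw [mul_div_assoc]
      exact mul_le_of_le_one_right (by positivity) (by rw [div_le_one hR0]; linarith)
    refine (abs_sub _ _).trans ?_
    rw [abs_neg]
    exact (add_le_add h1 ((hmain x).trans h2)).trans
      (pow_add_pow_le (by positivity) (by positivity) hm0)
  · rw [hlη, Finset.sum_eq_zero, neg_zero, zero_sub, abs_neg]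
    · refine (hmain x).trans (pow_le_pow_left₀ (by positivity) ?_ m)
      gcongr
      linarith
    · intro j hj
      rw [setConv_eq_zero hSm (fun y => ballKernel_eq_zero hm0 hτ.le), mul_zero]
      refine Set.disjoint_left.2 fun z hz hzS => hx ?_
      have hz2 := hS hzS
      rw [mem_ball, dist_zero_right] at hz2
      rw [mem_ball, dist_eq_norm] at hz
      rw [mem_closedBall, dist_eq_norm]
      have h1 : ‖(s j - 1) • a‖ ≤ d / (2 * B) := by
        rw [norm_smul, Real.norm_of_nonneg (by linarith [(hs j hj).1])]
        have h2 : s j - 1 ≤ 1 / (2 * B) := by linarith [(hs j hj).2]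
        calc (s j - 1) * ‖a‖ ≤ 1 / (2 * B) * d := by
              refine mul_le_mul h2 ha (norm_nonneg _) (by positivity)
          _ = d / (2 * B) := by ring
      have e1 : x - a = z - (z - (x - s j • a)) + (s j - 1) • a := by
        rw [sub_smul, one_smul]; abel
      have h3 : d / B = d / (4 * B) + d / (4 * B) + d / (2 * B) := by field_simp; norm_num
      rw [e1, h3]
      refine (norm_add_le _ _).trans (add_le_add ((norm_sub_le _ _).trans ?_) h1)
      linarith

end Sweeping

section Green

variable {N : ℕ}

theorem contDiff_indicator {Ω : Set (Eucl N)} (hΩ : IsOpen Ω) {n : WithTop ℕ∞} {G : Eucl N → ℝ}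
    (hG : ContDiff ℝ n G) (h0 : ∀ x ∈ frontier Ω, G =ᶠ[nhds x] fun _ => 0) :
    ContDiff ℝ n (Ω.indicator G) := by
  refine contDiff_iff_contDiffAt.2 fun x => ?_
  by_cases hx : x ∈ Ω
  · refine hG.contDiffAt.congr_of_eventuallyEq ?_
    filter_upwards [hΩ.mem_nhds hx] with y hy using indicator_of_mem hy G
  · refine (contDiffAt_const (c := (0 : ℝ))).congr_of_eventuallyEq ?_
    by_cases hc : x ∈ closure Ω
    · filter_upwards [h0 x ⟨hc, by rwa [hΩ.interior_eq]⟩] with y hy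
      by_cases hyΩ : y ∈ Ω
      · rw [indicator_of_mem hyΩ, hy]
      · exact indicator_of_notMem hyΩ G
    · filter_upwards [isClosed_closure.isOpen_compl.mem_nhds hc] with y hy
      exact indicator_of_notMem (fun h => hy (subset_closure h)) G

theorem setIntegral_pd_eq_zero {Ω : Set (Eucl N)} (hΩ : IsOpen Ω) (hb : Bornology.IsBounded Ω)
    {G : Eucl N → ℝ} (hG : ContDiff ℝ 1 G)
    (h0 : ∀ x ∈ frontier Ω, G =ᶠ[nhds x] fun _ => 0) (i : Fin N) :
    ∫ x in Ω, pd i G x = 0 := by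
  have hc := contDiff_indicator hΩ hG h0
  have hcs : HasCompactSupport (Ω.indicator G) :=
    HasCompactSupport.intro hb.isCompact_closure fun x hx =>
      indicator_of_notMem (fun h => hx (subset_closure h)) G
  have h := integral_pd_eq_zero hc hcs i
  rw [← h, ← integral_indicator hΩ.measurableSet]
  refine integral_congr_ae (Filter.Eventually.of_forall fun x => ?_)
  by_cases hx : x ∈ Ω
  · simp only [indicator_of_mem hx]
    refine (pd_congr_of_eventuallyEq ?_ i).symm
    filter_upwards [hΩ.mem_nhds hx] with y hy using indicator_of_mem hy G
  · simp only [indicator_of_notMem hx]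
    rw [← pd_const (0 : ℝ) i x]
    refine (pd_congr_of_eventuallyEq ?_ i).symm
    by_cases hc : x ∈ closure Ω
    · filter_upwards [h0 x ⟨hc, by rwa [hΩ.interior_eq]⟩] with y hy
      by_cases hyΩ : y ∈ Ω
      · rw [indicator_of_mem hyΩ, hy]
      · exact indicator_of_notMem hyΩ G
    · filter_upwards [isClosed_closure.isOpen_compl.mem_nhds hc] with y hy
      exact indicator_of_notMem (fun h => hy (subset_closure h)) G

theorem Continuous.integrableOn_of_isBounded {Ω : Set (Eucl N)} (hb : Bornology.IsBounded Ω)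
    {f : Eucl N → ℝ} (hf : Continuous f) : IntegrableOn f Ω :=
  (hf.continuousOn.integrableOn_compact hb.isCompact_closure).mono_set subset_closure

theorem exists_abs_le_of_isBounded {Ω : Set (Eucl N)} (hb : Bornology.IsBounded Ω)
    {f : Eucl N → ℝ} (hf : Continuous f) : ∃ C, 0 ≤ C ∧ ∀ x ∈ closure Ω, |f x| ≤ C := by
  obtain ⟨C, hC⟩ := hb.isCompact_closure.exists_bound_of_continuousOn hf.continuousOn
  exact ⟨max C 0, le_max_right _ _, fun x hx => (hC x hx).trans (le_max_left _ _)⟩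

theorem exists_cutoff : ∃ θ θ' : ℝ → ℝ, ContDiff ℝ 2 θ ∧ (∀ s, HasDerivAt θ (θ' s) s) ∧
    (∀ s ≤ 1, θ s = 0) ∧ (∀ s, 2 ≤ s → θ s = 1) ∧ (∀ s, 0 ≤ θ s ∧ θ s ≤ 1) ∧
    Continuous θ' ∧ (∀ s < 1, θ' s = 0) ∧ (∀ s > 2, θ' s = 0) ∧ ∃ K, 0 ≤ K ∧ ∀ s, |θ' s| ≤ K := by
  set θ : ℝ → ℝ := fun s => Real.smoothTransition (s - 1) with hθ
  have hc : ContDiff ℝ 2 θ := Real.smoothTransition.contDiff.comp (contDiff_id.sub contDiff_const)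
  have h0 : ∀ s ≤ 1, θ s = 0 := fun s hs => Real.smoothTransition.zero_of_nonpos (by linarith)
  have h1 : ∀ s, 2 ≤ s → θ s = 1 := fun s hs => Real.smoothTransition.one_of_one_le (by linarith)
  have hd : Continuous (deriv θ) := hc.continuous_deriv (by norm_num)
  have hl : ∀ s < 1, deriv θ s = 0 := fun s hs => by
    have : θ =ᶠ[nhds s] fun _ => 0 := by
      filter_upwards [Iio_mem_nhds hs] with y hy using h0 y (le_of_lt hy)
    rw [this.deriv_eq, deriv_const]
  have hr : ∀ s > 2, deriv θ s = 0 := fun s hs => by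
    have : θ =ᶠ[nhds s] fun _ => 1 := by
      filter_upwards [Ioi_mem_nhds hs] with y hy using h1 y (le_of_lt hy)
    rw [this.deriv_eq, deriv_const]
  obtain ⟨K, hK⟩ := (isCompact_Icc (a := (1 : ℝ)) (b := 2)).exists_bound_of_continuousOn
    hd.continuousOn
  refine ⟨θ, deriv θ, hc, fun s => (hc.differentiable (by norm_num) s).hasDerivAt, h0, h1,
    fun s => ⟨Real.smoothTransition.nonneg _, Real.smoothTransition.le_one _⟩, hd, hl, hr,
    max K 0, le_max_right _ _, fun s => ?_⟩
  by_cases h : s ∈ Icc (1 : ℝ) 2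
  · exact (hK s h).trans (le_max_left _ _)
  · rw [mem_Icc, not_and_or, not_le, not_le] at h
    rcases h with h | h
    · rw [hl s h, abs_zero]; exact le_max_right _ _
    · rw [hr s h, abs_zero]; exact le_max_right _ _

theorem setIntegral_mul_lapl_comm {Ω : Set (Eucl N)} (hΩ : IsOpen Ω) (hb : Bornology.IsBounded Ω)
    {u w : Eucl N → ℝ} (hu : ContDiff ℝ 2 u) (hw : ContDiff ℝ 2 w)
    (hu0 : ∀ x ∈ frontier Ω, u x = 0) (hw0 : ∀ x ∈ frontier Ω, w x = 0) :
    ∫ x in Ω, u x * lapl w x = ∫ x in Ω, w x * lapl u x := by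
  obtain ⟨θ, θ', hθ, hθd, hθ0, hθ1, hθb, hθ'c, hθl, hθr, K, hK0, hK⟩ := exists_cutoff
  set D : Eucl N → ℝ := fun x => u x * lapl w x - w x * lapl u x with hD
  set Q : Eucl N → ℝ := fun x => ∑ i, (u x * pd i u x + w x * pd i w x)
    * (u x * pd i w x - w x * pd i u x) with hQ
  set s : Eucl N → ℝ := fun x => u x ^ 2 + w x ^ 2 with hs
  have hs2 : ContDiff ℝ 2 s := (hu.pow 2).add (hw.pow 2)
  have hpu := fun i => (hu.pd_one i).continuous
  have hpw := fun i => (hw.pd_one i).continuous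
  have hDc : Continuous D := (hu.continuous.mul hw.continuous_lapl).sub
    (hw.continuous.mul hu.continuous_lapl)
  have hQc : Continuous Q := continuous_finsetSum _ fun i _ =>
    ((hu.continuous.mul (hpu i)).add (hw.continuous.mul (hpw i))).mul
      ((hu.continuous.mul (hpw i)).sub (hw.continuous.mul (hpu i)))
  set Y : ℝ → Eucl N → ℝ := fun k x => θ (k * s x) * D x + 2 * k * θ' (k * s x) * Q x with hY
  have hzero : ∀ k, 0 < k → ∫ x in Ω, Y k x = 0 := by
    intro k hk
    have hG1 : ContDiff ℝ 2 fun x => θ (k * s x) := hθ.comp (contDiff_const.mul hs2)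
    have hX : ∀ i, ContDiff ℝ 1 fun x => u x * pd i w x - w x * pd i u x := fun i =>
      ((hu.of_le (by norm_num)).mul (hw.pd_one i)).sub ((hw.of_le (by norm_num)).mul (hu.pd_one i))
    have hG : ∀ i, ContDiff ℝ 1 fun x => θ (k * s x) * (u x * pd i w x - w x * pd i u x) := fun i =>
      (hG1.of_le (by norm_num)).mul (hX i)
    have hintegral := fun i => setIntegral_pd_eq_zero hΩ hb (hG i) (fun x hx => by
      have h1 : k * s x < 1 := by simp only [hs, hu0 x hx, hw0 x hx]; norm_num
      have hcont : Continuous fun y => k * s y := continuous_const.mul hs2.continuous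
      filter_upwards [hcont.continuousAt.eventually_lt continuousAt_const h1] with y hy
      rw [hθ0 _ hy.le, zero_mul]) i
    have hsum : ∀ x, Y k x = ∑ i, pd i
        (fun x => θ (k * s x) * (u x * pd i w x - w x * pd i u x)) x := by
      intro x
      have du := hu.differentiable (by norm_num) x
      have dw := hw.differentiable (by norm_num) x
      have ds : DifferentiableAt ℝ s x := hs2.differentiable (by norm_num) x
      have hps : ∀ i, pd i (fun x => θ (k * s x)) x
          = θ' (k * s x) * (k * (2 * (u x * pd i u x + w x * pd i w x))) := fun i => by
        rw [pd_comp (hθd _) (ds.const_mul k) i, pd_const_mul k ds i]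
        simp only [hs]
        rw [pd_add (du.fun_pow 2) (dw.fun_pow 2)]
        simp only [sq]
        rw [pd_mul du du, pd_mul dw dw]
        ring
      have : ∀ i, pd i (fun x => θ (k * s x) * (u x * pd i w x - w x * pd i u x)) x
          = 2 * k * θ' (k * s x) * ((u x * pd i u x + w x * pd i w x)
            * (u x * pd i w x - w x * pd i u x))
            + θ (k * s x) * (u x * pd i (pd i w) x - w x * pd i (pd i u) x) := fun i => by
        rw [pd_mul (hG1.differentiable (by norm_num) x) ((hX i).differentiable (by norm_num) x),
          hps, pd_sub (du.fun_mul (hw.differentiableAt_pd i x))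
            (dw.fun_mul (hu.differentiableAt_pd i x)), pd_mul du (hw.differentiableAt_pd i x),
          pd_mul dw (hu.differentiableAt_pd i x)]
        ring
      simp only [this, Finset.sum_add_distrib, ← Finset.mul_sum, hY, hQ, hD,
        Finset.sum_sub_distrib, lapl_eq_sum_pd]
      ring
    simp only [hsum]
    rw [integral_finsetSum _ fun i _ => ((hG i).continuous_pd i).integrableOn_of_isBounded hb]
    exact Finset.sum_eq_zero fun i _ => hintegral i
  obtain ⟨KD, hKD0, hKD⟩ := exists_abs_le_of_isBounded hb hDc
  choose Ku hKu0 hKu using fun i => exists_abs_le_of_isBounded hb (hpu i)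
  choose Kw hKw0 hKw using fun i => exists_abs_le_of_isBounded hb (hpw i)
  have hQb : ∀ x ∈ closure Ω, |Q x| ≤ (∑ i, 2 * (Ku i + Kw i) ^ 2) * s x := by
    intro x hx
    rw [Finset.sum_mul]
    refine (Finset.abs_sum_le_sum_abs _ _).trans (Finset.sum_le_sum fun i _ => ?_)
    have a1 := hKu i x hx
    have a2 := hKw i x hx
    have h1 : |u x * pd i u x + w x * pd i w x| ≤ (|u x| + |w x|) * (Ku i + Kw i) := by
      refine (abs_add_le _ _).trans ?_
      rw [abs_mul, abs_mul]
      nlinarith [abs_nonneg (u x), abs_nonneg (w x), hKu0 i, hKw0 i,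
        mul_le_mul_of_nonneg_left a1 (abs_nonneg (u x)),
        mul_le_mul_of_nonneg_left a2 (abs_nonneg (w x)),
        mul_nonneg (abs_nonneg (u x)) (hKw0 i), mul_nonneg (abs_nonneg (w x)) (hKu0 i)]
    have h2 : |u x * pd i w x - w x * pd i u x| ≤ (|u x| + |w x|) * (Ku i + Kw i) := by
      refine (abs_sub _ _).trans ?_
      rw [abs_mul, abs_mul]
      nlinarith [abs_nonneg (u x), abs_nonneg (w x), hKu0 i, hKw0 i,
        mul_le_mul_of_nonneg_left a2 (abs_nonneg (u x)),
        mul_le_mul_of_nonneg_left a1 (abs_nonneg (w x)),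
        mul_nonneg (abs_nonneg (u x)) (hKu0 i), mul_nonneg (abs_nonneg (w x)) (hKw0 i)]
    rw [abs_mul]
    have hk : 0 ≤ Ku i + Kw i := add_nonneg (hKu0 i) (hKw0 i)
    have hsq : (|u x| + |w x|) ^ 2 ≤ 2 * s x := by
      simp only [hs]
      nlinarith [sq_nonneg (|u x| - |w x|), sq_abs (u x), sq_abs (w x)]
    calc _ ≤ ((|u x| + |w x|) * (Ku i + Kw i)) * ((|u x| + |w x|) * (Ku i + Kw i)) :=
          mul_le_mul h1 h2 (abs_nonneg _) (by positivity)
      _ = (Ku i + Kw i) ^ 2 * (|u x| + |w x|) ^ 2 := by ring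
      _ ≤ (Ku i + Kw i) ^ 2 * (2 * s x) := by gcongr
      _ = _ := by ring
  set KQ := ∑ i, 2 * (Ku i + Kw i) ^ 2 with hKQ
  have hKQ0 : 0 ≤ KQ := Finset.sum_nonneg fun i _ => by positivity
  have hs0 : ∀ x, 0 ≤ s x := fun x => by positivity
  have hlim : Filter.Tendsto (fun k : ℝ => ∫ x in Ω, Y k x) Filter.atTop
      (nhds (∫ x in Ω, D x)) := by
    have : IsFiniteMeasure (volume.restrict Ω) := ⟨by
      rw [Measure.restrict_apply_univ]; exact hb.measure_lt_top⟩
    refine tendsto_integral_filter_of_dominated_convergence (fun _ => KD + 4 * K * KQ) ?_ ?_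
      (integrable_const _) ?_
    · refine Filter.Eventually.of_forall fun k => Continuous.aestronglyMeasurable ?_
      have : Continuous fun x => k * s x := continuous_const.mul hs2.continuous
      exact ((hθ.continuous.comp this).mul hDc).add
        ((continuous_const.mul (hθ'c.comp this)).mul hQc)
    · filter_upwards [Filter.eventually_gt_atTop 0] with k hk
      refine (ae_restrict_iff' hΩ.measurableSet).2 (Filter.Eventually.of_forall fun x hx => ?_)
      have hx' := subset_closure hx
      rw [Real.norm_eq_abs]
      refine (abs_add_le _ _).trans (add_le_add ?_ ?_)
      · rw [abs_mul, abs_of_nonneg (hθb _).1]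
        exact (mul_le_of_le_one_left (abs_nonneg _) (hθb _).2).trans (hKD x hx')
      · by_cases h2 : 2 < k * s x
        · rw [hθr _ h2, mul_zero, zero_mul, abs_zero]; positivity
        · rw [abs_mul, abs_mul, abs_of_pos (by positivity : 0 < 2 * k)]
          calc 2 * k * |θ' (k * s x)| * |Q x| ≤ 2 * k * K * (KQ * s x) := by
                gcongr
                · exact hK _
                · exact hQb x hx'
            _ = 2 * K * KQ * (k * s x) := by ring
            _ ≤ 2 * K * KQ * 2 := by gcongr; exact not_lt.1 h2
            _ = 4 * K * KQ := by ring
    · refine (ae_restrict_iff' hΩ.measurableSet).2 (Filter.Eventually.of_forall fun x hx => ?_)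
      by_cases h0 : s x = 0
      · have hux : u x = 0 := by
          have := hs0 x; simp only [hs] at h0; nlinarith [sq_nonneg (u x), sq_nonneg (w x)]
        have hwx : w x = 0 := by
          have := hs0 x; simp only [hs] at h0; nlinarith [sq_nonneg (u x), sq_nonneg (w x)]
        have e : ∀ k, Y k x = D x := fun k => by simp [hY, hD, hQ, hux, hwx]
        simp only [e]
        exact tendsto_const_nhds
      · have hpos : 0 < s x := lt_of_le_of_ne (hs0 x) (Ne.symm h0)
        refine tendsto_const_nhds.congr' ?_
        filter_upwards [Filter.eventually_gt_atTop (2 / s x)] with k hk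
        have h2 : 2 < k * s x := by rwa [div_lt_iff₀ hpos] at hk
        simp only [hY, hθ1 _ h2.le, hθr _ h2]
        ring
  have h0 : ∫ x in Ω, D x = 0 := by
    refine tendsto_nhds_unique hlim (tendsto_const_nhds.congr' ?_)
    filter_upwards [Filter.eventually_gt_atTop 0] with k hk using (hzero k hk).symm
  have i1 : IntegrableOn (fun x => u x * lapl w x) Ω :=
    (hu.continuous.mul hw.continuous_lapl).integrableOn_of_isBounded hb
  have i2 : IntegrableOn (fun x => w x * lapl u x) Ω :=
    (hw.continuous.mul hu.continuous_lapl).integrableOn_of_isBounded hb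
  rw [← sub_eq_zero, ← integral_sub i1 i2]
  exact h0

theorem exists_sup_bound (hN : N ≠ 0) {Ω : Set (Eucl N)} (hΩ : IsOpen Ω)
    (hb : Bornology.IsBounded Ω) : ∃ C, 0 ≤ C ∧ ∀ ξ : Eucl N → ℝ, ContDiff ℝ 2 ξ →
      (∀ x ∈ frontier Ω, ξ x = 0) → ∀ b, 0 ≤ b → (∀ x ∈ Ω, |lapl ξ x| ≤ b) →
      ∀ x ∈ closure Ω, |ξ x| ≤ C * b := by
  obtain ⟨R, hR0, hR⟩ := exists_abs_le_of_isBounded hb (continuous_norm (E := Eucl N))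
  have hN' : (0 : ℝ) < N := by exact_mod_cast Nat.pos_of_ne_zero hN
  refine ⟨R ^ 2, sq_nonneg R, fun ξ hξ h0 b hb0 hl x hx => ?_⟩
  have hn : ContDiff ℝ 2 fun x : Eucl N => ‖x‖ ^ 2 := contDiff_norm_sq ℝ
  have hE : ∀ x ∈ closure Ω, 0 ≤ R ^ 2 - ‖x‖ ^ 2 := fun x hx => by
    have := hR x hx
    rw [abs_norm] at this
    nlinarith [norm_nonneg x]
  have key : ∀ ζ : Eucl N → ℝ, ContDiff ℝ 2 ζ → (∀ x ∈ frontier Ω, ζ x = 0) →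
      (∀ x ∈ Ω, lapl ζ x ≤ b) → 0 ≤ b * (R ^ 2 - ‖x‖ ^ 2) + ζ x := by
    intro ζ hζ hζ0 hζl
    have hc : ContDiff ℝ 2 fun x : Eucl N => R ^ 2 - ‖x‖ ^ 2 := contDiff_const.sub hn
    refine nonneg_of_superharmonic (F := fun x => b * (R ^ 2 - ‖x‖ ^ 2) + ζ x) hN hΩ hb
      ((contDiff_const.mul hc).add hζ) (fun y hy => ?_) (fun y hy => ?_) x hx
    · rw [lapl_add (contDiff_const.mul hc) hζ, lapl_const_mul b hc, lapl_sub contDiff_const hn,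
        lapl_const, lapl_norm_sq]
      have h1 : (1 : ℝ) ≤ N := by exact_mod_cast Nat.one_le_iff_ne_zero.2 hN
      nlinarith [hζl y hy, mul_le_mul_of_nonneg_left h1 hb0]
    · rw [hζ0 y hy, add_zero]
      exact mul_nonneg hb0 (hE y (frontier_subset_closure hy))
  have h1 := key ξ hξ h0 fun x hx => (le_abs_self _).trans (hl x hx)
  have h2 := key (fun x => -ξ x) hξ.neg (fun x hx => by rw [h0 x hx, neg_zero]) fun x hx => by
    rw [lapl_neg hξ]; exact (neg_le_abs _).trans (hl x hx)
  have h3 : b * (R ^ 2 - ‖x‖ ^ 2) ≤ R ^ 2 * b := by nlinarith [mul_nonneg hb0 (sq_nonneg ‖x‖)]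
  exact abs_le.2 ⟨by linarith, by linarith⟩

end Green

section Eigen

variable {N : ℕ}

theorem setIntegral_pos_of_continuous {Ω : Set (Eucl N)} (hΩ : IsOpen Ω)
    (hb : Bornology.IsBounded Ω) {f : Eucl N → ℝ} (hf : Continuous f) (h0 : ∀ x ∈ Ω, 0 ≤ f x)
    {x₀ : Eucl N} (hx₀ : x₀ ∈ Ω) (hp : 0 < f x₀) : 0 < ∫ x in Ω, f x := by
  rw [setIntegral_pos_iff_support_of_nonneg_ae
    ((ae_restrict_iff' hΩ.measurableSet).2 (Filter.Eventually.of_forall h0))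
    (hf.integrableOn_of_isBounded hb)]
  exact (((isOpen_ne_fun hf continuous_const).inter hΩ).measure_pos volume ⟨x₀, hp.ne', hx₀⟩)

theorem eq_zero_of_setIntegral_eq_zero {Ω : Set (Eucl N)} (hΩ : IsOpen Ω)
    (hb : Bornology.IsBounded Ω) {f : Eucl N → ℝ} (hf : Continuous f) (h0 : ∀ x ∈ Ω, 0 ≤ f x)
    (hi : ∫ x in Ω, f x = 0) {x : Eucl N} (hx : x ∈ Ω) : f x = 0 := by
  by_contra h
  exact (setIntegral_pos_of_continuous hΩ hb hf h0 hx (lt_of_le_of_ne (h0 x hx) (Ne.symm h))).ne' hi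

theorem eq_zero_of_lapl_eq_zero (hN : N ≠ 0) {Ω : Set (Eucl N)} (hΩ : IsOpen Ω)
    (hb : Bornology.IsBounded Ω) {φ : Eucl N → ℝ} (hφ : ContDiff ℝ 2 φ)
    (hφ0 : ∀ x ∈ frontier Ω, φ x = 0) (hl : ∀ x ∈ Ω, lapl φ x = 0) :
    ∀ x ∈ closure Ω, φ x = 0 := by
  obtain ⟨C, _, hC⟩ := exists_sup_bound hN hΩ hb
  intro x hx
  have := hC φ hφ hφ0 0 le_rfl (fun x hx => by rw [hl x hx, abs_zero]) x hx
  rw [mul_zero] at this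
  exact abs_nonpos_iff.1 this

theorem eq_zero_of_eigen_nonpos (hN : N ≠ 0) {Ω : Set (Eucl N)} (hΩ : IsOpen Ω)
    (hb : Bornology.IsBounded Ω) {V φ : Eucl N → ℝ} (hV : Continuous V) (hV0 : ∀ x, 0 ≤ V x)
    (hφ : ContDiff ℝ 2 φ) (hφ0 : ∀ x ∈ frontier Ω, φ x = 0) {μ c : ℝ} (hμ : μ ≤ 0)
    (heq : ∀ x ∈ Ω, -lapl φ x = μ * (V x * (φ x - c)))
    (hintegral : ∫ x in Ω, V x * (φ x - c) = 0) : ∀ x ∈ closure Ω, φ x = 0 := by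
  wlog hc : 0 ≤ c generalizing φ c
  · have h := this (φ := fun x => -φ x) (c := -c) hφ.neg
      (fun x hx => by rw [hφ0 x hx, neg_zero])
      (fun x hx => by rw [lapl_neg hφ, heq x hx]; ring) (by
        rw [← neg_eq_zero, ← hintegral, ← integral_neg]
        congr 1; funext x; ring) (by linarith)
    exact fun x hx => neg_eq_zero.1 (h x hx)
  have hle : ∀ x ∈ Ω, φ x ≤ c := by
    intro x hx
    by_contra! hlt
    have hU : IsOpen (Ω ∩ {x | c < φ x}) := hΩ.inter (isOpen_lt continuous_const hφ.continuous)
    have h := nonneg_of_superharmonic (F := fun x => c - φ x) hN hU (hb.subset inter_subset_left)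
      (contDiff_const.sub hφ) (fun y hy => by
        rw [lapl_sub contDiff_const hφ, lapl_const, zero_sub, heq y hy.1]
        exact mul_nonpos_of_nonpos_of_nonneg hμ
          (mul_nonneg (hV0 y) (sub_nonneg.2 (le_of_lt hy.2)))) (fun y hy => by
        have hyc : y ∈ closure Ω := closure_mono inter_subset_left (frontier_subset_closure hy)
        by_cases hyΩ : y ∈ Ω
        · rw [frontier, hU.interior_eq] at hy
          exact sub_nonneg.2 (not_lt.1 fun h => hy.2 ⟨hyΩ, h⟩)
        · rw [hφ0 y ⟨hyc, by rwa [hΩ.interior_eq]⟩, sub_zero]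
          exact hc) x (subset_closure ⟨hx, hlt⟩)
    linarith
  have hz : ∀ x ∈ Ω, V x * (c - φ x) = 0 := fun x hx =>
    eq_zero_of_setIntegral_eq_zero hΩ hb (f := fun x => V x * (c - φ x))
      (hV.mul (continuous_const.sub hφ.continuous))
      (fun x hx => mul_nonneg (hV0 x) (sub_nonneg.2 (hle x hx))) (by
        rw [← neg_eq_zero, ← hintegral, ← integral_neg]
        congr 1; funext x; ring) hx
  refine eq_zero_of_lapl_eq_zero hN hΩ hb hφ hφ0 fun x hx => ?_
  have h1 := heq x hx
  have h2 := hz x hx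
  have h3 : V x * (φ x - c) = 0 := by linarith [mul_sub (V x) c (φ x), mul_sub (V x) (φ x) c]
  rw [h3, mul_zero] at h1
  linarith

end Eigen

section Remainder

variable {p : ℝ}

/-- The second order remainder of `ρ ↦ p/(p+1) ρ^(1+1/p)` at `u^p`. -/
def convexRem (p ρ u : ℝ) : ℝ :=
  p / (p + 1) * ρ ^ (1 + 1 / p) - p / (p + 1) * (u ^ p) ^ (1 + 1 / p) - u * (ρ - u ^ p)

theorem young_rpow (hp : 0 < p) {x y : ℝ} (hx : 0 ≤ x) (hy : 0 ≤ y) :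
    y * x ^ p ≤ p / (p + 1) * x ^ (p + 1) + 1 / (p + 1) * y ^ (p + 1) := by
  have h := Real.geom_mean_le_arith_mean2_weighted (w₁ := p / (p + 1)) (w₂ := 1 / (p + 1))
    (p₁ := x ^ (p + 1)) (p₂ := y ^ (p + 1)) (by positivity) (by positivity) (by positivity)
    (by positivity) (by field_simp)
  rwa [← Real.rpow_mul hx, ← Real.rpow_mul hy, mul_div_cancel₀ _ (by positivity),
    mul_div_cancel₀ _ (by positivity), Real.rpow_one, mul_comm] at h

theorem rpow_rpow_succ (hp : 0 < p) {y : ℝ} (hy : 0 ≤ y) : (y ^ p) ^ (1 + 1 / p) = y ^ (p + 1) := by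
  rw [← Real.rpow_mul hy]
  congr 1
  field_simp

theorem exists_rpow_eq (hp : 0 < p) {ρ : ℝ} (hρ : 0 ≤ ρ) : ∃ y, 0 ≤ y ∧ y ^ p = ρ :=
  ⟨ρ ^ (1 / p), by positivity, by rw [← Real.rpow_mul hρ, one_div_mul_cancel hp.ne', Real.rpow_one]⟩

theorem rpow_succ_eq (hp : 0 < p) {y : ℝ} (hy : 0 ≤ y) : y ^ (p + 1) = y * y ^ p := by
  rw [Real.rpow_add_one' hy (by positivity), mul_comm]

theorem convexRem_eq (hp : 0 < p) {y u : ℝ} (hy : 0 ≤ y) (hu : 0 ≤ u) :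
    convexRem p (y ^ p) u
      = p / (p + 1) * y ^ (p + 1) + 1 / (p + 1) * u ^ (p + 1) - u * y ^ p := by
  rw [convexRem, rpow_rpow_succ hp hy, rpow_rpow_succ hp hu, rpow_succ_eq hp hu]
  field_simp
  ring

theorem convexRem_nonneg (hp : 0 < p) {ρ u : ℝ} (hρ : 0 ≤ ρ) (hu : 0 ≤ u) :
    0 ≤ convexRem p ρ u := by
  obtain ⟨y, hy, rfl⟩ := exists_rpow_eq hp hρ
  rw [convexRem_eq hp hy hu]
  linarith [young_rpow hp hy hu]

theorem convexRem_le (hp : 0 < p) {ρ u : ℝ} (hρ : 0 ≤ ρ) (hu : 0 ≤ u) :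
    convexRem p ρ u ≤ ρ ^ (1 + 1 / p) + u ^ (p + 1) := by
  obtain ⟨y, hy, rfl⟩ := exists_rpow_eq hp hρ
  rw [convexRem_eq hp hy hu, rpow_rpow_succ hp hy]
  have h1 : p / (p + 1) ≤ 1 := by rw [div_le_one (by positivity)]; linarith
  have h2 : 1 / (p + 1) ≤ 1 := by rw [div_le_one (by positivity)]; linarith
  linarith [mul_le_of_le_one_left (Real.rpow_nonneg hy (p + 1)) h1,
    mul_le_of_le_one_left (Real.rpow_nonneg hu (p + 1)) h2, mul_nonneg hu (Real.rpow_nonneg hy p)]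

theorem convexRem_mul_le (hp : 1 < p) {ρ u : ℝ} (hρ : 0 ≤ ρ) (hu : 0 ≤ u) :
    convexRem p ρ u * u ^ (p - 1) ≤ (ρ - u ^ p) ^ 2 := by
  have hp0 : 0 < p := by linarith
  obtain ⟨y, hy, rfl⟩ := exists_rpow_eq hp0 hρ
  have e1 : ∀ z : ℝ, 0 ≤ z → z ^ p = z * z ^ (p - 1) := fun z hz => by
    rw [← rpow_succ_eq (by linarith) hz, sub_add_cancel]
  have h1 : convexRem p (y ^ p) u ≤ (y - u) * (y ^ p - u ^ p) := by
    rw [convexRem_eq hp0 hy hu]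
    have h := young_rpow hp0 hu hy
    have e3 := rpow_succ_eq hp0 hu
    have e4 := rpow_succ_eq hp0 hy
    have e5 : p / (p + 1) = 1 - 1 / (p + 1) := by field_simp; ring
    rw [e5] at h ⊢
    linarith
  refine (mul_le_mul_of_nonneg_right h1 (by positivity)).trans ?_
  have e2 : (y - u) * (y ^ p - u ^ p) * u ^ (p - 1)
      = (y * u ^ (p - 1) - u ^ p) * (y ^ p - u ^ p) := by rw [e1 u hu]; ring
  rw [e2, sq]
  rcases le_total u y with h | h
  · have h3 : u ^ (p - 1) ≤ y ^ (p - 1) := Real.rpow_le_rpow hu h (by linarith)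
    refine mul_le_mul_of_nonneg_right ?_ (sub_nonneg.2 (Real.rpow_le_rpow hu h hp0.le))
    rw [e1 y hy]
    linarith [mul_le_mul_of_nonneg_left h3 hy]
  · have h3 : y ^ (p - 1) ≤ u ^ (p - 1) := Real.rpow_le_rpow hy h (by linarith)
    refine mul_le_mul_of_nonpos_right ?_ (sub_nonpos.2 (Real.rpow_le_rpow hy h hp0.le))
    rw [e1 y hy]
    linarith [mul_le_mul_of_nonneg_left h3 hy]

theorem isLittleO_taylor_two {f g : ℝ → ℝ} {a g' : ℝ}
    (hf : ∀ᶠ s in nhds a, HasDerivAt f (g s) s) (hg : HasDerivAt g g' a) :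
    (fun s => f s - f a - g a * (s - a) - g' / 2 * (s - a) ^ 2) =o[nhds a]
      fun s => (s - a) ^ 2 := by
  refine Asymptotics.isLittleO_iff.2 fun ε hε => ?_
  have h1 := (hasDerivAt_iff_isLittleO.1 hg).def hε
  obtain ⟨r, hr, hball⟩ := Metric.eventually_nhds_iff_ball.1 (hf.and h1)
  filter_upwards [ball_mem_nhds a hr] with s hs
  set F : ℝ → ℝ := fun s => f s - f a - g a * (s - a) - g' / 2 * (s - a) ^ 2 with hF
  have hsub : closedBall a |s - a| ⊆ ball a r := fun z hz =>
    lt_of_le_of_lt (mem_closedBall.1 hz) (by rwa [← Real.dist_eq])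
  have hd : ∀ z ∈ closedBall a |s - a|,
      HasDerivWithinAt F (g z - g a - (z - a) * g') (closedBall a |s - a|) z := by
    intro z hz
    have hs1 : HasDerivAt (fun z : ℝ => z - a) 1 z := (hasDerivAt_id z).sub_const a
    have := (((hball z (hsub hz)).1.sub_const (f a)).fun_sub (hs1.const_mul (g a))).fun_sub
      ((hs1.fun_pow 2).const_mul (g' / 2))
    exact (this.congr_deriv (by norm_num; ring)).hasDerivWithinAt
  have hbd : ∀ z ∈ closedBall a |s - a|, ‖g z - g a - (z - a) * g'‖ ≤ ε * |s - a| := by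
    intro z hz
    refine ((hball z (hsub hz)).2).trans ?_
    rw [Real.norm_eq_abs]
    exact mul_le_mul_of_nonneg_left (by simpa [Real.dist_eq] using hz) hε.le
  have := Convex.norm_image_sub_le_of_norm_hasDerivWithin_le hd hbd (convex_closedBall a _)
    (mem_closedBall_self (abs_nonneg _)) (show s ∈ closedBall a |s - a| by simp [Real.dist_eq])
  have e : F a = 0 := by simp [hF]
  rw [e, sub_zero] at this
  refine this.trans_eq ?_
  rw [Real.norm_eq_abs, Real.norm_eq_abs, mul_assoc, abs_pow, sq]

theorem tendsto_convexRem (hp : 1 < p) {u q : ℝ} (hu : 0 < u) {δ : ℝ → ℝ} {l : Filter ℝ}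
    (hl : Filter.Tendsto (fun t : ℝ => t) l (nhdsWithin 0 (Ioi 0)))
    (hδ : Filter.Tendsto (fun t => δ t / t) l (nhds (u ^ (p - 1) * q))) :
    Filter.Tendsto (fun t => convexRem p (u ^ p + δ t) u / t ^ 2) l
      (nhds (1 / (2 * p) * (u ^ (p - 1) * q ^ 2))) := by
  have hp0 : 0 < p := by linarith
  have hup : 0 < u ^ p := Real.rpow_pos_of_pos hu p
  have ht0 : ∀ᶠ t in l, 0 < t := hl.eventually self_mem_nhdsWithin
  have htt : Filter.Tendsto (fun t : ℝ => t) l (nhds 0) := hl.mono_right nhdsWithin_le_nhds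
  have hδ0 : Filter.Tendsto (fun t => u ^ p + δ t) l (nhds (u ^ p)) := by
    have : Filter.Tendsto (fun t => u ^ p + δ t / t * t) l (nhds (u ^ p + u ^ (p - 1) * q * 0)) :=
      tendsto_const_nhds.add (hδ.mul htt)
    rw [mul_zero, add_zero] at this
    refine this.congr' ?_
    filter_upwards [ht0] with t ht
    rw [div_mul_cancel₀ _ ht.ne']
  have hT := isLittleO_taylor_two (f := fun s => p / (p + 1) * s ^ (1 + 1 / p))
    (g := fun s => s ^ (1 / p)) (a := u ^ p) (g' := 1 / p * u ^ (1 - p)) (by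
      filter_upwards [lt_mem_nhds hup] with s hs
      refine ((Real.hasDerivAt_rpow_const (p := 1 + 1 / p) (Or.inl hs.ne')).const_mul
        (p / (p + 1))).congr_deriv ?_
      rw [add_sub_cancel_left]
      field_simp) (by
      refine (Real.hasDerivAt_rpow_const (p := 1 / p) (Or.inl hup.ne')).congr_deriv ?_
      rw [← Real.rpow_mul hu.le]
      congr 2
      field_simp)
  have hg : (u ^ p) ^ (1 / p) = u := by
    rw [← Real.rpow_mul hu.le, mul_one_div_cancel hp0.ne', Real.rpow_one]
  have hδ2 : Filter.Tendsto (fun t => δ t ^ 2 / t ^ 2) l (nhds ((u ^ (p - 1) * q) ^ 2)) := by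
    simpa only [div_pow] using hδ.pow 2
  have hsmall : Filter.Tendsto (fun t => (convexRem p (u ^ p + δ t) u
      - 1 / p * u ^ (1 - p) / 2 * δ t ^ 2) / t ^ 2) l (nhds 0) := by
    have h1 := hT.comp_tendsto hδ0
    have h2 : (fun t => δ t ^ 2) =O[l] fun t => t ^ 2 := by
      have : (fun t => δ t ^ 2 / t ^ 2) =O[l] fun _ => (1 : ℝ) := hδ2.isBigO_one ℝ
      have h3 := this.mul (Asymptotics.isBigO_refl (fun t : ℝ => t ^ 2) l)
      refine (h3.congr' ?_ ?_)
      · filter_upwards [ht0] with t ht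
        rw [div_mul_cancel₀ _ (by positivity)]
      · exact Filter.Eventually.of_forall fun t => one_mul _
    have h4 := (h1.trans_isBigO (h2.congr_left fun t => by simp)).tendsto_div_nhds_zero
    refine h4.congr fun t => ?_
    simp only [Function.comp, convexRem, hg, add_sub_cancel_left]
  have := hsmall.add (hδ2.const_mul (1 / p * u ^ (1 - p) / 2))
  have e : 0 + 1 / p * u ^ (1 - p) / 2 * (u ^ (p - 1) * q) ^ 2
      = 1 / (2 * p) * (u ^ (p - 1) * q ^ 2) := by
    have : u ^ (1 - p) * u ^ (p - 1) = 1 := by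
      rw [← Real.rpow_add hu]; simp
    calc _ = 1 / (2 * p) * ((u ^ (1 - p) * u ^ (p - 1)) * u ^ (p - 1) * q ^ 2) := by
          field_simp; ring
      _ = _ := by rw [this, one_mul]
  rw [e] at this
  refine this.congr fun t => ?_
  ring

end Remainder

section Variation

variable {N : ℕ}

/-- The first variation `t * h` of the density admits, for small `t`, an admissible
second order correction. -/
def HasCorrection (Ω : Set (Eucl N)) (p M : ℝ) (v : Eucl N → ℝ) : Prop :=
  ∃ C γ c t₀ : ℝ, 0 ≤ C ∧ 0 < γ ∧ 0 < c ∧ 0 < t₀ ∧ ∀ t, 0 < t → t < t₀ →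
    ∃ ξ : Eucl N → ℝ, ContDiff ℝ 2 ξ ∧ (∀ x ∈ frontier Ω, ξ x = 0) ∧ ∀ x ∈ Ω,
      t * M * max (v x) 0 ^ (p - 1) + lapl ξ x ≤ max (v x) 0 ^ p / 2 ∧
      |lapl ξ x| ≤ C * t ^ (1 + γ) ∧ (v x < c → |lapl ξ x| ≤ C * t ^ p) ∧
      max (-v x) 0 * |lapl ξ x| ≤ C * t ^ (2 + γ)

theorem continuous_max_rpow {v : Eucl N → ℝ} (hv : Continuous v) {k : ℝ} (hk : 0 ≤ k) :
    Continuous fun x => max (v x) 0 ^ k :=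
  (hv.max continuous_const).rpow_const fun _ => Or.inr hk

/-- Uniform bound of the second order remainder. -/
theorem convexRem_le_sq {p : ℝ} (hp : 1 < p) {C c M K : ℝ} (hC : 0 ≤ C) (hc : 0 < c)
    (hK : 0 ≤ K) : ∃ A, 0 ≤ A ∧ ∀ t v q ν k ρ : ℝ, 0 < t → t < 1 → t < c → |q| ≤ M → v ≤ K →
      |ν| ≤ C * t → (v < c → |ν| ≤ C * t ^ p) → |k| ≤ C * t → |k| ≤ 1 → 0 ≤ ρ →
      ρ = max v 0 ^ p + (t * (max v 0 ^ (p - 1) * q) + ν - k * max v 0 ^ p) →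
      convexRem p ρ (max v 0) ≤ A * t ^ 2 := by
  have hp0 : 0 < p := by linarith
  refine ⟨3 * (K ^ (p - 1) * M ^ 2 + (C ^ 2 + C ^ 2 / c ^ (p - 1)) + C ^ 2 * K ^ (p + 1))
    + ((2 + |M| + C) ^ (1 + 1 / p) + 1), by positivity,
    fun t v q ν k ρ ht ht1 htc hq hv hν hνc hk hk1 hρ hρe => ?_⟩
  have hu : 0 ≤ max v 0 := le_max_right _ _
  have huK : max v 0 ≤ K := max_le hv hK
  have hM : 0 ≤ M := (abs_nonneg q).trans hq
  have hA1 : 0 ≤ 3 * (K ^ (p - 1) * M ^ 2 + (C ^ 2 + C ^ 2 / c ^ (p - 1)) + C ^ 2 * K ^ (p + 1)) :=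
    by positivity
  have hA2 : 0 ≤ (2 + |M| + C) ^ (1 + 1 / p) + 1 := by positivity
  have htp : t ^ (p + 1) ≤ t ^ 2 := by
    rw [← Real.rpow_natCast]
    exact Real.rpow_le_rpow_of_exponent_ge ht ht1.le (by norm_num; linarith)
  rcases le_or_gt v t with h | h
  · have hut : max v 0 ≤ t := max_le h ht.le
    have e1 : max v 0 ^ p ≤ t ^ p := Real.rpow_le_rpow hu hut hp0.le
    have e2 : max v 0 ^ (p - 1) ≤ t ^ (p - 1) := Real.rpow_le_rpow hu hut (by linarith)
    have e3 : t * t ^ (p - 1) = t ^ p := by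
      rw [← rpow_succ_eq (by linarith) ht.le, sub_add_cancel]
    have e4 : max v 0 ^ (p - 1) * q ≤ t ^ (p - 1) * M :=
      (mul_le_mul_of_nonneg_left ((le_abs_self q).trans hq) (by positivity)).trans
        (mul_le_mul_of_nonneg_right e2 hM)
    have e5 : -(k * max v 0 ^ p) ≤ t ^ p := by
      rw [← neg_mul]
      exact (mul_le_of_le_one_left (by positivity) ((neg_le_abs k).trans hk1)).trans e1
    have hρt : ρ ≤ (2 + |M| + C) * t ^ p := by
      rw [hρe, abs_of_nonneg hM]
      have := (le_abs_self ν).trans (hνc (h.trans_lt htc))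
      have := mul_le_mul_of_nonneg_left e4 ht.le
      have e6 : t * (t ^ (p - 1) * M) = M * t ^ p := by rw [← e3]; ring
      linarith
    have h1 : ρ ^ (1 + 1 / p) ≤ (2 + |M| + C) ^ (1 + 1 / p) * t ^ (p + 1) := by
      rw [← rpow_rpow_succ hp0 ht.le, ← Real.mul_rpow (by positivity) (by positivity)]
      exact Real.rpow_le_rpow hρ hρt (by positivity)
    have h2 : max v 0 ^ (p + 1) ≤ t ^ (p + 1) := Real.rpow_le_rpow hu hut (by linarith)
    calc convexRem p ρ (max v 0) ≤ ρ ^ (1 + 1 / p) + max v 0 ^ (p + 1) := convexRem_le hp0 hρ hu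
      _ ≤ ((2 + |M| + C) ^ (1 + 1 / p) + 1) * t ^ (p + 1) := by linarith
      _ ≤ ((2 + |M| + C) ^ (1 + 1 / p) + 1) * t ^ 2 := by gcongr
      _ ≤ _ := mul_le_mul_of_nonneg_right (by linarith) (by positivity)
  · have hv0 : 0 < v := ht.trans h
    have hmax : max v 0 = v := max_eq_left hv0.le
    rw [hmax] at huK hρe ⊢
    have hV : 0 < v ^ (p - 1) := Real.rpow_pos_of_pos hv0 _
    have h1 := convexRem_mul_le hp hρ hv0.le
    rw [hρe, add_sub_cancel_left] at h1
    rw [← hρe] at h1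
    have hsq : (t * (v ^ (p - 1) * q) + ν - k * v ^ p) ^ 2
        ≤ 3 * ((t * (v ^ (p - 1) * q)) ^ 2 + ν ^ 2 + (k * v ^ p) ^ 2) := by
      nlinarith [sq_nonneg (t * (v ^ (p - 1) * q) - ν), sq_nonneg (t * (v ^ (p - 1) * q) + k * v ^ p),
        sq_nonneg (ν + k * v ^ p)]
    have hVK : v ^ (p - 1) ≤ K ^ (p - 1) := Real.rpow_le_rpow hv0.le huK (by linarith)
    have b1 : (t * (v ^ (p - 1) * q)) ^ 2 ≤ K ^ (p - 1) * M ^ 2 * t ^ 2 * v ^ (p - 1) := by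
      have : q ^ 2 ≤ M ^ 2 := sq_le_sq' (abs_le.1 hq).1 (abs_le.1 hq).2
      calc (t * (v ^ (p - 1) * q)) ^ 2 = v ^ (p - 1) * q ^ 2 * t ^ 2 * v ^ (p - 1) := by ring
        _ ≤ _ := by gcongr
    have b2 : ν ^ 2 ≤ (C ^ 2 + C ^ 2 / c ^ (p - 1)) * t ^ 2 * v ^ (p - 1) := by
      rw [← sq_abs]
      rcases lt_or_ge v c with hvc | hvc
      · have e1 : t ^ p = t * t ^ (p - 1) := by
          rw [← rpow_succ_eq (by linarith) ht.le, sub_add_cancel]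
        have e2 : t ^ (p - 1) ≤ v ^ (p - 1) := Real.rpow_le_rpow ht.le h.le (by linarith)
        have e3 : t ^ (p - 1) ≤ 1 := Real.rpow_le_one ht.le ht1.le (by linarith)
        calc |ν| ^ 2 ≤ (C * t ^ p) ^ 2 := by gcongr; exact hνc hvc
          _ = C ^ 2 * t ^ 2 * (t ^ (p - 1) * t ^ (p - 1)) := by rw [e1]; ring
          _ ≤ C ^ 2 * t ^ 2 * (1 * v ^ (p - 1)) := by gcongr
          _ ≤ _ := by
            have : 0 ≤ C ^ 2 / c ^ (p - 1) * t ^ 2 * v ^ (p - 1) := by positivity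
            linarith
      · have e2 : c ^ (p - 1) ≤ v ^ (p - 1) := Real.rpow_le_rpow hc.le hvc (by linarith)
        have hcp : 0 < c ^ (p - 1) := Real.rpow_pos_of_pos hc _
        calc |ν| ^ 2 ≤ (C * t) ^ 2 := by gcongr
          _ = C ^ 2 / c ^ (p - 1) * t ^ 2 * c ^ (p - 1) := by field_simp
          _ ≤ C ^ 2 / c ^ (p - 1) * t ^ 2 * v ^ (p - 1) := by gcongr
          _ ≤ _ := by
            have : 0 ≤ C ^ 2 * t ^ 2 * v ^ (p - 1) := by positivity
            linarith
    have b3 : (k * v ^ p) ^ 2 ≤ C ^ 2 * K ^ (p + 1) * t ^ 2 * v ^ (p - 1) := by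
      have e1 : v ^ p * v ^ p = v ^ (p + 1) * v ^ (p - 1) := by
        rw [← Real.rpow_add hv0, ← Real.rpow_add hv0]; congr 1; ring
      have e2 : v ^ (p + 1) ≤ K ^ (p + 1) := Real.rpow_le_rpow hv0.le huK (by linarith)
      calc (k * v ^ p) ^ 2 = |k| ^ 2 * (v ^ p * v ^ p) := by rw [sq_abs]; ring
        _ = |k| ^ 2 * (v ^ (p + 1) * v ^ (p - 1)) := by rw [e1]
        _ ≤ (C * t) ^ 2 * (K ^ (p + 1) * v ^ (p - 1)) := by gcongr
        _ = _ := by ring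
    have hfin : convexRem p ρ v * v ^ (p - 1) ≤ 3 * (K ^ (p - 1) * M ^ 2
        + (C ^ 2 + C ^ 2 / c ^ (p - 1)) + C ^ 2 * K ^ (p + 1)) * t ^ 2 * v ^ (p - 1) := by
      linarith
    refine (le_of_mul_le_mul_right hfin hV).trans ?_
    gcongr
    linarith

end Variation

section SecondVariation

variable {N : ℕ}

theorem second_variation_nonneg {Ω : Set (Eucl N)} (hΩ : IsOpen Ω)
    (hb : Bornology.IsBounded Ω) {p : ℝ} (hp : 1 < p) {lam α : ℝ} {ψ : Eucl N → ℝ}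
    (hsol : IsSol Ω p lam α ψ)
    (hvar : ∀ ρ : Eucl N → ℝ, Measurable ρ →
      (∀ᵐ x ∂(volume.restrict Ω), 0 ≤ ρ x) → (∫ x in Ω, ρ x) = 1 →
      IntegrableOn (fun x => ρ x ^ (1 + 1 / p)) Ω volume →
      ∀ w : Eucl N → ℝ, ContDiff ℝ 2 w →
        (∀ x ∈ frontier Ω, w x = 0) → (∀ x ∈ Ω, -lapl w x = ρ x) →
        (p / (p + 1)) * (∫ x in Ω, ((max (α + lam * ψ x) 0) ^ p) ^ (1 + 1 / p)) -
            (lam / 2) * (∫ x in Ω, (max (α + lam * ψ x) 0) ^ p * ψ x) ≤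
          (p / (p + 1)) * (∫ x in Ω, ρ x ^ (1 + 1 / p)) -
            (lam / 2) * (∫ x in Ω, ρ x * w x))
    {w : Eucl N → ℝ} (hw : ContDiff ℝ 2 w) (hw0 : ∀ x ∈ frontier Ω, w x = 0)
    (hρ0 : ∀ x ∈ Ω, 0 ≤ -lapl w x) (hρ1 : ∫ x in Ω, -lapl w x = 1) :
    0 ≤ (∫ x in Ω, convexRem p (-lapl w x) (max (α + lam * ψ x) 0))
      + (∫ x in Ω, max (-(α + lam * ψ x)) 0 * -lapl w x)
      - lam / 2 * ∫ x in Ω, (-lapl w x - max (α + lam * ψ x) 0 ^ p) * (w x - ψ x) := by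
  obtain ⟨hψ, heq, hψ0, hone⟩ := hsol
  have hp0 : 0 < p := by linarith
  have hinv : 0 ≤ 1 + 1 / p := by positivity
  set v : Eucl N → ℝ := fun x => α + lam * ψ x with hv
  have hvc : Continuous v := continuous_const.add (continuous_const.mul hψ.continuous)
  set ρ : Eucl N → ℝ := fun x => -lapl w x with hρ
  have hρc : Continuous ρ := hw.continuous_lapl.neg
  set s : Eucl N → ℝ := fun x => max (v x) 0 ^ p with hs
  have hsc : Continuous s := continuous_max_rpow hvc hp0.le
  have hρp : Continuous fun x => ρ x ^ (1 + 1 / p) := hρc.rpow_const fun _ => Or.inr hinv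
  have hsp : Continuous fun x => s x ^ (1 + 1 / p) := hsc.rpow_const fun _ => Or.inr hinv
  have I : ∀ {f : Eucl N → ℝ}, Continuous f → IntegrableOn f Ω := fun hf =>
    hf.integrableOn_of_isBounded hb
  have h := hvar ρ hρc.measurable ((ae_restrict_iff' hΩ.measurableSet).2
    (Filter.Eventually.of_forall hρ0)) hρ1 (I hρp) w hw hw0 fun x _ => rfl
  have hgreen : ∫ x in Ω, ρ x * ψ x = ∫ x in Ω, s x * w x := by
    have h1 := setIntegral_mul_lapl_comm hΩ hb hψ hw hψ0 hw0
    have e1 : ∫ x in Ω, ρ x * ψ x = -∫ x in Ω, ψ x * lapl w x := by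
      rw [← integral_neg]; congr 1; funext x; simp only [hρ]; ring
    have e2 : ∫ x in Ω, s x * w x = -∫ x in Ω, w x * lapl ψ x := by
      rw [← integral_neg]
      refine setIntegral_congr_fun hΩ.measurableSet fun x hx => ?_
      simp only [hs, hv]
      rw [← heq x hx]; ring
    rw [e1, e2, h1]
  have i1 : IntegrableOn (fun x => p / (p + 1) * ρ x ^ (1 + 1 / p)) Ω := I (continuous_const.mul hρp)
  have i2 : IntegrableOn (fun x => lam / 2 * (ρ x * w x)) Ω :=
    I (continuous_const.mul (hρc.mul hw.continuous))
  have i3 : IntegrableOn (fun x => p / (p + 1) * s x ^ (1 + 1 / p)) Ω := I (continuous_const.mul hsp)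
  have i4 : IntegrableOn (fun x => lam / 2 * (s x * ψ x)) Ω :=
    I (continuous_const.mul (hsc.mul hψ.continuous))
  have i5 : IntegrableOn (fun x => α * (ρ x - s x)) Ω := I (continuous_const.mul (hρc.sub hsc))
  have i6 : IntegrableOn (fun x => lam / 2 * (ρ x * ψ x - s x * w x)) Ω :=
    I (continuous_const.mul ((hρc.mul hψ.continuous).sub (hsc.mul hw.continuous)))
  have hcR : Continuous fun x => convexRem p (ρ x) (max (v x) 0) :=
    ((continuous_const.mul hρp).sub (continuous_const.mul hsp)).sub
      ((hvc.max continuous_const).mul (hρc.sub hsc))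
  have i7 : IntegrableOn (fun x => max (-v x) 0 * ρ x) Ω :=
    I ((hvc.neg.max continuous_const).mul hρc)
  have i8 : IntegrableOn (fun x => lam / 2 * ((ρ x - s x) * (w x - ψ x))) Ω :=
    I (continuous_const.mul ((hρc.sub hsc).mul (hw.continuous.sub hψ.continuous)))
  have e1 : ∫ x in Ω, α * (ρ x - s x) = 0 := by
    rw [integral_const_mul, integral_sub (I hρc) (I hsc), hρ1, hone, sub_self, mul_zero]
  have e2 : ∫ x in Ω, lam / 2 * (ρ x * ψ x - s x * w x) = 0 := by
    have j1 : IntegrableOn (fun x => ρ x * ψ x) Ω := I (hρc.mul hψ.continuous)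
    have j2 : IntegrableOn (fun x => s x * w x) Ω := I (hsc.mul hw.continuous)
    rw [integral_const_mul, integral_sub j1 j2, hgreen, sub_self, mul_zero]
  have key : ((∫ x in Ω, p / (p + 1) * ρ x ^ (1 + 1 / p)) - ∫ x in Ω, lam / 2 * (ρ x * w x))
      - ((∫ x in Ω, p / (p + 1) * s x ^ (1 + 1 / p)) - ∫ x in Ω, lam / 2 * (s x * ψ x))
      - (∫ x in Ω, α * (ρ x - s x)) - (∫ x in Ω, lam / 2 * (ρ x * ψ x - s x * w x))
      = (∫ x in Ω, convexRem p (ρ x) (max (v x) 0)) + (∫ x in Ω, max (-v x) 0 * ρ x)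
        - ∫ x in Ω, lam / 2 * ((ρ x - s x) * (w x - ψ x)) := by
    have j1 : IntegrableOn (fun x => p / (p + 1) * ρ x ^ (1 + 1 / p) - lam / 2 * (ρ x * w x)) Ω :=
      i1.sub i2
    have j2 : IntegrableOn (fun x => p / (p + 1) * s x ^ (1 + 1 / p) - lam / 2 * (s x * ψ x)) Ω :=
      i3.sub i4
    have j3 : IntegrableOn (fun x => p / (p + 1) * ρ x ^ (1 + 1 / p) - lam / 2 * (ρ x * w x)
      - (p / (p + 1) * s x ^ (1 + 1 / p) - lam / 2 * (s x * ψ x))) Ω := j1.sub j2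
    have j4 : IntegrableOn (fun x => p / (p + 1) * ρ x ^ (1 + 1 / p) - lam / 2 * (ρ x * w x)
      - (p / (p + 1) * s x ^ (1 + 1 / p) - lam / 2 * (s x * ψ x)) - α * (ρ x - s x)) Ω := j3.sub i5
    have j5 : IntegrableOn (fun x => convexRem p (ρ x) (max (v x) 0) + max (-v x) 0 * ρ x) Ω :=
      (I hcR).add i7
    rw [← integral_sub i1 i2, ← integral_sub i3 i4, ← integral_sub j1 j2, ← integral_sub j3 i5,
      ← integral_sub j4 i6, ← integral_add (I hcR) i7, ← integral_sub j5 i8]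
    congr 1
    funext x
    have hu : max (v x) 0 = v x + max (-v x) 0 := by
      rcases le_total 0 (v x) with h | h
      · rw [max_eq_left h, max_eq_right (by linarith), add_zero]
      · rw [max_eq_right h, max_eq_left (by linarith)]; ring
    have hz : max (-v x) 0 * s x = 0 := by
      rcases le_total 0 (v x) with h | h
      · rw [max_eq_right (a := -v x) (by linarith), zero_mul]
      · simp only [hs]; rw [max_eq_right h, Real.zero_rpow hp0.ne', mul_zero]
    have ee : convexRem p (ρ x) (max (v x) 0) = p / (p + 1) * ρ x ^ (1 + 1 / p)
      - p / (p + 1) * s x ^ (1 + 1 / p) - (v x + max (-v x) 0) * (ρ x - s x) := by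
      rw [← hu]; rfl
    rw [ee]
    have hvx : v x = α + lam * ψ x := rfl
    rw [← sub_eq_zero]
    linear_combination (ρ x - s x) * hvx - hz
  rw [e1, e2, integral_const_mul, integral_const_mul, integral_const_mul, integral_const_mul,
    integral_const_mul] at key
  linarith

end SecondVariation

section VariationalInequality

variable {N : ℕ}

theorem variational_inequality (hN : N ≠ 0) {Ω : Set (Eucl N)} (hΩ : IsOpen Ω)
    (hb : Bornology.IsBounded Ω) (hvol : volume Ω = 1) {p : ℝ} (hp : 1 < p) {lam α : ℝ}
    {ψ : Eucl N → ℝ} (hsol : IsSol Ω p lam α ψ)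
    (hvar : ∀ ρ : Eucl N → ℝ, Measurable ρ →
      (∀ᵐ x ∂(volume.restrict Ω), 0 ≤ ρ x) → (∫ x in Ω, ρ x) = 1 →
      IntegrableOn (fun x => ρ x ^ (1 + 1 / p)) Ω volume →
      ∀ w : Eucl N → ℝ, ContDiff ℝ 2 w →
        (∀ x ∈ frontier Ω, w x = 0) → (∀ x ∈ Ω, -lapl w x = ρ x) →
        (p / (p + 1)) * (∫ x in Ω, ((max (α + lam * ψ x) 0) ^ p) ^ (1 + 1 / p)) -
            (lam / 2) * (∫ x in Ω, (max (α + lam * ψ x) 0) ^ p * ψ x) ≤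
          (p / (p + 1)) * (∫ x in Ω, ρ x ^ (1 + 1 / p)) -
            (lam / 2) * (∫ x in Ω, ρ x * w x))
    {φ q : Eucl N → ℝ} (hφ : ContDiff ℝ 2 φ) (hφ0 : ∀ x ∈ frontier Ω, φ x = 0)
    (hq : Continuous q)
    (hφq : ∀ x ∈ Ω, -lapl φ x = max (α + lam * ψ x) 0 ^ (p - 1) * q x)
    (hintegral : ∫ x in Ω, max (α + lam * ψ x) 0 ^ (p - 1) * q x = 0) {M : ℝ}
    (hM : ∀ x ∈ Ω, |q x| ≤ M) (hcorr : HasCorrection Ω p M fun x => α + lam * ψ x) :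
    lam / 2 * ∫ x in Ω, max (α + lam * ψ x) 0 ^ (p - 1) * q x * φ x
      ≤ ∫ x in Ω, 1 / (2 * p) * (max (α + lam * ψ x) 0 ^ (p - 1) * q x ^ 2) := by
  have hsol' := hsol
  obtain ⟨hψ, heq, hψ0, hone⟩ := hsol'
  have hp0 : 0 < p := by linarith
  set v : Eucl N → ℝ := fun x => α + lam * ψ x with hv
  have hvc : Continuous v := continuous_const.add (continuous_const.mul hψ.continuous)
  obtain ⟨C, γ, c, t₀, hC, hγ, hc, ht₀, hξ⟩ := hcorr
  choose! ξ hξ2 hξ0 hξb using hξ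
  set V : Eucl N → ℝ := fun x => max (v x) 0 ^ (p - 1) with hVdef
  have hVc : Continuous V := continuous_max_rpow hvc (by linarith)
  set s : Eucl N → ℝ := fun x => max (v x) 0 ^ p with hs
  have hsc : Continuous s := continuous_max_rpow hvc hp0.le
  have hs0 : ∀ x, 0 ≤ s x := fun x => by positivity
  have hV0 : ∀ x, 0 ≤ V x := fun x => by positivity
  obtain ⟨Kv, hKv0, hKv⟩ := exists_abs_le_of_isBounded hb hvc
  obtain ⟨Ks, hKs0, hKs⟩ := exists_abs_le_of_isBounded hb hsc
  obtain ⟨KD, hKD0, hKD⟩ := exists_abs_le_of_isBounded hb (hVc.mul hq)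
  obtain ⟨Kφ, hKφ0, hKφ⟩ := exists_abs_le_of_isBounded hb hφ.continuous
  obtain ⟨Cb, hCb0, hCb⟩ := exists_sup_bound hN hΩ hb
  obtain ⟨A, hA0, hA⟩ := convexRem_le_sq hp (M := M) hC hc hKv0
  have I : ∀ {f : Eucl N → ℝ}, Continuous f → IntegrableOn f Ω := fun hf =>
    hf.integrableOn_of_isBounded hb
  have hfin : IsFiniteMeasure (volume.restrict Ω) := ⟨by
    rw [Measure.restrict_apply_univ, hvol]; exact ENNReal.one_lt_top⟩
  set k : ℝ → ℝ := fun t => ∫ x in Ω, -lapl (ξ t) x with hk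
  set w : ℝ → Eucl N → ℝ := fun t x => (1 - k t) * ψ x + t * φ x + ξ t x with hw
  set l : Filter ℝ := nhdsWithin 0 (Ioi 0) with hl
  have hev : ∀ᶠ t in l, 0 < t ∧ t < t₀ ∧ t < 1 ∧ t < c ∧ C * t ≤ 1 / 2 := by
    have h1 : ∀ᶠ t in l, t < min (min t₀ 1) (min c (1 / (2 * (C + 1)))) :=
      nhdsWithin_le_nhds (gt_mem_nhds (by positivity))
    filter_upwards [self_mem_nhdsWithin, h1] with t ht h
    simp only [lt_min_iff] at h
    refine ⟨ht, h.1.1, h.1.2, h.2.1, ?_⟩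
    have h2 := h.2.2
    rw [lt_div_iff₀ (by positivity)] at h2
    have : (0 : ℝ) < t := ht
    nlinarith
  have ht0 : Filter.Tendsto (fun t : ℝ => t) l (nhds 0) :=
    Filter.tendsto_id.mono_left nhdsWithin_le_nhds
  have hpow0 : ∀ e : ℝ, 0 < e → Filter.Tendsto (fun t : ℝ => t ^ e) l (nhds 0) := fun e he => by
    have := ht0.rpow_const (p := e) (Or.inr he.le)
    rwa [Real.zero_rpow he.ne'] at this
  have hpow1 : ∀ t : ℝ, 0 < t → t < 1 → t ^ (1 + γ) ≤ t := fun t h0 h1 => by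
    have := Real.rpow_le_rpow_of_exponent_ge h0 h1.le (show (1 : ℝ) ≤ 1 + γ by linarith)
    rwa [Real.rpow_one] at this
  have hkb : ∀ t, 0 < t → t < t₀ → |k t| ≤ C * t ^ (1 + γ) := fun t h0 h1 => by
    have := norm_setIntegral_le_of_norm_le_const (μ := volume) (s := Ω)
      (f := fun x => -lapl (ξ t) x) (C := C * t ^ (1 + γ)) (by rw [hvol]; exact ENNReal.one_lt_top)
      (fun x hx => by rw [norm_neg]; exact (hξb t h0 h1 x hx).2.1)
    rwa [measureReal_def, hvol, ENNReal.toReal_one, mul_one] at this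
  have hw2 : ∀ t, 0 < t → t < t₀ → ContDiff ℝ 2 (w t) := fun t h0 h1 =>
    ((contDiff_const.mul hψ).add (contDiff_const.mul hφ)).add (hξ2 t h0 h1)
  have hlw : ∀ t, 0 < t → t < t₀ → ∀ x ∈ Ω,
      -lapl (w t) x = s x + (t * (V x * q x) + -lapl (ξ t) x - k t * s x) := by
    intro t h0 h1 x hx
    simp only [hw]
    rw [lapl_add ((contDiff_const.mul hψ).add (contDiff_const.mul hφ)) (hξ2 t h0 h1),
      lapl_add (contDiff_const.mul hψ) (contDiff_const.mul hφ), lapl_const_mul _ hψ,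
      lapl_const_mul _ hφ]
    have e1 : s x = -lapl ψ x := (heq x hx).symm
    have e2 : V x * q x = -lapl φ x := (hφq x hx).symm
    rw [e1, e2]; ring
  have hlow : ∀ t, 0 < t → t < t₀ → t < 1 → C * t ≤ 1 / 2 → ∀ x ∈ Ω, 0 ≤ -lapl (w t) x := by
    intro t h0 h1 h2 h3 x hx
    rw [hlw t h0 h1 x hx]
    have a1 := (hξb t h0 h1 x hx).1
    have a2 : k t * s x ≤ 1 / 2 * s x := mul_le_mul_of_nonneg_right ((le_abs_self _).trans
      ((hkb t h0 h1).trans ((mul_le_mul_of_nonneg_left (hpow1 t h0 h2) hC).trans h3))) (hs0 x)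
    have a3 : V x * -q x ≤ V x * M :=
      mul_le_mul_of_nonneg_left ((neg_le_abs _).trans (hM x hx)) (hV0 x)
    have a4 := mul_le_mul_of_nonneg_left a3 h0.le
    have a5 : t * M * V x + lapl (ξ t) x ≤ s x / 2 := a1
    linarith
  have hineq : ∀ᶠ t in l, 0 ≤ (∫ x in Ω, convexRem p (-lapl (w t) x) (max (v x) 0) / t ^ 2)
      + C * t ^ γ - lam / 2 * ∫ x in Ω, (-lapl (w t) x - s x) / t * ((w t x - ψ x) / t) := by
    filter_upwards [hev] with t ⟨h0, h1, h2, h3, h4⟩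
    have hρc : Continuous fun x => -lapl (w t) x := (hw2 t h0 h1).continuous_lapl.neg
    have hνc : Continuous fun x => -lapl (ξ t) x := (hξ2 t h0 h1).continuous_lapl.neg
    have hmass : ∫ x in Ω, -lapl (w t) x = 1 := by
      rw [setIntegral_congr_fun hΩ.measurableSet (hlw t h0 h1)]
      have i1 : IntegrableOn (fun x => t * (V x * q x)) Ω := I (continuous_const.mul (hVc.mul hq))
      have i2 : IntegrableOn (fun x => t * (V x * q x) + -lapl (ξ t) x) Ω := i1.add (I hνc)
      have i3 : IntegrableOn (fun x => k t * s x) Ω := I (continuous_const.mul hsc)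
      have i4 : IntegrableOn (fun x => t * (V x * q x) + -lapl (ξ t) x - k t * s x) Ω := i2.sub i3
      rw [integral_add (I hsc) i4, integral_sub i2 i3, integral_add i1 (I hνc),
        integral_const_mul, integral_const_mul]
      have a1 : ∫ x in Ω, V x * q x = 0 := hintegral
      have a2 : ∫ x in Ω, s x = 1 := hone
      rw [a1, a2]
      simp only [hk]; ring
    have h := second_variation_nonneg hΩ hb hp hsol hvar (hw2 t h0 h1) (fun x hx => by
      simp only [hw]
      rw [hψ0 x hx, hφ0 x hx, hξ0 t h0 h1 x hx]; ring) (hlow t h0 h1 h2 h4) hmass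
    have hneg : ∫ x in Ω, max (-v x) 0 * -lapl (w t) x ≤ C * t ^ (2 + γ) := by
      have : ∫ x in Ω, max (-v x) 0 * -lapl (w t) x ≤ ∫ x in Ω, C * t ^ (2 + γ) := by
        refine setIntegral_mono_on (I ((hvc.neg.max continuous_const).mul hρc))
          (integrable_const _) hΩ.measurableSet fun x hx => ?_
        rw [hlw t h0 h1 x hx]
        refine le_trans ?_ (hξb t h0 h1 x hx).2.2.2
        rcases le_total 0 (v x) with hvx | hvx
        · rw [max_eq_right (a := -v x) (by linarith), zero_mul, zero_mul]
        · have z1 : s x = 0 := by simp only [hs]; rw [max_eq_right hvx, Real.zero_rpow hp0.ne']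
          have z2 : V x = 0 := by
            simp only [hVdef]; rw [max_eq_right hvx, Real.zero_rpow (by linarith)]
          rw [z1, z2]
          refine mul_le_mul_of_nonneg_left ?_ (le_max_right _ _)
          simpa using neg_le_abs (lapl (ξ t) x)
      rwa [setIntegral_const, measureReal_def, hvol, ENNReal.toReal_one, one_smul] at this
    have e1 : ∀ x, (-lapl (w t) x - s x) / t * ((w t x - ψ x) / t)
        = (-lapl (w t) x - s x) * (w t x - ψ x) / t ^ 2 := fun x => by field_simp
    simp only [e1]
    rw [integral_div, integral_div]
    have e2 : t ^ γ = t ^ (2 + γ) / t ^ 2 := by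
      rw [Real.rpow_add h0, Real.rpow_two]; field_simp
    calc (0 : ℝ) ≤ ((∫ x in Ω, convexRem p (-lapl (w t) x) (max (v x) 0)) + C * t ^ (2 + γ)
        - lam / 2 * ∫ x in Ω, (-lapl (w t) x - s x) * (w t x - ψ x)) / t ^ 2 := by
          refine div_nonneg ?_ (by positivity)
          have : ∀ a b b' d : ℝ, 0 ≤ a + b - d → b ≤ b' → 0 ≤ a + b' - d := fun a b b' d h1 h2 => by
            linarith
          exact this _ _ _ _ h hneg
      _ = _ := by rw [e2]; ring
  have hrest : ∀ t, 0 < t → t < t₀ → ∀ x ∈ Ω,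
      |-lapl (ξ t) x - k t * s x| ≤ C * (1 + Ks) * t ^ (1 + γ) := fun t h0 h1 x hx => by
    refine (abs_sub _ _).trans ?_
    rw [abs_mul, abs_neg]
    have a1 := (hξb t h0 h1 x hx).2.1
    have a2 := mul_le_mul (hkb t h0 h1) (hKs x (subset_closure hx)) (abs_nonneg _)
      (by positivity)
    linarith
  have hδt : ∀ t, 0 < t → t < t₀ → ∀ x ∈ Ω,
      |(-lapl (w t) x - s x) / t - V x * q x| ≤ C * (1 + Ks) * t ^ γ := fun t h0 h1 x hx => by
    have e : (-lapl (w t) x - s x) / t - V x * q x = (-lapl (ξ t) x - k t * s x) / t := by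
      rw [hlw t h0 h1 x hx]; field_simp; ring
    rw [e, abs_div, abs_of_pos h0, div_le_iff₀ h0]
    refine (hrest t h0 h1 x hx).trans_eq ?_
    rw [Real.rpow_add h0, Real.rpow_one]; ring
  have hζt : ∀ t, 0 < t → t < t₀ → ∀ x ∈ Ω,
      |(w t x - ψ x) / t - φ x| ≤ Cb * (C * (1 + Ks)) * t ^ γ := fun t h0 h1 x hx => by
    have e : (w t x - ψ x) / t - φ x = (ξ t x - k t * ψ x) / t := by
      simp only [hw]; field_simp; ring
    rw [e, abs_div, abs_of_pos h0, div_le_iff₀ h0]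
    refine (hCb (fun x => ξ t x - k t * ψ x) ((hξ2 t h0 h1).sub (contDiff_const.mul hψ))
      (fun y hy => by rw [hξ0 t h0 h1 y hy, hψ0 y hy]; ring) (C * (1 + Ks) * t ^ (1 + γ))
      (by positivity) (fun y hy => ?_) x (subset_closure hx)).trans_eq ?_
    · rw [lapl_sub (hξ2 t h0 h1) (contDiff_const.mul hψ), lapl_const_mul _ hψ, ← abs_neg]
      have := hrest t h0 h1 y hy
      have e1 : s y = -lapl ψ y := (heq y hy).symm
      rw [e1] at this
      convert this using 2
      ring
    · rw [Real.rpow_add h0, Real.rpow_one]; ring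
  have hsq0 : ∀ B : ℝ, Filter.Tendsto (fun t : ℝ => B * t ^ γ) l (nhds 0) := fun B => by
    have := (hpow0 γ hγ).const_mul B
    rwa [mul_zero] at this
  have hδlim : ∀ x ∈ Ω, Filter.Tendsto (fun t => (-lapl (w t) x - s x) / t) l
      (nhds (V x * q x)) := fun x hx => by
    rw [tendsto_iff_norm_sub_tendsto_zero]
    refine squeeze_zero' (Filter.Eventually.of_forall fun _ => norm_nonneg _) ?_
      (hsq0 (C * (1 + Ks)))
    filter_upwards [hev] with t h using hδt t h.1 h.2.1 x hx
  have hζlim : ∀ x ∈ Ω, Filter.Tendsto (fun t => (w t x - ψ x) / t) l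
      (nhds (φ x)) := fun x hx => by
    rw [tendsto_iff_norm_sub_tendsto_zero]
    refine squeeze_zero' (Filter.Eventually.of_forall fun _ => norm_nonneg _) ?_
      (hsq0 (Cb * (C * (1 + Ks))))
    filter_upwards [hev] with t h using hζt t h.1 h.2.1 x hx
  have hL3 : Filter.Tendsto
      (fun t => ∫ x in Ω, (-lapl (w t) x - s x) / t * ((w t x - ψ x) / t)) l
      (nhds (∫ x in Ω, V x * q x * φ x)) := by
    refine tendsto_integral_filter_of_dominated_convergence
      (fun _ => (KD + C * (1 + Ks)) * (Kφ + Cb * (C * (1 + Ks)))) ?_ ?_ (integrable_const _) ?_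
    · filter_upwards [hev] with t h
      exact Continuous.aestronglyMeasurable
        ((((hw2 t h.1 h.2.1).continuous_lapl.neg.sub hsc).div_const _).mul
          (((hw2 t h.1 h.2.1).continuous.sub hψ.continuous).div_const _))
    · filter_upwards [hev] with t h
      refine (ae_restrict_iff' hΩ.measurableSet).2 (Filter.Eventually.of_forall fun x hx => ?_)
      have htγ : t ^ γ ≤ 1 := Real.rpow_le_one h.1.le h.2.2.1.le hγ.le
      rw [norm_mul, Real.norm_eq_abs, Real.norm_eq_abs]
      have b1 : |(-lapl (w t) x - s x) / t| ≤ KD + C * (1 + Ks) := by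
        have a1 := hδt t h.1 h.2.1 x hx
        have a2 : |V x * q x| ≤ KD := hKD x (subset_closure hx)
        have a3 : C * (1 + Ks) * t ^ γ ≤ C * (1 + Ks) := mul_le_of_le_one_right (by positivity) htγ
        linarith [abs_sub_abs_le_abs_sub ((-lapl (w t) x - s x) / t) (V x * q x)]
      have b2 : |(w t x - ψ x) / t| ≤ Kφ + Cb * (C * (1 + Ks)) := by
        have a1 := hζt t h.1 h.2.1 x hx
        have a2 : |φ x| ≤ Kφ := hKφ x (subset_closure hx)
        have a3 : Cb * (C * (1 + Ks)) * t ^ γ ≤ Cb * (C * (1 + Ks)) :=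
          mul_le_of_le_one_right (by positivity) htγ
        linarith [abs_sub_abs_le_abs_sub ((w t x - ψ x) / t) (φ x)]
      exact mul_le_mul b1 b2 (abs_nonneg _) (by positivity)
    · exact (ae_restrict_iff' hΩ.measurableSet).2 (Filter.Eventually.of_forall fun x hx =>
        (hδlim x hx).mul (hζlim x hx))
  have hL1 : Filter.Tendsto
      (fun t => ∫ x in Ω, convexRem p (-lapl (w t) x) (max (v x) 0) / t ^ 2) l
      (nhds (∫ x in Ω, 1 / (2 * p) * (V x * q x ^ 2))) := by
    refine tendsto_integral_filter_of_dominated_convergence (fun _ => A) ?_ ?_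
      (integrable_const _) ?_
    · filter_upwards [hev] with t h
      have hρc : Continuous fun x => -lapl (w t) x := (hw2 t h.1 h.2.1).continuous_lapl.neg
      have hinv : 0 ≤ 1 + 1 / p := by positivity
      refine Continuous.aestronglyMeasurable (Continuous.div_const ?_ _)
      exact ((continuous_const.mul (hρc.rpow_const fun _ => Or.inr hinv)).sub
        (continuous_const.mul (hsc.rpow_const fun _ => Or.inr hinv))).sub
        ((hvc.max continuous_const).mul (hρc.sub hsc))
    · filter_upwards [hev] with t ⟨h0, h1, h2, h3, h4⟩
      refine (ae_restrict_iff' hΩ.measurableSet).2 (Filter.Eventually.of_forall fun x hx => ?_)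
      have hρ0 := hlow t h0 h1 h2 h4 x hx
      have hp1 := mul_le_mul_of_nonneg_left (hpow1 t h0 h2) hC
      have hkt : |k t| ≤ C * t := (hkb t h0 h1).trans hp1
      rw [Real.norm_of_nonneg (div_nonneg (convexRem_nonneg hp0 hρ0 (le_max_right _ _))
        (sq_nonneg t)), div_le_iff₀ (by positivity)]
      refine hA t (v x) (q x) (-lapl (ξ t) x) (k t) _ h0 h2 h3 (hM x hx)
        ((le_abs_self _).trans (hKv x (subset_closure hx))) ?_ (fun hvc => ?_) hkt
        (hkt.trans (h4.trans (by norm_num))) hρ0 (hlw t h0 h1 x hx)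
      · rw [abs_neg]; exact (hξb t h0 h1 x hx).2.1.trans hp1
      · rw [abs_neg]; exact (hξb t h0 h1 x hx).2.2.1 hvc
    · refine (ae_restrict_iff' hΩ.measurableSet).2 (Filter.Eventually.of_forall fun x hx => ?_)
      rcases lt_or_ge 0 (v x) with hvx | hvx
      · have := tendsto_convexRem hp (u := max (v x) 0) (q := q x)
          (δ := fun t => -lapl (w t) x - s x) (l := l) (lt_max_of_lt_left hvx) Filter.tendsto_id
          (hδlim x hx)
        refine this.congr fun t => ?_
        simp only [hs]
        rw [add_sub_cancel]
      · have hu : max (v x) 0 = 0 := max_eq_right hvx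
        have hV : V x = 0 := by simp only [hVdef]; rw [hu, Real.zero_rpow (by linarith)]
        have hsx : s x = 0 := by simp only [hs]; rw [hu, Real.zero_rpow hp0.ne']
        rw [hV, hu, zero_mul, mul_zero]
        have hz : Filter.Tendsto (fun t : ℝ => C ^ (1 + 1 / p) * t ^ (p - 1)) l (nhds 0) := by
          have := (hpow0 (p - 1) (by linarith)).const_mul (C ^ (1 + 1 / p))
          rwa [mul_zero] at this
        refine squeeze_zero' ?_ ?_ hz
        · filter_upwards [hev] with t ⟨h0, h1, h2, h3, h4⟩
          exact div_nonneg (convexRem_nonneg hp0 (hlow t h0 h1 h2 h4 x hx) le_rfl) (sq_nonneg t)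
        · filter_upwards [hev] with t ⟨h0, h1, h2, h3, h4⟩
          have hρ0 := hlow t h0 h1 h2 h4 x hx
          rw [div_le_iff₀ (by positivity)]
          refine (convexRem_le hp0 hρ0 le_rfl).trans ?_
          rw [Real.zero_rpow (by linarith), add_zero]
          have hρe : -lapl (w t) x ≤ C * t ^ p := by
            rw [hlw t h0 h1 x hx, hV, hsx]
            have := (neg_le_abs _).trans ((hξb t h0 h1 x hx).2.2.1 (hvx.trans_lt hc))
            linarith
          refine (Real.rpow_le_rpow hρ0 hρe (by positivity)).trans_eq ?_
          rw [Real.mul_rpow hC (by positivity), rpow_rpow_succ hp0 h0.le, mul_assoc,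
            ← Real.rpow_two, ← Real.rpow_add h0]
          congr 2
          ring
  have hlim := (hL1.add (hsq0 C)).sub (hL3.const_mul (lam / 2))
  rw [add_zero] at hlim
  have := ge_of_tendsto hlim hineq
  linarith

end VariationalInequality

section Corrections

variable {N : ℕ}

theorem exists_pd_ne_zero {f : Eucl N → ℝ} {x : Eucl N} (h : fderiv ℝ f x ≠ 0) :
    ∃ i, pd i f x ≠ 0 := by
  by_contra! hc
  refine h (ContinuousLinearMap.coe_injective
    ((EuclideanSpace.basisFun (Fin N) ℝ).toBasis.ext fun i => ?_))
  simpa [pd] using hc i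

/-- Near a boundary point there is a function vanishing on the boundary and strictly
subharmonic there. -/
theorem exists_local_subharmonic {Ω : Set (Eucl N)} (hΩ : IsC3Domain Ω) {x₀ : Eucl N}
    (hx₀ : x₀ ∈ frontier Ω) : ∃ S : Eucl N → ℝ, ContDiff ℝ 2 S ∧ (∀ x ∈ frontier Ω, S x = 0) ∧
      (∀ x ∈ frontier Ω, 0 ≤ lapl S x) ∧ ∃ O ∈ nhds x₀, ∀ x ∈ frontier Ω, x ∈ O → 0 < lapl S x := by
  obtain ⟨hΩo, -, -, hloc⟩ := hΩ
  obtain ⟨U, f, hU, hxU, hf, hdf, hΩU⟩ := hloc x₀ hx₀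
  obtain ⟨ε, hε, hεU⟩ := Metric.isOpen_iff.1 hU x₀ hxU
  have hf2 : ContDiff ℝ 2 f := hf.of_le (by norm_num)
  have hf0 : ∀ x ∈ frontier Ω, x ∈ U → f x = 0 := by
    intro x hx hxU
    have h1 : x ∉ Ω := fun h => (hΩo.frontier_eq ▸ hx).2 h
    refine le_antisymm ?_ ?_
    · by_contra! h
      have hc : Continuous fun y => f y := hf2.continuous
      have ho : IsOpen (U ∩ {y | 0 < f y}) := hU.inter (isOpen_lt continuous_const hc)
      obtain ⟨y, hy, hyΩ⟩ := mem_closure_iff.1 hx.1 _ ho ⟨hxU, h⟩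
      have : y ∈ {y ∈ U | f y < 0} := hΩU ▸ ⟨hyΩ, hy.1⟩
      exact absurd this.2 (not_lt.2 (le_of_lt hy.2))
    · by_contra! h
      have : x ∈ Ω ∩ U := hΩU ▸ ⟨hxU, h⟩
      exact h1 this.1
  let χ : ContDiffBump x₀ := ⟨ε / 2, ε, by positivity, by linarith⟩
  have hχ : ContDiff ℝ 2 fun x => χ x := χ.contDiff
  have hh : ContDiff ℝ 2 fun x => χ x * f x := hχ.mul hf2
  have hh0 : ∀ x ∈ frontier Ω, χ x * f x = 0 := by
    intro x hx
    by_cases hxε : x ∈ ball x₀ ε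
    · rw [hf0 x hx (hεU hxε), mul_zero]
    · rw [χ.zero_of_le_dist (by simpa using hxε), zero_mul]
  have hlap : ∀ x ∈ frontier Ω, lapl (fun x => χ x * f x * (χ x * f x)) x =
      2 * ∑ i, pd i (fun x => χ x * f x) x * pd i (fun x => χ x * f x) x := by
    intro x hx
    rw [lapl_mul hh hh, hh0 x hx]
    ring
  refine ⟨fun x => χ x * f x * (χ x * f x), hh.mul hh, fun x hx => by simp [hh0 x hx],
    fun x hx => ?_, ball x₀ (ε / 2), ball_mem_nhds _ (by positivity), fun x hx hxO => ?_⟩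
  · rw [hlap x hx]
    exact mul_nonneg zero_le_two (Finset.sum_nonneg fun i _ => mul_self_nonneg _)
  · rw [hlap x hx]
    obtain ⟨i, hi⟩ := exists_pd_ne_zero (hdf x (hεU (ball_subset_ball (by linarith) hxO)))
    have he : (fun x => χ x * f x) =ᶠ[nhds x] f := by
      filter_upwards [isOpen_ball.mem_nhds hxO] with y hy
      rw [χ.one_of_mem_closedBall (ball_subset_closedBall hy), one_mul]
    refine mul_pos two_pos (Finset.sum_pos' (fun i _ => mul_self_nonneg _)
      ⟨i, Finset.mem_univ i, ?_⟩)
    rw [pd_congr_of_eventuallyEq he]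
    exact mul_self_pos.2 hi

/-- A function vanishing on the boundary and uniformly subharmonic near it. -/
theorem exists_boundary_subharmonic {Ω : Set (Eucl N)} (hΩ : IsC3Domain Ω) :
    ∃ (S : Eucl N → ℝ) (W : Set (Eucl N)), ContDiff ℝ 2 S ∧ (∀ x ∈ frontier Ω, S x = 0) ∧
      IsOpen W ∧ frontier Ω ⊆ W ∧ ∀ x ∈ W, 1 ≤ lapl S x := by
  have hK : IsCompact (frontier Ω) :=
    Metric.isCompact_of_isClosed_isBounded isClosed_frontier
      (hΩ.2.2.1.closure.subset frontier_subset_closure)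
  choose! S hS hS0 hSl O hO hSO using fun x₀ (hx₀ : x₀ ∈ frontier Ω) =>
    exists_local_subharmonic hΩ hx₀
  obtain ⟨T, hT, hcov⟩ := hK.elim_nhds_subcover O hO
  have hT2 : ∀ j ∈ T, ContDiff ℝ 2 (S j) := fun j hj => hS j (hT j hj)
  have hsum : ContDiff ℝ 2 fun x => ∑ j ∈ T, S j x := ContDiff.sum hT2
  have hpos : ∀ x ∈ frontier Ω, 0 < lapl (fun x => ∑ j ∈ T, S j x) x := by
    intro x hx
    rw [lapl_sum T hT2]
    obtain ⟨j, hj, hxj⟩ := mem_iUnion₂.1 (hcov hx)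
    exact Finset.sum_pos' (fun i hi => hSl i (hT i hi) x hx) ⟨j, hj, hSO j (hT j hj) x hx hxj⟩
  have hc : Continuous fun x => lapl (fun x => ∑ j ∈ T, S j x) x := hsum.continuous_lapl
  obtain ⟨c, hc0, hcle⟩ : ∃ c, 0 < c ∧ ∀ x ∈ frontier Ω, c ≤ lapl (fun x => ∑ j ∈ T, S j x) x := by
    rcases (frontier Ω).eq_empty_or_nonempty with h | h
    · exact ⟨1, one_pos, by simp [h]⟩
    · obtain ⟨x, hx, hmin⟩ := hK.exists_isMinOn h hc.continuousOn
      exact ⟨_, hpos x hx, fun y hy => hmin hy⟩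
  refine ⟨fun x => 2 / c * ∑ j ∈ T, S j x, {x | c / 2 < lapl (fun x => ∑ j ∈ T, S j x) x},
    contDiff_const.mul hsum, fun x hx => ?_, isOpen_lt continuous_const hc,
    fun x hx => (half_lt_self hc0).trans_le (hcle x hx), fun x hx => ?_⟩
  · beta_reduce
    rw [Finset.sum_eq_zero fun j hj => hS0 j (hT j hj) x hx, mul_zero]
  · rw [lapl_const_mul _ hsum]
    have hx' : c / 2 < lapl (fun x => ∑ j ∈ T, S j x) x := hx
    calc (1 : ℝ) = 2 / c * (c / 2) := by field_simp
      _ ≤ _ := mul_le_mul_of_nonneg_left hx'.le (by positivity)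

theorem IsSol.nonneg (hN : N ≠ 0) {Ω : Set (Eucl N)} (hΩ : IsOpen Ω)
    (hb : Bornology.IsBounded Ω) {p lam α : ℝ} {ψ : Eucl N → ℝ} (hsol : IsSol Ω p lam α ψ) :
    ∀ x ∈ closure Ω, 0 ≤ ψ x :=
  nonneg_of_superharmonic hN hΩ hb hsol.1
    (fun x hx => by
      have := hsol.2.1 x hx
      have : 0 ≤ max (α + lam * ψ x) 0 ^ p := Real.rpow_nonneg (le_max_right _ _) _
      linarith)
    fun x hx => (hsol.2.2.1 x hx).ge

theorem hasCorrection_of_pos (hN : N ≠ 0) {Ω : Set (Eucl N)} (hΩ : IsOpen Ω)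
    (hb : Bornology.IsBounded Ω) {p lam α M : ℝ} (hp : 1 < p) {ψ : Eucl N → ℝ}
    (hsol : IsSol Ω p lam α ψ) (hlam : 0 ≤ lam) (hM : 0 < M) (hα : 0 < α) :
    HasCorrection Ω p M fun x => α + lam * ψ x := by
  refine ⟨0, 1, 1, α / (2 * M), le_rfl, one_pos, one_pos, by positivity, fun t ht htα =>
    ⟨fun _ => 0, contDiff_const, fun _ _ => rfl, fun x hx => ?_⟩⟩
  have hψ := hsol.nonneg hN hΩ hb x (subset_closure hx)
  have hv : α ≤ α + lam * ψ x := le_add_of_nonneg_right (mul_nonneg hlam hψ)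
  have hm : max (α + lam * ψ x) 0 = α + lam * ψ x := max_eq_left (hα.le.trans hv)
  simp only [lapl_const, abs_zero, mul_zero, zero_mul, le_refl, implies_true, and_true, add_zero]
  rw [hm]
  have h1 := rpow_succ_eq (p := p - 1) (by linarith) (hα.le.trans hv)
  rw [sub_add_cancel] at h1
  rw [h1]
  have h2 : t * M ≤ (α + lam * ψ x) / 2 := by
    rw [lt_div_iff₀ (by positivity)] at htα
    linarith
  have h3 : 0 ≤ (α + lam * ψ x) ^ (p - 1) := Real.rpow_nonneg (hα.le.trans hv) _
  calc _ ≤ (α + lam * ψ x) / 2 * (α + lam * ψ x) ^ (p - 1) := mul_le_mul_of_nonneg_right h2 h3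
    _ = _ := by ring

/-- Where the density is of size at most `t`, the first variation is of size `t ^ p`;
elsewhere it is dominated by the density. -/
theorem first_variation_le {p M t u : ℝ} (hp : 1 < p) (hM : 0 < M) (ht : 0 < t) (hu : 0 ≤ u) :
    t * M * u ^ (p - 1) ≤ M * (2 * M) ^ (p - 1) * t ^ p ∨ t * M * u ^ (p - 1) ≤ u ^ p / 2 := by
  have e : ∀ s : ℝ, 0 ≤ s → s ^ p = s * s ^ (p - 1) := fun s hs => by
    rw [← rpow_succ_eq (by linarith) hs, sub_add_cancel]
  have hu1 : 0 ≤ u ^ (p - 1) := Real.rpow_nonneg hu _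
  rcases le_total u (2 * M * t) with h | h
  · left
    have := Real.rpow_le_rpow hu h (by linarith : 0 ≤ p - 1)
    rw [Real.mul_rpow (by positivity) ht.le] at this
    calc _ ≤ t * M * ((2 * M) ^ (p - 1) * t ^ (p - 1)) :=
          mul_le_mul_of_nonneg_left this (by positivity)
      _ = _ := by rw [e t ht.le]; ring
  · right
    calc _ ≤ u / 2 * u ^ (p - 1) := mul_le_mul_of_nonneg_right (by linarith) hu1
      _ = _ := by rw [e u hu]; ring

/-- Where the density is bounded below, the first variation is small. -/
theorem first_variation_le_of_ge {p M t u c : ℝ} (hp : 1 < p) (hM : 0 < M) (hc : 0 < c)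
    (hcu : c ≤ u) (ht : t < c / (4 * M)) : t * M * u ^ (p - 1) ≤ u ^ p / 4 := by
  have hu : 0 < u := hc.trans_le hcu
  rw [lt_div_iff₀ (by positivity)] at ht
  have e : u ^ p = u * u ^ (p - 1) := by
    rw [← rpow_succ_eq (by linarith) hu.le, sub_add_cancel]
  calc _ ≤ u / 4 * u ^ (p - 1) := mul_le_mul_of_nonneg_right (by linarith) (by positivity)
    _ = _ := by rw [e]; ring

theorem hasCorrection_of_zero {Ω : Set (Eucl N)} (hΩ : IsC3Domain Ω)
    {p M : ℝ} (hp : 1 < p) (hM : 0 < M) {v : Eucl N → ℝ} (hv : Continuous v)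
    (hpos : ∀ x ∈ Ω, 0 < v x) :
    HasCorrection Ω p M v := by
  obtain ⟨S, W, hS, hS0, hW, hfW, hSW⟩ := exists_boundary_subharmonic hΩ
  obtain ⟨CS, hCS, hCSb⟩ := exists_abs_le_of_isBounded hΩ.2.2.1 hS.continuous_lapl
  obtain ⟨c, hc, hcv⟩ : ∃ c, 0 < c ∧ ∀ x ∈ Ω, x ∉ W → c ≤ v x := by
    have hK : IsCompact (closure Ω \ W) := hΩ.2.2.1.isCompact_closure.diff hW
    have hKΩ : closure Ω \ W ⊆ Ω := fun x hx => by
      by_contra h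
      exact hx.2 (hfW (hΩ.1.frontier_eq ▸ ⟨hx.1, h⟩))
    rcases (closure Ω \ W).eq_empty_or_nonempty with h | h
    · exact ⟨1, one_pos, fun x hx hxW => (h.subset ⟨subset_closure hx, hxW⟩).elim⟩
    · obtain ⟨x, hx, hmin⟩ := hK.exists_isMinOn h hv.continuousOn
      exact ⟨_, hpos x (hKΩ hx), fun y hy hyW => hmin ⟨subset_closure hy, hyW⟩⟩
  set A := M * (2 * M) ^ (p - 1) with hA
  have hA0 : 0 < A := by positivity
  refine ⟨A * CS, p - 1, 1, min 1 (min (c / (4 * M)) (c ^ p / (4 * (A * CS + 1)))), by positivity,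
    by linarith, one_pos, by positivity, fun t ht htm => ?_⟩
  obtain ⟨ht1, ht2⟩ := lt_min_iff.1 htm
  obtain ⟨ht2, ht3⟩ := lt_min_iff.1 ht2
  refine ⟨fun x => -(A * t ^ p) * S x, contDiff_const.mul hS, fun x hx => by simp [hS0 x hx],
    fun x hx => ?_⟩
  have hl : lapl (fun x => -(A * t ^ p) * S x) x = -(A * t ^ p * lapl S x) := by
    rw [lapl_const_mul _ hS]; ring
  have hSx := hCSb x (subset_closure hx)
  have habs : |lapl (fun x => -(A * t ^ p) * S x) x| ≤ A * CS * t ^ p := by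
    rw [hl, abs_neg, abs_mul, abs_of_pos (by positivity)]
    calc _ ≤ A * t ^ p * CS := mul_le_mul_of_nonneg_left hSx (by positivity)
      _ = _ := by ring
  have hvx := hpos x hx
  refine ⟨?_, by rwa [add_sub_cancel], fun _ => habs, ?_⟩
  · rw [hl, max_eq_left hvx.le]
    by_cases hxW : x ∈ W
    · have h1 : A * t ^ p ≤ A * t ^ p * lapl S x :=
        le_mul_of_one_le_right (by positivity) (hSW x hxW)
      have h2 : 0 ≤ v x ^ p := by positivity
      have h3 : 0 < A * t ^ p := by positivity
      rcases first_variation_le hp hM ht hvx.le with h | h <;> linarith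
    · have hcx := hcv x hx hxW
      have h1 := first_variation_le_of_ge hp hM hc hcx ht2
      have h2 : c ^ p ≤ v x ^ p := Real.rpow_le_rpow hc.le hcx (by linarith)
      rw [hl] at habs
      have h3 := (le_abs_self _).trans habs
      have h4 : t ^ p ≤ t := by
        simpa using Real.rpow_le_rpow_of_exponent_ge ht ht1.le hp.le
      rw [lt_div_iff₀ (by positivity)] at ht3
      have h5 : A * CS * t ^ p ≤ A * CS * t := mul_le_mul_of_nonneg_left h4 (by positivity)
      linarith
  · rw [max_eq_right (by linarith), zero_mul]
    positivity

end Corrections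

section LocalSweeping

variable {N : ℕ}

theorem hasDerivAt_max_rpow {p : ℝ} (hp : 0 < p) (s : ℝ) :
    HasDerivAt (fun s : ℝ => max s 0 ^ (p + 1)) ((p + 1) * max s 0 ^ p) s := by
  have key : ∀ s : ℝ, 0 ≤ s → HasDerivAt (fun s : ℝ => s ^ (p + 1)) ((p + 1) * s ^ p) s := by
    intro s _
    have := Real.hasDerivAt_rpow_const (x := s) (p := p + 1) (Or.inr (by linarith))
    rwa [add_sub_cancel_right] at this
  have hR : ∀ s : ℝ, 0 ≤ s →
      HasDerivWithinAt (fun s : ℝ => max s 0 ^ (p + 1)) ((p + 1) * s ^ p) (Ici 0) s := fun s hs =>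
    (key s hs).hasDerivWithinAt.congr (fun x hx => by rw [max_eq_left hx]) (by rw [max_eq_left hs])
  have hL : ∀ s : ℝ, s ≤ 0 →
      HasDerivWithinAt (fun s : ℝ => max s 0 ^ (p + 1)) 0 (Iic 0) s := fun s hs =>
    (hasDerivWithinAt_const s (Iic 0) (0 : ℝ)).congr
      (fun x hx => by rw [max_eq_right hx, Real.zero_rpow (by linarith)])
      (by rw [max_eq_right hs, Real.zero_rpow (by linarith)])
  rcases lt_trichotomy s 0 with h | h | h
  · rw [max_eq_right h.le, Real.zero_rpow hp.ne', mul_zero]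
    exact (hL s h.le).hasDerivAt (Iic_mem_nhds h)
  · subst h
    have h1 := hR 0 le_rfl
    rw [Real.zero_rpow hp.ne', mul_zero] at h1
    have h2 := (hL 0 le_rfl).union h1
    rw [Iic_union_Ici, hasDerivWithinAt_univ] at h2
    simpa [Real.zero_rpow hp.ne'] using h2
  · rw [max_eq_left h.le]
    exact (hR s h.le).hasDerivAt (Ici_mem_nhds h)

/-- Near a free boundary point the positive set contains balls of comparable size. -/
theorem exists_corkscrew_at {v : Eucl N → ℝ} (hv : ContDiff ℝ 2 v) {lam p : ℝ} (hlam : 0 ≤ lam)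
    (hp : 1 < p) {O : Set (Eucl N)} (hO : IsOpen O)
    (heq : ∀ x ∈ O, lapl v x = -(lam * max (v x) 0 ^ p)) {x₀ : Eucl N} (hx₀ : x₀ ∈ O)
    (h0 : v x₀ = 0) (hne : x₀ ∈ closure {x | 0 < v x}) :
    ∃ B : ℝ, 1 ≤ B ∧ ∀ ε > 0, ∃ r, 0 < r ∧ r < ε ∧ ∃ z : Eucl N, ‖z‖ ≤ 4 * r ∧
      ∀ y ∈ closedBall z (r / B), 0 < v (x₀ + y) := by
  obtain ⟨ρ, hρ, hρO⟩ := Metric.isOpen_iff.1 hO x₀ hx₀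
  obtain ⟨K, hK, hKb⟩ := exists_abs_le_of_isBounded (isBounded_ball (x := x₀) (r := ρ))
    hv.continuous
  have hmem : ∀ x ∈ ball (0 : Eucl N) ρ, x₀ + x ∈ ball x₀ ρ := fun x hx => by simpa using hx
  have hp0 : 0 < p := by linarith
  have hlapl : ∀ x, lapl (fun y => v (x₀ + y)) x = lapl v (x₀ + x) := fun x => by
    simpa using lapl_comp_affine hv x₀ 1 x
  have hbound : ∀ s : ℝ, |s| ≤ K → max s 0 ^ p ≤ K ^ (p - 1) * |s| := by
    intro s hs
    have h1 : max s 0 ≤ |s| := max_le (le_abs_self s) (abs_nonneg s)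
    have h2 : max s 0 ^ (p - 1) ≤ K ^ (p - 1) :=
      Real.rpow_le_rpow (le_max_right _ _) (h1.trans hs) (by linarith)
    have h3 := rpow_succ_eq (p := p - 1) (by linarith) (le_max_right s 0)
    rw [sub_add_cancel] at h3
    rw [h3, mul_comm]
    exact mul_le_mul h2 h1 (le_max_right _ _) (by positivity)
  refine exists_corkscrew (v := fun y => v (x₀ + y)) (g := fun s => lam * max s 0 ^ p)
    (G := fun s => lam / (p + 1) * max s 0 ^ (p + 1)) (L := lam * K ^ (p - 1)) (ρ := ρ)
    (hv.comp (contDiff_const.add contDiff_id)) ?_ (fun s => ?_) hρ (fun x hx => ?_)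
    (fun x hx => ?_) (fun x hx => ?_) (fun x hx => ?_) (fun ε hε => ?_) (by simpa using h0)
  · exact continuous_const.mul
      ((continuous_id.max continuous_const).rpow_const fun _ => Or.inr hp0.le)
  · refine ((hasDerivAt_max_rpow hp0 s).const_mul (lam / (p + 1))).congr_deriv ?_
    field_simp
  · rw [hlapl, heq _ (hρO (hmem x hx))]
  · exact mul_nonneg hlam (Real.rpow_nonneg (le_max_right _ _) _)
  · rw [abs_of_nonneg (mul_nonneg hlam (Real.rpow_nonneg (le_max_right _ _) _)), mul_assoc]
    exact mul_le_mul_of_nonneg_left (hbound _ (hKb _ (subset_closure (hmem x hx)))) hlam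
  · have h1 := hbound _ (hKb _ (subset_closure (hmem x hx)))
    have h2 : max (v (x₀ + x)) 0 ≤ |v (x₀ + x)| := max_le (le_abs_self _) (abs_nonneg _)
    rw [abs_of_nonneg (by positivity), rpow_succ_eq hp0 (le_max_right _ _)]
    have h3 : lam / (p + 1) ≤ lam := div_le_self hlam (by linarith)
    have h4 := mul_le_mul h2 h1 (by positivity) (abs_nonneg _)
    calc _ ≤ lam * (|v (x₀ + x)| * (K ^ (p - 1) * |v (x₀ + x)|)) :=
          mul_le_mul h3 h4 (by positivity) hlam
      _ = lam * K ^ (p - 1) * |v (x₀ + x)| ^ 2 := by ring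
      _ = _ := by rw [sq_abs]
  · obtain ⟨y, hy, hd⟩ := Metric.mem_closure_iff.1 hne ε hε
    refine ⟨y - x₀, by rwa [dist_comm, dist_eq_norm] at hd, ?_⟩
    simpa using (ne_of_gt hy : v y ≠ 0)

/-- Approximate inverse Laplacians of indicator functions near a free boundary point, whose
error is concentrated where `v` is bounded below. -/
theorem exists_local_sweeping {v : Eucl N → ℝ} (hv : Continuous v) {p γ R B' : ℝ} (hγ : 0 < γ)
    (hR : 0 < R) {x₀ : Eucl N} (hB : 1 ≤ B')
    (hcork : ∀ ε > 0, ∃ r, 0 < r ∧ r < ε ∧ ∃ z : Eucl N, ‖z‖ ≤ 4 * r ∧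
      ∀ y ∈ closedBall z (r / B'), 0 < v (x₀ + y)) :
    ∃ ρ C c t₀ : ℝ, 0 < ρ ∧ 0 ≤ C ∧ 0 < c ∧ 0 < t₀ ∧ ∀ (t τ : ℝ) (S : Set (Eucl N)), 0 < t →
      t < t₀ → 0 < τ → τ ≤ ρ → MeasurableSet S → S ⊆ ball x₀ ρ → ∃ η f : Eucl N → ℝ,
        ContDiff ℝ 2 η ∧ (∀ x, 2 * R ≤ dist x x₀ → η x = 0) ∧ (∀ x, f x ∈ Icc (0 : ℝ) 1) ∧
        (∀ x, ball x τ ⊆ S → f x = 1) ∧ (∀ x, Disjoint (ball x τ) S → f x = 0) ∧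
        (∀ x, |lapl η x + f x| ≤ C * t ^ (-γ)) ∧
        ∀ x, v x < c → |lapl η x + f x| ≤ C * t ^ p := by
  obtain ⟨B1, hB1, hsweep⟩ := exists_sweeping N (B := 4 * B') (by linarith)
  have hB10 : 0 < B1 := by linarith
  obtain ⟨s, hs⟩ := exists_nat_ge (p / γ)
  rw [div_le_iff₀ hγ] at hs
  obtain ⟨r, hr, hrε, z, hz, hzv⟩ := hcork (min (R / 32) (R / (4 * B1 * B1 ^ s))) (by positivity)
  obtain ⟨hr1, hr2⟩ := lt_min_iff.1 hrε
  obtain ⟨c, hc, hcv⟩ : ∃ c, 0 < c ∧ ∀ y ∈ closedBall z (r / B'), c ≤ v (x₀ + y) := by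
    have hcont : Continuous fun y => v (x₀ + y) := hv.comp (continuous_const.add continuous_id)
    obtain ⟨y, hy, hmin⟩ := (isCompact_closedBall z (r / B')).exists_isMinOn
      (nonempty_closedBall.2 (by positivity)) hcont.continuousOn
    exact ⟨_, hzv y hy, fun y' hy' => hmin hy'⟩
  have hdR : B1 * (4 * r) / R ≤ (B1 ^ s)⁻¹ := by
    rw [lt_div_iff₀ (by positivity)] at hr2
    rw [div_le_iff₀ hR, inv_mul_eq_div, le_div_iff₀ (by positivity)]
    linarith
  refine ⟨4 * r / (4 * (4 * B')), B1 ^ s, c, min 1 ((B1 ^ 3) ^ (-γ⁻¹)), by positivity,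
    by positivity, hc, by positivity, fun t τ S ht htt hτ hτρ hS hSρ => ?_⟩
  obtain ⟨ht1, ht2⟩ := lt_min_iff.1 htt
  have htγ : B1 ^ 3 < t ^ (-γ) := by
    have := Real.rpow_lt_rpow_of_neg ht ht2 (neg_neg_of_pos hγ)
    rwa [← Real.rpow_mul (by positivity), neg_mul_neg, inv_mul_cancel₀ hγ.ne', Real.rpow_one]
      at this
  obtain ⟨m, hm1, hm2⟩ := exists_nat_pow_near
    ((one_le_pow₀ (n := 3) hB1.le).trans htγ.le) hB1
  have hm3 : 3 ≤ m := by
    have := (pow_lt_pow_iff_right₀ hB1).1 (htγ.trans hm2)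
    omega
  have hsmall : (B1 * (4 * r) / R) ^ m ≤ B1 ^ s * t ^ p := by
    have h1 : (t ^ (-γ)) ^ s ≤ (B1 ^ (m + 1)) ^ s := by gcongr
    have h2 : (t ^ (-γ)) ^ s * t ^ (γ * s) = 1 := by
      rw [← Real.rpow_natCast, ← Real.rpow_mul ht.le, ← Real.rpow_add ht]
      simp
    have h3 : t ^ (γ * s) ≤ t ^ p :=
      Real.rpow_le_rpow_of_exponent_ge ht ht1.le (by linarith)
    have h4 : 0 < t ^ (γ * s) := by positivity
    calc _ ≤ ((B1 ^ s)⁻¹) ^ m := pow_le_pow_left₀ (by positivity) hdR m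
      _ = ((B1 ^ m) ^ s)⁻¹ := by rw [inv_pow, ← pow_mul, ← pow_mul, mul_comm]
      _ ≤ B1 ^ s * t ^ (γ * s) := by
        rw [inv_le_iff_one_le_mul₀ (by positivity), ← h2]
        calc _ ≤ (B1 ^ (m + 1)) ^ s * t ^ (γ * s) := mul_le_mul_of_nonneg_right h1 h4.le
          _ = _ := by rw [pow_succ, mul_pow]; ring
      _ ≤ _ := mul_le_mul_of_nonneg_left h3 (by positivity)
  have hshift : ∀ y : Eucl N, -x₀ + (1 : ℝ) • y = y - x₀ := fun y => by rw [one_smul]; abel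
  have hball : ∀ x y : Eucl N, y ∈ ball (x - x₀) τ ↔ x₀ + y ∈ ball x τ := fun x y => by
    rw [mem_ball, mem_ball, dist_eq_norm, dist_eq_norm]
    congr! 2
    abel
  obtain ⟨η, f, hη, hη0, hf, hf1, hf0, he1, he2⟩ := hsweep R (4 * r) τ z ((fun y => x₀ + y) ⁻¹' S) m
    (by positivity) (by linarith) hz (hS.preimage (measurable_const_add x₀))
    (fun y hy => by simpa using hSρ hy) hτ hτρ hm3
  have hlap : ∀ x, lapl (fun y => η (-x₀ + (1 : ℝ) • y)) x = lapl η (x - x₀) := fun x => by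
    rw [lapl_comp_affine hη, hshift, one_pow, one_mul]
  have habs : ∀ a b : ℝ, |a + b| = |-a - b| := fun a b => by rw [← abs_neg]; congr 1; ring
  refine ⟨fun y => η (-x₀ + (1 : ℝ) • y), fun y => f (y - x₀),
    hη.comp (contDiff_const.add (contDiff_id.const_smul (1 : ℝ))), fun x hx => ?_, fun x => hf _,
    fun x hx => hf1 _ fun y hy => hx ((hball x y).1 hy), fun x hx => hf0 _ ?_, fun x => ?_,
    fun x hx => ?_⟩
  · beta_reduce
    rw [hshift]
    exact hη0 _ (by rwa [← dist_eq_norm])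
  · rw [Set.disjoint_left] at hx ⊢
    exact fun y hy => hx ((hball x y).1 hy)
  · rw [hlap, habs]
    refine (he1 _).trans (hm1.trans (le_mul_of_one_le_left (by positivity) (one_le_pow₀ hB1.le)))
  · rw [hlap, habs]
    refine (he2 _ fun hmem => ?_).trans hsmall
    rw [mul_div_mul_left _ _ (by norm_num : (4 : ℝ) ≠ 0)] at hmem
    have := hcv _ hmem
    rw [add_sub_cancel] at this
    linarith

end LocalSweeping

section GlobalSweeping

variable {N : ℕ}

/-- On `W` there are functions with Laplacian close to minus the indicator of the set where
`v` is of size `t`, supported in `Ω ∩ {v > -δ}`. -/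
def HasSweeping (Ω : Set (Eucl N)) (v : Eucl N → ℝ) (p γ M δ : ℝ) (W : Set (Eucl N)) : Prop :=
  ∃ C c t₀ : ℝ, 0 ≤ C ∧ 0 < c ∧ 0 < t₀ ∧ ∀ t, 0 < t → t < t₀ → ∃ η F : Eucl N → ℝ,
    ContDiff ℝ 2 η ∧ (∀ x ∈ frontier Ω, η x = 0) ∧ ∀ x ∈ Ω, 0 ≤ F x ∧ F x ≤ C ∧
      (x ∈ W → |v x| < 2 * M * t → 1 ≤ F x) ∧ (4 * M * t ≤ |v x| → F x = 0) ∧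
      |lapl η x + F x| ≤ C * t ^ (-γ) ∧ (v x < c → |lapl η x + F x| ≤ C * t ^ p) ∧
      (v x ≤ -δ → lapl η x = 0 ∧ F x = 0)

theorem HasSweeping.mono {Ω : Set (Eucl N)} {v : Eucl N → ℝ} {p γ M δ : ℝ} {W W' : Set (Eucl N)}
    (h : HasSweeping Ω v p γ M δ W) (hW : W' ⊆ W) : HasSweeping Ω v p γ M δ W' := by
  obtain ⟨C, c, t₀, hC, hc, ht₀, h⟩ := h
  refine ⟨C, c, t₀, hC, hc, ht₀, fun t ht htt => ?_⟩
  obtain ⟨η, F, hη, hη0, h⟩ := h t ht htt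
  refine ⟨η, F, hη, hη0, fun x hx => ?_⟩
  obtain ⟨h1, h2, h3, h4⟩ := h x hx
  exact ⟨h1, h2, fun hxW => h3 (hW hxW), h4⟩

theorem hasSweeping_empty (Ω : Set (Eucl N)) (v : Eucl N → ℝ) (p γ M δ : ℝ) :
    HasSweeping Ω v p γ M δ ∅ :=
  ⟨0, 1, 1, le_rfl, one_pos, one_pos, fun t _ _ => ⟨fun _ => 0, fun _ => 0, contDiff_const,
    fun _ _ => rfl, fun x _ => by simp [lapl_const]⟩⟩

theorem HasSweeping.union {Ω : Set (Eucl N)} {v : Eucl N → ℝ} {p γ M δ : ℝ} {W W' : Set (Eucl N)}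
    (h : HasSweeping Ω v p γ M δ W) (h' : HasSweeping Ω v p γ M δ W') :
    HasSweeping Ω v p γ M δ (W ∪ W') := by
  obtain ⟨C, c, t₀, hC, hc, ht₀, h⟩ := h
  obtain ⟨C', c', t₀', hC', hc', ht₀', h'⟩ := h'
  refine ⟨C + C', min c c', min t₀ t₀', by positivity, lt_min hc hc', lt_min ht₀ ht₀',
    fun t ht htt => ?_⟩
  obtain ⟨η, F, hη, hη0, h⟩ := h t ht (lt_min_iff.1 htt).1
  obtain ⟨η', F', hη', hη0', h'⟩ := h' t ht (lt_min_iff.1 htt).2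
  refine ⟨fun x => η x + η' x, fun x => F x + F' x, hη.add hη',
    fun x hx => by simp [hη0 x hx, hη0' x hx], fun x hx => ?_⟩
  obtain ⟨a1, a2, a3, a4, a5, a6, a7⟩ := h x hx
  obtain ⟨b1, b2, b3, b4, b5, b6, b7⟩ := h' x hx
  rw [lapl_add hη hη']
  have habs : |lapl η x + lapl η' x + (F x + F' x)| ≤ |lapl η x + F x| + |lapl η' x + F' x| := by
    rw [add_add_add_comm]
    exact abs_add_le _ _
  refine ⟨by positivity, by linarith, ?_, fun hv => by simp [a4 hv, b4 hv], ?_, fun hv => ?_,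
    fun hv => by simp [a7 hv, b7 hv]⟩
  · rintro (hW | hW) hv
    · linarith [a3 hW hv]
    · linarith [b3 hW hv]
  · linarith
  · have := a6 (lt_min_iff.1 hv).1
    have := b6 (lt_min_iff.1 hv).2
    linarith

theorem exists_hasSweeping_ball {Ω : Set (Eucl N)} (hΩ : IsOpen Ω) (hb : Bornology.IsBounded Ω)
    {v : Eucl N → ℝ} (hv : ContDiff ℝ 2 v) {lam p γ M δ : ℝ} (hlam : 0 ≤ lam) (hp : 1 < p)
    (hγ : 0 < γ) (hM : 0 < M) (hδ : 0 < δ) (heq : ∀ x ∈ Ω, lapl v x = -(lam * max (v x) 0 ^ p))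
    {x₀ : Eucl N} (hx₀ : x₀ ∈ Ω) (h0 : v x₀ = 0) (hne : x₀ ∈ closure {x | 0 < v x}) :
    ∃ ρ, 0 < ρ ∧ HasSweeping Ω v p γ M δ (ball x₀ ρ) := by
  have hvc := hv.continuous
  obtain ⟨R₀, hR₀, hRΩ⟩ := Metric.isOpen_iff.1
    (hΩ.inter (isOpen_lt (continuous_const (y := -δ)) hvc)) x₀ ⟨hx₀, by simpa [h0] using hδ⟩
  obtain ⟨B', hB', hcork⟩ := exists_corkscrew_at hv hlam hp hΩ heq hx₀ h0 hne
  obtain ⟨ρ, C, c, t₀, hρ, hC, hc, ht₀, hsw⟩ := exists_local_sweeping hvc (p := p) hγ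
    (R := R₀ / 3) (by positivity) hB' hcork
  refine ⟨ρ / 2, by positivity, C + 1, c, min t₀ (δ / (4 * M)), by positivity, hc, by positivity,
    fun t ht htt => ?_⟩
  obtain ⟨htt1, htt2⟩ := lt_min_iff.1 htt
  rw [lt_div_iff₀ (by positivity)] at htt2
  obtain ⟨τ₀, hτ₀, hunif⟩ : ∃ τ, 0 < τ ∧ ∀ x ∈ Ω, ∀ y ∈ ball x τ, |v x - v y| < M * t := by
    have := hb.isCompact_closure.uniformContinuousAt_of_continuousAt v
      (fun a _ => hvc.continuousAt) (Metric.dist_mem_uniformity (by positivity : 0 < M * t))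
    obtain ⟨τ, hτ, hu⟩ := Metric.mem_uniformity_dist.1 this
    refine ⟨τ, hτ, fun x hx y hy => ?_⟩
    have := hu (by rwa [mem_ball, dist_comm] at hy) (subset_closure hx)
    rwa [mem_ofPred_eq, Real.dist_eq] at this
  have hSo : IsOpen (ball x₀ ρ ∩ {x | |v x| < 3 * M * t}) :=
    isOpen_ball.inter (isOpen_lt hvc.abs continuous_const)
  obtain ⟨η, f, hη, hη0, hf, hf1, hf0, he1, he2⟩ := hsw t (min τ₀ (ρ / 2))
    (ball x₀ ρ ∩ {x | |v x| < 3 * M * t}) ht htt1 (by positivity)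
    ((min_le_right _ _).trans (by linarith)) hSo.measurableSet inter_subset_left
  have hτ : ∀ x ∈ Ω, ∀ y ∈ ball x (min τ₀ (ρ / 2)), |v x - v y| < M * t := fun x hx y hy =>
    hunif x hx y (ball_subset_ball (min_le_left _ _) hy)
  have hfz : ∀ x ∈ Ω, 4 * M * t ≤ |v x| → f x = 0 := fun x hx hvx => hf0 x (by
    rw [Set.disjoint_left]
    intro y hy hyS
    have h1 := hτ x hx y hy
    have h2 : |v y| < 3 * M * t := hyS.2
    have h3 := abs_sub_abs_le_abs_sub (v x) (v y)
    linarith)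
  refine ⟨η, f, hη, fun x hx => hη0 x ?_, fun x hx => ⟨(hf x).1, by linarith [(hf x).2],
    fun hxW hvx => (hf1 x fun y hy => ⟨?_, ?_⟩).ge, hfz x hx, ?_, fun hvc => ?_, fun hvx => ⟨?_, ?_⟩⟩⟩
  · by_contra! h
    have : x ∈ ball x₀ R₀ := by rw [mem_ball]; linarith
    exact (hΩ.frontier_eq ▸ hx).2 (hRΩ this).1
  · have h1 := mem_ball.1 (ball_subset_ball (min_le_right _ _) hy)
    have h2 := mem_ball.1 hxW
    exact mem_ball.2 (by linarith [dist_triangle y x x₀])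
  · have h1 := hτ x hx y hy
    have h3 := abs_sub_abs_le_abs_sub (v y) (v x)
    rw [abs_sub_comm] at h3
    show |v y| < 3 * M * t
    linarith
  · have : 0 < t ^ (-γ) := by positivity
    linarith [he1 x]
  · have : 0 < t ^ p := by positivity
    linarith [he2 x hvc]
  · have hx' : x ∈ (closedBall x₀ (2 * (R₀ / 3)))ᶜ := fun h => by
      have : x ∈ ball x₀ R₀ := by
        rw [mem_closedBall] at h
        rw [mem_ball]
        linarith
      exact absurd (hRΩ this).2 (not_lt.2 hvx)
    have : η =ᶠ[nhds x] fun _ => 0 := by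
      filter_upwards [isClosed_closedBall.isOpen_compl.mem_nhds hx'] with y hy
      refine hη0 y ?_
      rw [mem_compl_iff, mem_closedBall, not_le] at hy
      exact hy.le
    rw [lapl_congr_of_eventuallyEq this, lapl_const]
  · refine hfz x hx ?_
    have := neg_le_abs (v x)
    linarith

/-- The zero level on the boundary of the positive set is covered by a sweeping. -/
theorem exists_hasSweeping {Ω : Set (Eucl N)} (hΩ : IsOpen Ω) (hb : Bornology.IsBounded Ω)
    {v : Eucl N → ℝ} (hv : ContDiff ℝ 2 v) {lam p γ M δ : ℝ} (hlam : 0 ≤ lam) (hp : 1 < p)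
    (hγ : 0 < γ) (hM : 0 < M) (hδ : 0 < δ) (heq : ∀ x ∈ Ω, lapl v x = -(lam * max (v x) 0 ^ p))
    (hfr : ∀ x ∈ frontier Ω, v x < 0) :
    ∃ (W : Set (Eucl N)) (c : ℝ), 0 < c ∧ (∀ x ∈ Ω, 0 < v x → v x < c → x ∈ W) ∧
      HasSweeping Ω v p γ M δ W := by
  have hvc : Continuous fun x => v x := hv.continuous
  have hP : IsCompact (closure (Ω ∩ {x | 0 < v x})) := (hb.subset inter_subset_left).isCompact_closure
  have hPv : ∀ x ∈ closure (Ω ∩ {x | 0 < v x}), 0 ≤ v x := fun x hx =>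
    closure_minimal (fun y hy => le_of_lt (hy.2 : 0 < v y)) (isClosed_le continuous_const hvc) hx
  have hZ : IsCompact (closure (Ω ∩ {x | 0 < v x}) ∩ {x | v x = 0}) :=
    hP.inter_right (isClosed_eq hvc continuous_const)
  obtain ⟨W, hWo, hZW, hW⟩ : ∃ W, IsOpen W ∧ closure (Ω ∩ {x | 0 < v x}) ∩ {x | v x = 0} ⊆ W ∧
      HasSweeping Ω v p γ M δ W := by
    refine hZ.induction_on (p := fun s => ∃ W, IsOpen W ∧ s ⊆ W ∧ HasSweeping Ω v p γ M δ W)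
      ⟨∅, isOpen_empty, le_rfl, hasSweeping_empty _ _ _ _ _ _⟩ ?_ ?_ ?_
    · rintro s t hst ⟨W, hWo, htW, hW⟩
      exact ⟨W, hWo, hst.trans htW, hW⟩
    · rintro s t ⟨W, hWo, htW, hW⟩ ⟨W', hWo', htW', hW'⟩
      exact ⟨W ∪ W', hWo.union hWo', union_subset_union htW htW', hW.union hW'⟩
    · rintro x ⟨hx, hx0⟩
      have hx0' : v x = 0 := hx0
      have hxΩ : x ∈ Ω := by
        by_contra h
        have : x ∈ frontier Ω := hΩ.frontier_eq ▸ ⟨closure_mono inter_subset_left hx, h⟩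
        exact (hfr x this).ne hx0'
      obtain ⟨ρ, hρ, hs⟩ := exists_hasSweeping_ball hΩ hb hv hlam hp hγ hM hδ heq hxΩ hx0'
        (closure_mono inter_subset_right hx)
      exact ⟨ball x ρ, mem_nhdsWithin_of_mem_nhds (ball_mem_nhds x hρ), ball x ρ, isOpen_ball,
        le_rfl, hs⟩
  have hK : IsCompact (closure (Ω ∩ {x | 0 < v x}) \ W) := hP.diff hWo
  rcases (closure (Ω ∩ {x | 0 < v x}) \ W).eq_empty_or_nonempty with h | h
  · refine ⟨W, 1, one_pos, fun x hx h0 _ => ?_, hW⟩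
    by_contra hxW
    exact h.subset ⟨subset_closure ⟨hx, h0⟩, hxW⟩
  · obtain ⟨x, hx, hmin⟩ := hK.exists_isMinOn h hvc.continuousOn
    refine ⟨W, v x, (hPv x hx.1).lt_of_ne fun h => hx.2 (hZW ⟨hx.1, h.symm⟩),
      fun y hy h0 hyc => ?_, hW⟩
    by_contra hyW
    exact absurd (hmin ⟨subset_closure ⟨hy, h0⟩, hyW⟩ : v x ≤ v y) (not_le.2 hyc)

/-- A function vanishing on the boundary, superharmonic, and uniformly so where `ψ` is
bounded below. -/
theorem exists_superharmonic {Ω : Set (Eucl N)} (hN : N ≠ 0)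
    (hb : Bornology.IsBounded Ω) {ψ : Eucl N → ℝ} (hψ : ContDiff ℝ 2 ψ)
    (hψ0 : ∀ x ∈ frontier Ω, ψ x = 0) (hl : ∀ x ∈ Ω, lapl ψ x ≤ 0) {β : ℝ} (hβ : 0 < β) :
    ∃ S : Eucl N → ℝ, ContDiff ℝ 2 S ∧ (∀ x ∈ frontier Ω, S x = 0) ∧ (∀ x ∈ Ω, lapl S x ≤ 0) ∧
      ∀ x ∈ Ω, β ≤ ψ x → lapl S x ≤ -1 := by
  obtain ⟨E, hE, hEb⟩ := exists_abs_le_of_isBounded hb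
    (f := fun x : Eucl N => ‖x‖ ^ 2) (by fun_prop)
  set A := (E + 1) / β with hA
  have hA0 : 0 < A := by positivity
  have hsq : ContDiff ℝ 2 fun x : Eucl N => ‖x‖ ^ 2 := contDiff_norm_sq ℝ
  have hw0 : ContDiff ℝ 2 fun x : Eucl N => A * ψ x + ‖x‖ ^ 2 := (contDiff_const.mul hψ).add hsq
  have hw : ContDiff ℝ 2 fun x : Eucl N => A * ψ x + ‖x‖ ^ 2 + -E := hw0.add contDiff_const
  set w := fun x : Eucl N => A * ψ x + ‖x‖ ^ 2 + -E with hwdef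
  have hlw : ∀ x, lapl w x = A * lapl ψ x + 2 * N := fun x => by
    rw [hwdef, lapl_add hw0 contDiff_const, lapl_add (contDiff_const.mul hψ) hsq,
      lapl_const_mul _ hψ, lapl_norm_sq, lapl_const, add_zero]
  obtain ⟨K, hK, hKb⟩ := exists_abs_le_of_isBounded hb hw.continuous
  have hcube : ContDiff ℝ 2 fun x => posPow 3 (w x) := (contDiff_posPow_two (k := 2) le_rfl).comp hw
  have hlcube : ∀ x, lapl (fun x => posPow 3 (w x)) x =
      6 * posPow 1 (w x) * ∑ i, pd i w x ^ 2 + 3 * posPow 2 (w x) * (A * lapl ψ x + 2 * N) := by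
    intro x
    have h3 : ∀ s, HasDerivAt (posPow 3) (3 * posPow 2 s) s := fun s =>
      (hasDerivAt_posPow (k := 2) (by norm_num) s).congr_deriv (by norm_num)
    have h2 : ∀ s, HasDerivAt (fun s => 3 * posPow 2 s) (6 * posPow 1 s) s := fun s =>
      ((hasDerivAt_posPow (k := 1) le_rfl s).const_mul 3).congr_deriv (by push_cast; ring)
    rw [lapl_comp h3 h2 hw, hlw]
  have hN1 : (1 : ℝ) ≤ N := by exact_mod_cast Nat.one_le_iff_ne_zero.2 hN
  have hlS : ∀ x ∈ Ω, lapl (fun x => 3 * A * K ^ 2 * ψ x - posPow 3 (w x)) x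
      ≤ -(6 * posPow 2 (w x)) := by
    intro x hx
    rw [lapl_sub (contDiff_const.mul hψ) hcube, lapl_const_mul _ hψ, hlcube]
    have h1 : posPow 2 (w x) ≤ K ^ 2 := by
      have h := hKb x (subset_closure hx)
      exact pow_le_pow_left₀ (le_max_right _ _) (max_le ((le_abs_self _).trans h) hK) 2
    have h2 : 0 ≤ 6 * posPow 1 (w x) * ∑ i, pd i w x ^ 2 :=
      mul_nonneg (mul_nonneg (by norm_num) (posPow_nonneg _ _))
        (Finset.sum_nonneg fun i _ => sq_nonneg _)
    have h3 := posPow_nonneg 2 (w x)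
    have h4 : (3 * A * (K ^ 2 - posPow 2 (w x))) * lapl ψ x ≤ 0 :=
      mul_nonpos_of_nonneg_of_nonpos (mul_nonneg (by positivity) (by linarith)) (hl x hx)
    have h5 := mul_le_mul_of_nonneg_left hN1 h3
    linarith
  refine ⟨fun x => 3 * A * K ^ 2 * ψ x - posPow 3 (w x), (contDiff_const.mul hψ).sub hcube,
    fun x hx => ?_, fun x hx => ?_, fun x hx hβx => ?_⟩
  · have h1 := hEb x (frontier_subset_closure hx)
    have h2 : w x ≤ 0 := by
      simp only [hwdef, hψ0 x hx]
      linarith [(le_abs_self _).trans h1]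
    simp [hψ0 x hx, posPow_of_nonpos h2]
  · linarith [hlS x hx, posPow_nonneg 2 (w x)]
  · have h1 : 1 ≤ w x := by
      have : E + 1 ≤ A * ψ x := by
        calc E + 1 = A * β := by rw [hA]; field_simp
          _ ≤ _ := mul_le_mul_of_nonneg_left hβx hA0.le
      simp only [hwdef]
      linarith [sq_nonneg ‖x‖]
    have h2 : 1 ≤ posPow 2 (w x) := by
      rw [posPow_of_nonneg (by linarith)]
      exact one_le_pow₀ h1
    linarith [hlS x hx]

end GlobalSweeping

section NegativeLevel

variable {N : ℕ}

theorem hasCorrection_of_neg (hN : N ≠ 0) {Ω : Set (Eucl N)} (hΩ : IsOpen Ω)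
    (hb : Bornology.IsBounded Ω) {p lam α M : ℝ} (hp : 1 < p) {ψ : Eucl N → ℝ}
    (hsol : IsSol Ω p lam α ψ) (hlam : 0 < lam) (hM : 0 < M) (hα : α < 0) :
    HasCorrection Ω p M fun x => α + lam * ψ x := by
  obtain ⟨hψ, hψl, hψ0, -⟩ := hsol
  have hv : ContDiff ℝ 2 fun x => α + lam * ψ x := contDiff_const.add (contDiff_const.mul hψ)
  have hlψ : ∀ x ∈ Ω, lapl ψ x ≤ 0 := fun x hx => by
    have := hψl x hx
    have : 0 ≤ max (α + lam * ψ x) 0 ^ p := Real.rpow_nonneg (le_max_right _ _) _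
    linarith
  have heq : ∀ x ∈ Ω, lapl (fun x => α + lam * ψ x) x = -(lam * max (α + lam * ψ x) 0 ^ p) :=
    fun x hx => by
      rw [lapl_add contDiff_const (contDiff_const.mul hψ), lapl_const, lapl_const_mul _ hψ,
        ← hψl x hx]
      ring
  have hγ : 0 < (p - 1) / 2 := by linarith
  obtain ⟨W, c₂, hc₂, hW, C, c₁, t₁, hC, hc₁, ht₁, hsw⟩ := exists_hasSweeping hΩ hb hv
    (M := M) (δ := -α / 2) hlam.le hp hγ hM (by linarith) heq
    (fun x hx => by simpa [hψ0 x hx] using hα)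
  obtain ⟨S, hS, hS0, hSl, hS1⟩ := exists_superharmonic hN hb hψ hψ0 hlψ
    (β := -α / (2 * lam)) (div_pos (by linarith) (by positivity))
  obtain ⟨CS, hCS, hCSb⟩ := exists_abs_le_of_isBounded hb hS.continuous_lapl
  obtain ⟨K, hK, hKb⟩ := exists_abs_le_of_isBounded hb hv.continuous
  set γ := (p - 1) / 2 with hγdef
  set A := M * (2 * M) ^ (p - 1) with hA
  have hA0 : 0 < A := by positivity
  set C' := 2 * A * C + A * C * CS with hC'
  have hC'0 : 0 ≤ C' := by positivity
  have hmin0 : 0 < min c₁ c₂ := lt_min hc₁ hc₂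
  set c := min c₁ c₂ with hc
  refine ⟨C' + 4 * M * A * C + K * (A * C + A * C * CS), γ, c, min (min 1 t₁)
    (min (c / (4 * M)) (c ^ p / (4 * (C' + 1)))), by positivity, hγ, hmin0, by positivity,
    fun t ht htm => ?_⟩
  obtain ⟨htm1, htm2⟩ := lt_min_iff.1 htm
  obtain ⟨ht1, htt₁⟩ := lt_min_iff.1 htm1
  obtain ⟨htc, htc'⟩ := lt_min_iff.1 htm2
  obtain ⟨η, F, hη, hη0, h⟩ := hsw t ht htt₁
  have hmono : ∀ a b : ℝ, b ≤ a → t ^ a ≤ t ^ b := fun a b hab =>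
    Real.rpow_le_rpow_of_exponent_ge ht ht1.le hab
  refine ⟨fun x => A * t ^ p * η x + A * C * (t ^ p * t ^ p) * S x,
    (contDiff_const.mul hη).add (contDiff_const.mul hS), fun x hx => by simp [hη0 x hx, hS0 x hx],
    fun x hx => ?_⟩
  obtain ⟨hF0, hFC, hF1, hFz, he1, he2, hδ⟩ := h x hx
  have hSx := hCSb x (subset_closure hx)
  have hSl' := hSl x hx
  have htp : 0 < t ^ p := by positivity
  have htp1 : t ^ p ≤ 1 := by simpa using hmono p 0 (by linarith)
  have hl : lapl (fun x => A * t ^ p * η x + A * C * (t ^ p * t ^ p) * S x) x =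
      A * t ^ p * lapl η x + A * C * (t ^ p * t ^ p) * lapl S x := by
    rw [lapl_add (contDiff_const.mul hη) (contDiff_const.mul hS), lapl_const_mul _ hη,
      lapl_const_mul _ hS]
  rw [hl]
  set v := α + lam * ψ x with hvdef
  set ℓ := lapl η x with hℓ
  set s := lapl S x with hs
  have htri : |A * t ^ p * ℓ + A * C * (t ^ p * t ^ p) * s| ≤
      A * t ^ p * |ℓ + F x| + A * t ^ p * F x + A * C * CS * (t ^ p * t ^ p) := by
    have e : A * t ^ p * ℓ + A * C * (t ^ p * t ^ p) * s =
        A * t ^ p * (ℓ + F x) - A * t ^ p * F x + A * C * (t ^ p * t ^ p) * s := by ring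
    rw [e]
    refine (abs_add_le _ _).trans (add_le_add ((abs_sub _ _).trans ?_) ?_)
    · rw [abs_mul (A * t ^ p) (ℓ + F x), abs_mul (A * t ^ p) (F x),
        abs_of_pos (by positivity : 0 < A * t ^ p), abs_of_nonneg hF0]
    · rw [abs_mul, abs_of_nonneg (by positivity : 0 ≤ A * C * (t ^ p * t ^ p))]
      calc _ ≤ A * C * (t ^ p * t ^ p) * CS := mul_le_mul_of_nonneg_left hSx (by positivity)
        _ = _ := by ring
  have hpγ : t ^ p * t ^ (-γ) = t ^ (1 + γ) := by
    rw [← Real.rpow_add ht]; congr 1; rw [hγdef]; ring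
  have h1γ : t ^ p ≤ t ^ (1 + γ) := hmono _ _ (by rw [hγdef]; linarith)
  have hpp : t ^ p * t ^ p ≤ t ^ p := mul_le_of_le_one_left htp.le htp1
  have hbig : |A * t ^ p * ℓ + A * C * (t ^ p * t ^ p) * s| ≤ C' * t ^ (1 + γ) := by
    have e1 : A * t ^ p * |ℓ + F x| ≤ A * C * t ^ (1 + γ) := by
      calc _ ≤ A * t ^ p * (C * t ^ (-γ)) := mul_le_mul_of_nonneg_left he1 (by positivity)
        _ = A * C * (t ^ p * t ^ (-γ)) := by ring
        _ = _ := by rw [hpγ]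
    have e2 : A * t ^ p * F x ≤ A * C * t ^ (1 + γ) := by
      calc _ ≤ A * t ^ p * C := mul_le_mul_of_nonneg_left hFC (by positivity)
        _ = A * C * t ^ p := by ring
        _ ≤ _ := mul_le_mul_of_nonneg_left h1γ (by positivity)
    have e3 : A * C * CS * (t ^ p * t ^ p) ≤ A * C * CS * t ^ (1 + γ) :=
      mul_le_mul_of_nonneg_left (hpp.trans h1γ) (by positivity)
    have e4 : C' * t ^ (1 + γ) = A * C * t ^ (1 + γ) + A * C * t ^ (1 + γ)
      + A * C * CS * t ^ (1 + γ) := by rw [hC']; ring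
    linarith
  have hC1 : C' ≤ C' + 4 * M * A * C + K * (A * C + A * C * CS) := by
    have : 0 ≤ 4 * M * A * C + K * (A * C + A * C * CS) := by positivity
    linarith
  have hsm : v < c → A * t ^ p * |ℓ + F x| ≤ A * C * (t ^ p * t ^ p) := fun hvc => by
    calc _ ≤ A * t ^ p * (C * t ^ p) :=
          mul_le_mul_of_nonneg_left (he2 (hvc.trans_le (min_le_left _ _))) (by positivity)
      _ = _ := by ring
  have hnn : v < c → A * t ^ p * F x ≤ -(A * t ^ p * ℓ + A * C * (t ^ p * t ^ p) * s) := by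
    intro hvc
    have hD : 0 ≤ A * C * (t ^ p * t ^ p) := by positivity
    by_cases hvδ : v ≤ -(-α / 2)
    · rw [(hδ hvδ).1, (hδ hvδ).2]
      have := mul_nonpos_of_nonneg_of_nonpos hD hSl'
      linarith
    · have hs1 : s ≤ -1 := hS1 x hx (by
        rw [div_le_iff₀ (by positivity)]
        push Not at hvδ
        linarith)
      have h1 := mul_le_mul_of_nonneg_left hs1 hD
      have h2 : A * t ^ p * (ℓ + F x) ≤ A * t ^ p * |ℓ + F x| :=
        mul_le_mul_of_nonneg_left (le_abs_self _) (by positivity)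
      linarith [hsm hvc]
  refine ⟨?_, hbig.trans (mul_le_mul_of_nonneg_right hC1 (by positivity)), fun hvc => ?_, ?_⟩
  · rcases le_or_gt c v with hcv | hcv
    · have hv0 : 0 < v := hmin0.trans_le hcv
      rw [max_eq_left hv0.le]
      have h1 := first_variation_le_of_ge hp hM hmin0 hcv htc
      have h2 : c ^ p ≤ v ^ p := Real.rpow_le_rpow hmin0.le hcv (by linarith)
      have h3 := (le_abs_self _).trans hbig
      have h4 : t ^ (1 + γ) ≤ t := by simpa using hmono (1 + γ) 1 (by linarith)
      rw [lt_div_iff₀ (by positivity)] at htc'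
      have h5 : C' * t ^ (1 + γ) ≤ C' * t := mul_le_mul_of_nonneg_left h4 hC'0
      linarith
    · have h1 := hnn hcv
      have h2 : 0 ≤ A * t ^ p * F x := by positivity
      rcases le_or_gt v 0 with hv0 | hv0
      · rw [max_eq_right hv0, Real.zero_rpow (by linarith), Real.zero_rpow (by linarith)]
        linarith
      · rw [max_eq_left hv0.le]
        have hxW := hW x hx hv0 (hcv.trans_le (min_le_right _ _))
        rcases lt_or_ge v (2 * M * t) with hvt | hvt
        · have hF := hF1 hxW (by rwa [abs_of_pos hv0])
          have h3 : A * t ^ p ≤ A * t ^ p * F x := le_mul_of_one_le_right (by positivity) hF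
          have h4 : 0 < A * t ^ p := by positivity
          have h5 : 0 < v ^ p := by positivity
          rcases first_variation_le hp hM ht hv0.le with h | h <;> linarith
        · have e : v ^ p = v * v ^ (p - 1) := by
            rw [← rpow_succ_eq (by linarith) hv0.le, sub_add_cancel]
          have h3 : t * M * v ^ (p - 1) ≤ v / 2 * v ^ (p - 1) :=
            mul_le_mul_of_nonneg_right (by linarith) (by positivity)
          rw [e]
          linarith
  · have e1 : A * t ^ p * F x ≤ A * C * t ^ p := by
      calc _ ≤ A * t ^ p * C := mul_le_mul_of_nonneg_left hFC (by positivity)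
        _ = _ := by ring
    have e2 : A * C * (t ^ p * t ^ p) ≤ A * C * t ^ p :=
      mul_le_mul_of_nonneg_left hpp (by positivity)
    have e3 : A * C * CS * (t ^ p * t ^ p) ≤ A * C * CS * t ^ p :=
      mul_le_mul_of_nonneg_left hpp (by positivity)
    have e4 : C' * t ^ p = A * C * t ^ p + A * C * t ^ p + A * C * CS * t ^ p := by rw [hC']; ring
    refine le_trans ?_ (mul_le_mul_of_nonneg_right hC1 htp.le)
    linarith [hsm hvc]
  · rcases le_or_gt 0 v with hv0 | hv0
    · rw [max_eq_right (by linarith), zero_mul]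
      positivity
    · rw [max_eq_left (by linarith)]
      have hKx : -v ≤ K := (neg_le_abs v).trans (hKb x (subset_closure hx))
      have h1 := hsm (hv0.trans hmin0)
      have e1 : t ^ p * t ^ p ≤ t ^ (2 + γ) := by
        rw [← Real.rpow_add ht]
        exact hmono _ _ (by rw [hγdef]; linarith)
      have e2 : t * t ^ p ≤ t ^ (2 + γ) := by
        rw [← rpow_succ_eq (by linarith) ht.le]
        exact hmono _ _ (by rw [hγdef]; linarith)
      have e3 : -v * (A * t ^ p * F x) ≤ 4 * M * A * C * t ^ (2 + γ) := by
        rcases le_or_gt (4 * M * t) |v| with hvt | hvt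
        · rw [hFz hvt]
          simp only [mul_zero]
          positivity
        · have h2 : -v ≤ 4 * M * t := (neg_le_abs v).trans hvt.le
          calc _ ≤ 4 * M * t * (A * t ^ p * C) := mul_le_mul h2
                (mul_le_mul_of_nonneg_left hFC (by positivity)) (by positivity) (by positivity)
            _ = 4 * M * A * C * (t * t ^ p) := by ring
            _ ≤ _ := mul_le_mul_of_nonneg_left e2 (by positivity)
      have e4 : -v * (A * C * (t ^ p * t ^ p) + A * C * CS * (t ^ p * t ^ p)) ≤
          K * (A * C + A * C * CS) * t ^ (2 + γ) := by
        calc _ ≤ K * (A * C * (t ^ p * t ^ p) + A * C * CS * (t ^ p * t ^ p)) :=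
              mul_le_mul_of_nonneg_right hKx (by positivity)
          _ = K * (A * C + A * C * CS) * (t ^ p * t ^ p) := by ring
          _ ≤ _ := mul_le_mul_of_nonneg_left e1 (by positivity)
      have e5 : 0 ≤ C' * t ^ (2 + γ) := by positivity
      calc _ ≤ -v * (A * C * (t ^ p * t ^ p) + A * t ^ p * F x + A * C * CS * (t ^ p * t ^ p)) :=
            mul_le_mul_of_nonneg_left (htri.trans (by linarith)) (by linarith)
        _ = -v * (A * t ^ p * F x) + -v * (A * C * (t ^ p * t ^ p) + A * C * CS * (t ^ p * t ^ p)) :=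
            by ring
        _ ≤ _ := by linarith

theorem hasCorrection_of_isSol (hN : N ≠ 0) {Ω : Set (Eucl N)} (hΩ : IsC3Domain Ω)
    {p lam α M : ℝ} (hp : 1 < p) {ψ : Eucl N → ℝ} (hsol : IsSol Ω p lam α ψ) (hlam : 0 < lam)
    (hM : 0 < M) : HasCorrection Ω p M fun x => α + lam * ψ x := by
  rcases lt_trichotomy α 0 with h | h | h
  · exact hasCorrection_of_neg hN hΩ.1 hΩ.2.2.1 hp hsol hlam hM h
  · subst h
    refine hasCorrection_of_zero hΩ hp hM
      (continuous_const.add (continuous_const.mul hsol.1.continuous)) fun x hx => ?_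
    have hψ := hsol.nonneg hN hΩ.1 hΩ.2.2.1
    have hne : ψ x ≠ 0 := by
      intro h0
      have hz := eq_zero_of_superharmonic hΩ.1 hΩ.2.1.isPreconnected hsol.1
        (fun y hy => by
          have := hsol.2.1 y hy
          have : 0 ≤ max (0 + lam * ψ y) 0 ^ p := Real.rpow_nonneg (le_max_right _ _) _
          linarith)
        (fun y hy => hψ y (subset_closure hy)) hx h0
      have h1 := hsol.2.2.2
      rw [setIntegral_congr_fun hΩ.1.measurableSet (g := fun _ => 0) fun y hy => by
        simp [hz y hy, Real.zero_rpow (by linarith : p ≠ 0)]] at h1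
      simp at h1
    have := (hψ x (subset_closure hx)).lt_of_ne hne.symm
    simpa using mul_pos hlam this
  · exact hasCorrection_of_pos hN hΩ.1 hΩ.2.2.1 hp hsol hlam.le hM h

end NegativeLevel

theorem stmt15 (N : ℕ) (hN : 2 ≤ N) (Ω : Set (EuclideanSpace ℝ (Fin N)))
    (hΩ : IsC3Domain Ω) (hvol : volume Ω = 1) (p : ℝ) (hp1 : 1 < p)
    (hpN : N = 2 ∨ p < (N : ℝ) / ((N : ℝ) - 2))
    (lam : ℝ) (hlam : 0 ≤ lam) (α : ℝ) (ψ : EuclideanSpace ℝ (Fin N) → ℝ)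
    (hsol : IsSol Ω p lam α ψ)
    (hvar : ∀ ρ : EuclideanSpace ℝ (Fin N) → ℝ, Measurable ρ →
      (∀ᵐ x ∂(volume.restrict Ω), 0 ≤ ρ x) → (∫ x in Ω, ρ x) = 1 →
      IntegrableOn (fun x => ρ x ^ (1 + 1 / p)) Ω volume →
      ∀ w : EuclideanSpace ℝ (Fin N) → ℝ, ContDiff ℝ 2 w →
        (∀ x ∈ frontier Ω, w x = 0) → (∀ x ∈ Ω, -lapl w x = ρ x) →
        (p / (p + 1)) * (∫ x in Ω, ((max (α + lam * ψ x) 0) ^ p) ^ (1 + 1 / p)) -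
            (lam / 2) * (∫ x in Ω, (max (α + lam * ψ x) 0) ^ p * ψ x) ≤
          (p / (p + 1)) * (∫ x in Ω, ρ x ^ (1 + 1 / p)) -
            (lam / 2) * (∫ x in Ω, ρ x * w x)) :
    ∀ σ : ℝ, IsEigen Ω p lam α ψ σ → 0 ≤ σ := by
  rintro σ ⟨φ, hφ, ⟨xφ, hxφ, hφne⟩, hφ0, heig⟩
  by_contra! hσ
  have hN0 : N ≠ 0 := by omega
  obtain ⟨hΩo, -, hb, -⟩ := id hΩ
  obtain ⟨hψ, -, -, hmass⟩ := id hsol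
  have hv : Continuous fun x => α + lam * ψ x := continuous_const.add (continuous_const.mul hψ.continuous)
  have hV : Continuous (Vfun p lam α ψ) := continuous_max_rpow hv (by linarith)
  have hV0 : ∀ x, 0 ≤ Vfun p lam α ψ x := fun x => Real.rpow_nonneg (le_max_right _ _) _
  set V := Vfun p lam α ψ with hVdef
  set a := avgV Ω p lam α ψ φ with ha
  have hφc := hφ.continuous
  have hm : 0 < mV Ω p lam α ψ := by
    obtain ⟨x, hx, hxv⟩ : ∃ x ∈ Ω, 0 < α + lam * ψ x := by
      by_contra! h
      rw [setIntegral_congr_fun hΩo.measurableSet (g := fun _ => 0) fun y hy => by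
        simp [h y hy, Real.zero_rpow (by linarith : p ≠ 0)]] at hmass
      simp at hmass
    exact setIntegral_pos_of_continuous hΩo hb hV (fun x _ => hV0 x) hx
      (Real.rpow_pos_of_pos (lt_max_of_lt_left hxv) _)
  have hintegral : ∫ x in Ω, V x * (φ x - a) = 0 := by
    have j1 : IntegrableOn (fun x => V x * φ x) Ω := (hV.mul hφc).integrableOn_of_isBounded hb
    have j2 : IntegrableOn (fun x => V x * a) Ω :=
      (hV.mul continuous_const).integrableOn_of_isBounded hb
    have e : ∀ x, V x * (φ x - a) = V x * φ x - V x * a := fun x => mul_sub _ _ _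
    simp only [e]
    rw [integral_sub j1 j2, integral_mul_const, ha, avgV]
    have : ∫ x in Ω, V x = mV Ω p lam α ψ := rfl
    rw [this]
    field_simp
    simp [hVdef]
  rcases le_or_gt (p * lam + σ) 0 with hμ | hμ
  · exact hφne (eq_zero_of_eigen_nonpos hN0 hΩo hb hV hV0 hφ hφ0 hμ heig hintegral xφ hxφ)
  have hlam0 : 0 < lam := by
    rcases hlam.eq_or_lt with h | h
    · rw [← h] at hμ
      linarith
    · exact h
  set μ := p * lam + σ with hμdef
  have hq : Continuous fun x => φ x - a := hφc.sub continuous_const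
  have hX : 0 < ∫ x in Ω, V x * (φ x - a) ^ 2 := by
    have hcX : Continuous fun x => V x * (φ x - a) ^ 2 := hV.mul (hq.pow 2)
    have hX0 : ∀ x ∈ Ω, 0 ≤ V x * (φ x - a) ^ 2 := fun x _ => mul_nonneg (hV0 x) (sq_nonneg _)
    refine (setIntegral_nonneg hΩo.measurableSet hX0).lt_of_ne fun h => ?_
    refine hφne (eq_zero_of_lapl_eq_zero hN0 hΩo hb hφ hφ0 (fun x hx => ?_) xφ hxφ)
    have h1 := eq_zero_of_setIntegral_eq_zero hΩo hb hcX hX0 h.symm hx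
    have h2 : V x * (φ x - a) = 0 := by
      rcases mul_eq_zero.1 h1 with h | h
      · rw [h, zero_mul]
      · rw [pow_eq_zero_iff two_ne_zero] at h
        rw [h, mul_zero]
    have h3 := heig x hx
    rw [h2, mul_zero] at h3
    linarith
  obtain ⟨M, hM, hMb⟩ := exists_abs_le_of_isBounded hb hq
  have hvi := variational_inequality hN0 hΩo hb hvol hp1 hsol hvar
    (φ := fun x => 1 / μ * φ x) (q := fun x => φ x - a) (contDiff_const.mul hφ)
    (fun x hx => by simp [hφ0 x hx]) hq
    (fun x hx => by
      rw [lapl_const_mul _ hφ, ← mul_neg, heig x hx, ← mul_assoc, one_div_mul_cancel hμ.ne', one_mul]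
      rfl)
    hintegral (M := M + 1) (fun x hx => (hMb x (subset_closure hx)).trans (by linarith))
    (hasCorrection_of_isSol hN0 hΩ hp1 hsol hlam0 (by linarith))
  have e1 : ∫ x in Ω, max (α + lam * ψ x) 0 ^ (p - 1) * (φ x - a) * (1 / μ * φ x) =
      1 / μ * ∫ x in Ω, V x * (φ x - a) ^ 2 := by
    have j1 : IntegrableOn (fun x => V x * (φ x - a) ^ 2) Ω :=
      (hV.mul (hq.pow 2)).integrableOn_of_isBounded hb
    have j2 : IntegrableOn (fun x => a * (V x * (φ x - a))) Ω :=
      (continuous_const.mul (hV.mul hq)).integrableOn_of_isBounded hb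
    have e : ∀ x, max (α + lam * ψ x) 0 ^ (p - 1) * (φ x - a) * (1 / μ * φ x) =
        1 / μ * (V x * (φ x - a) ^ 2 + a * (V x * (φ x - a))) := fun x => by
      simp only [hVdef, Vfun]
      ring
    simp only [e]
    rw [integral_const_mul, integral_add j1 j2, integral_const_mul, hintegral, mul_zero, add_zero]
  have e2 : ∫ x in Ω, 1 / (2 * p) * (max (α + lam * ψ x) 0 ^ (p - 1) * (φ x - a) ^ 2) =
      1 / (2 * p) * ∫ x in Ω, V x * (φ x - a) ^ 2 := integral_const_mul _ _
  rw [e1, e2, ← mul_assoc] at hvi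
  have h1 := le_of_mul_le_mul_right hvi hX
  have hp0 : 0 < p := by linarith
  have h2 : lam / 2 * (1 / μ) = lam / (2 * μ) := by field_simp
  rw [h2, div_le_div_iff₀ (by positivity) (by positivity)] at h1
  linarith

end
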